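/- Let n ≥ 2 and let (u,v) be a solution of the elliptic system Δu = u v², Δv = v u², u > 0, v > 0 on ℝⁿ. If (u,v) is a local minimizer and there exists a constant C > 0 such that u(x) + v(x) ≤ C(1 + |x|) for all x ∈ ℝⁿ, then (u,v) is one dimensional, i.e. there exist a unit vector e ∈ ℝⁿ and functions f, g : ℝ → ℝ such that u(x) = f(x·e) and v(x) = g(x·e) for all x ∈ ℝⁿ. -/

import Mathlib

open MeasureTheory Metric
open scoped RealInnerProductSpace

noncomputable section

/-- The Laplacian of a function on Euclidean space, as the trace of the second derivative. -/
def lap {n : ℕ} (u : EuclideanSpace ℝ (Fin n) → ℝ) (x : EuclideanSpace ℝ (Fin n)) : ℝ :=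
  ∑ i : Fin n, iteratedFDeriv ℝ 2 u x (fun _ => EuclideanSpace.single i 1)

/-- A (positive classical) solution of the system Δu = u v², Δv = v u², u,v > 0 on ℝⁿ. -/
def IsSolution {n : ℕ} (u v : EuclideanSpace ℝ (Fin n) → ℝ) : Prop :=
  ContDiff ℝ (⊤ : ℕ∞) u ∧ ContDiff ℝ (⊤ : ℕ∞) v ∧ (∀ x, 0 < u x) ∧ (∀ x, 0 < v x) ∧
    (∀ x, lap u x = u x * v x ^ 2) ∧ (∀ x, lap v x = v x * u x ^ 2)

/-- The energy of a pair of functions on the ball B_R(0). -/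
def energy {n : ℕ} (u v : EuclideanSpace ℝ (Fin n) → ℝ) (R : ℝ) : ℝ :=
  ∫ y in ball (0 : EuclideanSpace ℝ (Fin n)) R,
    (‖gradient u y‖ ^ 2 + ‖gradient v y‖ ^ 2 + (u y) ^ 2 * (v y) ^ 2)

/-- A local minimizer: any smooth competitor coinciding with (u,v) outside a ball has no
smaller energy on that ball. -/
def IsLocalMinimizer {n : ℕ} (u v : EuclideanSpace ℝ (Fin n) → ℝ) : Prop :=
  ∀ R > (0 : ℝ), ∀ ub vb : EuclideanSpace ℝ (Fin n) → ℝ,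
    ContDiff ℝ (⊤ : ℕ∞) ub → ContDiff ℝ (⊤ : ℕ∞) vb →
    (∀ x ∉ ball (0 : EuclideanSpace ℝ (Fin n)) R, ub x = u x ∧ vb x = v x) →
    energy u v R ≤ energy ub vb R

section Calculus

/-- Euclidean space. -/
abbrev Eu (n : ℕ) := EuclideanSpace ℝ (Fin n)

/-- Smoothness of real functions. -/
abbrev Smooth {n : ℕ} (f : Eu n → ℝ) : Prop := ContDiff ℝ (⊤ : ℕ∞) f

/-- Partial derivative. -/
def pd {n : ℕ} (i : Fin n) (f : Eu n → ℝ) (x : Eu n) : ℝ :=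
  fderiv ℝ f x (EuclideanSpace.single i 1)

variable {n : ℕ} {f g : Eu n → ℝ} {i j : Fin n} {x : Eu n}

theorem Smooth.diff (hf : Smooth f) : Differentiable ℝ f := hf.differentiable (by simp)

theorem Smooth.pd (hf : Smooth f) (i : Fin n) : Smooth (pd i f) := by
  unfold _root_.pd
  exact (hf.fderiv_right (m := (⊤ : ℕ∞)) (by simp)).clm_apply contDiff_const

theorem Smooth.coord (i : Fin n) : Smooth (fun x : Eu n => x i) :=
  (EuclideanSpace.proj (𝕜 := ℝ) i).contDiff

theorem pd_add (hf : Smooth f) (hg : Smooth g) :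
    pd i (fun y => f y + g y) x = pd i f x + pd i g x := by
  unfold pd
  rw [fderiv_fun_add (hf.diff x) (hg.diff x)]; rfl

theorem pd_sub (hf : Smooth f) (hg : Smooth g) :
    pd i (fun y => f y - g y) x = pd i f x - pd i g x := by
  unfold pd
  rw [fderiv_fun_sub (hf.diff x) (hg.diff x)]; rfl

theorem pd_const (c : ℝ) : pd i (fun _ => c) x = 0 := by
  unfold pd; simp

theorem pd_mul (hf : Smooth f) (hg : Smooth g) :
    pd i (fun y => f y * g y) x = f x * pd i g x + g x * pd i f x := by
  unfold pd
  rw [fderiv_fun_mul (hf.diff x) (hg.diff x)]; simp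

theorem pd_const_mul (c : ℝ) (hf : Smooth f) :
    pd i (fun y => c * f y) x = c * pd i f x := by
  rw [pd_mul contDiff_const hf, pd_const]; ring

theorem pd_sq (hf : Smooth f) : pd i (fun y => f y ^ 2) x = 2 * f x * pd i f x := by
  simp only [sq]; rw [pd_mul hf hf]; ring

theorem pd_sum {ι : Type*} (s : Finset ι) {F : ι → Eu n → ℝ} (hF : ∀ k ∈ s, Smooth (F k)) :
    pd i (fun y => ∑ k ∈ s, F k y) x = ∑ k ∈ s, pd i (F k) x := by
  unfold pd
  rw [fderiv_fun_sum (fun k hk => (hF k hk).diff x)]; simp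

theorem pd_comp {φ : ℝ → ℝ} (hφ : Differentiable ℝ φ) (hf : Smooth f) :
    pd i (fun y => φ (f y)) x = deriv φ (f x) * pd i f x := by
  unfold pd
  have := ((hφ (f x)).hasDerivAt.comp_hasFDerivAt x (hf.diff x).hasFDerivAt)
  rw [show (fun y => φ (f y)) = φ ∘ f from rfl, this.fderiv]; simp

theorem pd_coord : pd i (fun y : Eu n => y j) x = if i = j then 1 else 0 := by
  unfold pd
  have : (fun y : Eu n => y j) = EuclideanSpace.proj (𝕜 := ℝ) j := by ext; simp
  rw [this, ContinuousLinearMap.fderiv]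
  simp [eq_comm]

theorem pd_comm (hf : Smooth f) : pd i (pd j f) x = pd j (pd i f) x := by
  have h1 : IsSymmSndFDerivAt ℝ f x := (hf.contDiffAt).isSymmSndFDerivAt
    (by simp only [minSmoothness_of_isRCLikeNormedField]; exact WithTop.coe_le_coe.2 le_top)
  have hd : DifferentiableAt ℝ (fderiv ℝ f) x :=
    ((hf.fderiv_right (m := (⊤ : ℕ∞)) (by simp)).differentiable (by simp)) x
  unfold pd
  have key : ∀ a b : Eu n, fderiv ℝ (fun y => fderiv ℝ f y a) x b
      = fderiv ℝ (fderiv ℝ f) x b a := by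
    intro a b
    rw [fderiv_clm_apply hd (differentiableAt_const _)]; simp
  rw [key, key]
  exact h1 _ _

theorem lap_eq (hf : Smooth f) (x : Eu n) : lap f x = ∑ i, pd i (pd i f) x := by
  have hd : DifferentiableAt ℝ (fderiv ℝ f) x :=
    ((hf.fderiv_right (m := (⊤ : ℕ∞)) (by simp)).differentiable (by simp)) x
  unfold lap pd
  refine Finset.sum_congr rfl fun i _ => ?_
  rw [iteratedFDeriv_two_apply, fderiv_clm_apply hd (differentiableAt_const _)]; simp

theorem Smooth.lap (hf : Smooth f) : Smooth (lap f) := by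
  rw [show _root_.lap f = fun x => ∑ i, _root_.pd i (_root_.pd i f) x from funext (lap_eq hf)]
  exact ContDiff.sum fun i _ => (hf.pd i).pd i

theorem lap_add (hf : Smooth f) (hg : Smooth g) (x : Eu n) :
    lap (fun y => f y + g y) x = lap f x + lap g x := by
  rw [lap_eq hf, lap_eq hg, lap_eq (hf.add hg), ← Finset.sum_add_distrib]
  refine Finset.sum_congr rfl fun i _ => ?_
  rw [← pd_add (hf.pd i) (hg.pd i)]; congr 1; ext y; exact pd_add hf hg

theorem lap_const_mul (c : ℝ) (hf : Smooth f) (x : Eu n) :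
    lap (fun y => c * f y) x = c * lap f x := by
  rw [lap_eq hf, lap_eq (contDiff_const.mul hf), Finset.mul_sum]
  refine Finset.sum_congr rfl fun i _ => ?_
  rw [← pd_const_mul c (hf.pd i)]; congr 1; ext y; exact pd_const_mul c hf

theorem lap_sub (hf : Smooth f) (hg : Smooth g) (x : Eu n) :
    lap (fun y => f y - g y) x = lap f x - lap g x := by
  have := lap_add hf (contDiff_const (c := (-1 : ℝ)).mul hg) x
  rw [lap_const_mul _ hg] at this
  rw [show (fun y => f y - g y) = fun y => f y + (-1) * g y by ext; ring, this]; ring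

theorem lap_mul (hf : Smooth f) (hg : Smooth g) (x : Eu n) :
    lap (fun y => f y * g y) x = f x * lap g x + g x * lap f x
      + 2 * ∑ i, pd i f x * pd i g x := by
  rw [lap_eq hf, lap_eq hg, lap_eq (hf.mul hg), Finset.mul_sum, Finset.mul_sum, Finset.mul_sum,
    ← Finset.sum_add_distrib, ← Finset.sum_add_distrib]
  refine Finset.sum_congr rfl fun i _ => ?_
  have : pd i (fun y => f y * g y) = fun y => f y * pd i g y + g y * pd i f y := by
    ext y; exact pd_mul hf hg
  rw [this, pd_add (hf.mul (hg.pd i)) (hg.mul (hf.pd i)), pd_mul hf (hg.pd i),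
    pd_mul hg (hf.pd i)]; ring

theorem lap_sq (hf : Smooth f) (x : Eu n) :
    lap (fun y => f y ^ 2) x = 2 * f x * lap f x + 2 * ∑ i, pd i f x ^ 2 := by
  simp only [sq]; rw [lap_mul hf hf]; ring

theorem Smooth.affine (hf : Smooth f) (p : Eu n) (r : ℝ) : Smooth (fun y => f (p + r • y)) :=
  hf.comp (contDiff_const.add (contDiff_id.const_smul r))

theorem pd_affine (hf : Smooth f) (p : Eu n) (r : ℝ) (y : Eu n) :
    pd i (fun y => f (p + r • y)) y = r * pd i f (p + r • y) := by
  unfold pd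
  have h1 : HasFDerivAt (fun y : Eu n => p + r • y) (r • ContinuousLinearMap.id ℝ (Eu n)) y :=
    ((hasFDerivAt_id y).const_smul r).const_add p
  have := (hf.diff (p + r • y)).hasFDerivAt.comp y h1
  rw [show (fun y => f (p + r • y)) = f ∘ (fun y => p + r • y) from rfl, this.fderiv]
  simp

theorem pd_affine' (hf : Smooth f) (p : Eu n) (r : ℝ) :
    pd i (fun y => f (p + r • y)) = fun y => r * pd i f (p + r • y) :=
  funext fun y => pd_affine hf p r y

theorem lap_affine (hf : Smooth f) (p : Eu n) (r : ℝ) (y : Eu n) :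
    lap (fun y => f (p + r • y)) y = r ^ 2 * lap f (p + r • y) := by
  rw [lap_eq hf, lap_eq (hf.affine p r), Finset.mul_sum]
  refine Finset.sum_congr rfl fun i _ => ?_
  rw [pd_affine' hf, pd_const_mul r ((hf.pd i).affine p r), pd_affine (hf.pd i)]; ring

theorem fderiv_eq_sum (f : Eu n → ℝ) (x v : Eu n) : fderiv ℝ f x v = ∑ i, v i * pd i f x := by
  have hv : v = ∑ i, v i • (EuclideanSpace.single i (1 : ℝ) : Eu n) := by
    ext j; simp [Pi.single_apply]
  conv_lhs => rw [hv]
  rw [map_sum]; simp [pd]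

theorem hasDerivAt_ray (hf : Smooth f) (x y : Eu n) (t : ℝ) :
    HasDerivAt (fun s : ℝ => f (x + s • y)) (∑ i, y i * pd i f (x + t • y)) t := by
  rw [← fderiv_eq_sum]
  have h1 : HasDerivAt (fun s : ℝ => x + s • y) y t := by
    simpa using ((hasDerivAt_id t).smul_const y).const_add x
  exact (hf.diff (x + t • y)).hasFDerivAt.comp_hasDerivAt t h1

theorem gradient_norm_sq (f : Eu n → ℝ) (x : Eu n) :
    ‖gradient f x‖ ^ 2 = ∑ i, pd i f x ^ 2 := by
  rw [EuclideanSpace.norm_sq_eq]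
  refine Finset.sum_congr rfl fun i _ => ?_
  have : gradient f x i = pd i f x := by
    unfold pd
    rw [← toDual_gradient (𝕜 := ℝ), InnerProductSpace.toDual_apply_apply,
      EuclideanSpace.inner_single_right]
    simp
  rw [this]; simp


theorem integrable_mul_of_compact (hf : Continuous f) (hg : Continuous g)
    (hs : HasCompactSupport g) : Integrable (fun y => f y * g y) :=
  (hf.mul hg).integrable_of_hasCompactSupport hs.mul_left

theorem hasCompactSupport_pd (hs : HasCompactSupport f) : HasCompactSupport (pd i f) :=
  hs.fderiv_apply ℝ _

theorem integral_pd_mul (hf : Smooth f) (hg : Smooth g) (hs : HasCompactSupport g) (i : Fin n) :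
    ∫ y, pd i f y * g y = - ∫ y, f y * pd i g y := by
  have h := integral_mul_fderiv_eq_neg_fderiv_mul_of_integrable (𝕜 := ℝ)
    (μ := (volume : Measure (Eu n))) (f := f) (g := g) (v := EuclideanSpace.single i 1)
    (integrable_mul_of_compact (hf.pd i).continuous hg.continuous hs)
    (integrable_mul_of_compact hf.continuous (hg.pd i).continuous (hasCompactSupport_pd hs))
    (integrable_mul_of_compact hf.continuous hg.continuous hs)
    (fun x _ => hf.diff x) (fun x _ => hg.diff x)
  unfold pd; linarith

theorem integral_pd_eq_zero (hg : Smooth g) (hs : HasCompactSupport g) (i : Fin n) :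
    ∫ y, pd i g y = 0 := by
  have h := integral_pd_mul (contDiff_const (c := (1 : ℝ))) hg hs i
  simp only [pd_const, zero_mul, integral_zero, one_mul] at h
  linarith

theorem integral_sum_pd_mul_pd (hf : Smooth f) (hg : Smooth g) (hs : HasCompactSupport g) :
    ∫ y, ∑ i, pd i f y * pd i g y = - ∫ y, f y * lap g y := by
  have : ∀ y, f y * lap g y = ∑ i, f y * pd i (pd i g) y := fun y => by
    rw [lap_eq hg, Finset.mul_sum]
  simp_rw [this]
  rw [integral_finsetSum, integral_finsetSum, ← Finset.sum_neg_distrib]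
  · exact Finset.sum_congr rfl fun i _ => integral_pd_mul hf (hg.pd i) (hasCompactSupport_pd hs) i
  · exact fun i _ => integrable_mul_of_compact hf.continuous ((hg.pd i).pd i).continuous
      (hasCompactSupport_pd (hasCompactSupport_pd hs))
  · exact fun i _ => integrable_mul_of_compact (hf.pd i).continuous (hg.pd i).continuous
      (hasCompactSupport_pd hs)

theorem integral_lap_mul (hf : Smooth f) (hg : Smooth g) (hs : HasCompactSupport g) :
    ∫ y, lap f y * g y = ∫ y, f y * lap g y := by
  have h : ∫ y, ∑ i, pd i f y * pd i g y = - ∫ y, lap f y * g y := by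
    have : ∀ y, lap f y * g y = ∑ i, pd i (pd i f) y * g y := fun y => by
      rw [lap_eq hf, Finset.sum_mul]
    simp_rw [this]
    rw [integral_finsetSum, integral_finsetSum, ← Finset.sum_neg_distrib]
    · refine Finset.sum_congr rfl fun i _ => ?_
      rw [integral_pd_mul (hf.pd i) hg hs i, neg_neg]
    · exact fun i _ => integrable_mul_of_compact ((hf.pd i).pd i).continuous hg.continuous hs
    · exact fun i _ => integrable_mul_of_compact (hf.pd i).continuous (hg.pd i).continuous
        (hasCompactSupport_pd hs)
  have := integral_sum_pd_mul_pd hf hg hs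
  linarith

/-- Differentiation under the integral sign against a compactly supported kernel. -/
theorem hasDerivAt_integral_kernel {F F' : ℝ → Eu n → ℝ} {K : Eu n → ℝ}
    (hF : Continuous fun p : ℝ × Eu n => F p.1 p.2)
    (hF' : Continuous fun p : ℝ × Eu n => F' p.1 p.2)
    (hd : ∀ t y, HasDerivAt (fun s => F s y) (F' t y) t)
    (hK : Continuous K) (hs : HasCompactSupport K) (t : ℝ) :
    HasDerivAt (fun s => ∫ y, F s y * K y) (∫ y, F' t y * K y) t := by
  have hc : IsCompact (Set.Icc (t - 1) (t + 1) ×ˢ tsupport K) :=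
    isCompact_Icc.prod hs.isCompact
  obtain ⟨M, hM⟩ := hc.exists_bound_of_continuousOn hF'.continuousOn
  have hcF : ∀ s, Continuous (F s) := fun s => hF.comp (Continuous.prodMk continuous_const continuous_id)
  have hcF' : ∀ s, Continuous (F' s) := fun s => hF'.comp (Continuous.prodMk continuous_const continuous_id)
  refine (hasDerivAt_integral_of_dominated_loc_of_deriv_le (s := ball t 1)
    (bound := fun y => M * |K y|) (ball_mem_nhds t one_pos)
    (Filter.Eventually.of_forall fun s => ((hcF s).mul hK).aestronglyMeasurable)
    (integrable_mul_of_compact (hcF t) hK hs) ((hcF' t).mul hK).aestronglyMeasurable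
    (Filter.Eventually.of_forall fun y s hsb => ?_)
    ((hK.integrable_of_hasCompactSupport hs).abs.const_mul M)
    (Filter.Eventually.of_forall fun y s _ => (hd s y).mul_const (K y))).2
  rw [norm_mul, Real.norm_eq_abs (K y)]
  by_cases hy : y ∈ tsupport K
  · refine mul_le_mul_of_nonneg_right (hM (s, y) ⟨?_, hy⟩) (abs_nonneg _)
    rw [mem_ball, Real.dist_eq, abs_lt] at hsb
    constructor <;> linarith
  · rw [image_eq_zero_of_notMem_tsupport hy]; simp

end Calculus

section Kernel

theorem expNegInvGlue_le_deriv {t : ℝ} (ht : t ≤ 1) :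
    expNegInvGlue t ≤ 2 * deriv expNegInvGlue t := by
  have h := expNegInvGlue.hasDerivAt_polynomial_eval_inv_mul 1 t
  simp only [Polynomial.eval_one, one_mul, Polynomial.derivative_one, sub_zero, mul_one,
    Polynomial.eval_pow, Polynomial.eval_X] at h
  rw [h.deriv]
  rcases le_or_gt t 0 with h0 | h0
  · rw [expNegInvGlue.zero_of_nonpos h0]; simp
  · have h1 : 1 ≤ (t⁻¹) ^ 2 := one_le_pow₀ ((one_le_inv₀ h0).2 ht)
    nlinarith [expNegInvGlue.nonneg t]

theorem deriv_expNegInvGlue_of_nonpos {t : ℝ} (ht : t ≤ 0) : deriv expNegInvGlue t = 0 := by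
  have h := expNegInvGlue.hasDerivAt_polynomial_eval_inv_mul 1 t
  simp only [Polynomial.eval_one, one_mul] at h
  rw [h.deriv, expNegInvGlue.zero_of_nonpos ht]; simp

/-- Unnormalised radial potential. -/
def kQ0 {n : ℕ} (y : Eu n) : ℝ := expNegInvGlue (1 - ‖y‖ ^ 2)

/-- Unnormalised radial kernel, `∇ kQ0 = - y kG0`. -/
def kG0 {n : ℕ} (y : Eu n) : ℝ := 2 * deriv expNegInvGlue (1 - ‖y‖ ^ 2)

/-- Normalising constant. -/
def kc (n : ℕ) : ℝ := ∫ y : Eu n, kG0 y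

/-- Radial potential. -/
def kQ {n : ℕ} (y : Eu n) : ℝ := (kc n)⁻¹ * kQ0 y

/-- Radial averaging kernel of mass one. -/
def kG {n : ℕ} (y : Eu n) : ℝ := (kc n)⁻¹ * kG0 y

variable {n : ℕ}

theorem smooth_deriv_glue : ContDiff ℝ (⊤ : ℕ∞) (deriv expNegInvGlue) := by
  have : ContDiff ℝ (⊤ : ℕ∞) expNegInvGlue := expNegInvGlue.contDiff
  exact (contDiff_infty_iff_deriv.1 this).2

theorem kQ0_smooth : Smooth (kQ0 : Eu n → ℝ) :=
  expNegInvGlue.contDiff.comp (contDiff_const.sub (contDiff_norm_sq ℝ))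

theorem kG0_smooth : Smooth (kG0 : Eu n → ℝ) :=
  contDiff_const.mul (smooth_deriv_glue.comp (contDiff_const.sub (contDiff_norm_sq ℝ)))

theorem kQ_smooth : Smooth (kQ : Eu n → ℝ) := contDiff_const.mul kQ0_smooth

theorem kG_smooth : Smooth (kG : Eu n → ℝ) := contDiff_const.mul kG0_smooth

theorem kQ0_le_kG0 (y : Eu n) : kQ0 y ≤ kG0 y :=
  expNegInvGlue_le_deriv (by nlinarith [norm_nonneg y])

theorem kQ0_nonneg (y : Eu n) : 0 ≤ kQ0 y := expNegInvGlue.nonneg _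

theorem kG0_nonneg (y : Eu n) : 0 ≤ kG0 y := (kQ0_nonneg y).trans (kQ0_le_kG0 y)

theorem kG0_eq_zero {y : Eu n} (hy : 1 ≤ ‖y‖) : kG0 y = 0 := by
  unfold kG0; rw [deriv_expNegInvGlue_of_nonpos (by nlinarith)]; simp

theorem kG_eq_zero {y : Eu n} (hy : 1 ≤ ‖y‖) : kG y = 0 := by
  unfold kG; rw [kG0_eq_zero hy]; simp

theorem kQ_eq_zero {y : Eu n} (hy : 1 ≤ ‖y‖) : kQ y = 0 := by
  unfold kQ kQ0; rw [expNegInvGlue.zero_of_nonpos (by nlinarith)]; simp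

theorem hasCompactSupport_of_unit {K : Eu n → ℝ} (h : ∀ y, 1 ≤ ‖y‖ → K y = 0) :
    HasCompactSupport K :=
  HasCompactSupport.intro (isCompact_closedBall (0 : Eu n) 1) fun y hy => h y (by
    rw [mem_closedBall, dist_zero_right, not_le] at hy; exact hy.le)

theorem kG0_supp : HasCompactSupport (kG0 : Eu n → ℝ) :=
  hasCompactSupport_of_unit fun _ => kG0_eq_zero

theorem kG_supp : HasCompactSupport (kG : Eu n → ℝ) :=
  hasCompactSupport_of_unit fun _ => kG_eq_zero

theorem kQ_supp : HasCompactSupport (kQ : Eu n → ℝ) :=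
  hasCompactSupport_of_unit fun _ => kQ_eq_zero

theorem kQ0_pos {y : Eu n} (hy : ‖y‖ < 1) : 0 < kQ0 y :=
  expNegInvGlue.pos_of_pos (by nlinarith [norm_nonneg y])

theorem kc_pos : 0 < kc n := by
  refine kG0_smooth.continuous.integral_pos_of_hasCompactSupport_nonneg_nonzero kG0_supp
    kG0_nonneg (x := 0) (ne_of_gt ?_)
  exact (kQ0_pos (by simp)).trans_le (kQ0_le_kG0 0)

theorem kQ_nonneg (y : Eu n) : 0 ≤ kQ y := mul_nonneg (inv_nonneg.2 kc_pos.le) (kQ0_nonneg y)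

theorem kG_nonneg (y : Eu n) : 0 ≤ kG y := mul_nonneg (inv_nonneg.2 kc_pos.le) (kG0_nonneg y)

theorem kQ_le_kG (y : Eu n) : kQ y ≤ kG y :=
  mul_le_mul_of_nonneg_left (kQ0_le_kG0 y) (inv_nonneg.2 kc_pos.le)

theorem integral_kG : ∫ y : Eu n, kG y = 1 := by
  unfold kG
  rw [integral_const_mul]; exact inv_mul_cancel₀ kc_pos.ne'

theorem pd_norm_sq (i : Fin n) (y : Eu n) : pd i (fun y : Eu n => ‖y‖ ^ 2) y = 2 * y i := by
  have : (fun y : Eu n => ‖y‖ ^ 2) = fun y => ∑ j, y j ^ 2 := by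
    ext y; rw [EuclideanSpace.norm_sq_eq]; simp
  rw [this, pd_sum _ fun j _ => (Smooth.coord j).pow 2]
  have : ∀ j, pd i (fun y : Eu n => y j ^ 2) y = 2 * y j * (if i = j then 1 else 0) := fun j => by
    rw [pd_sq (Smooth.coord j), pd_coord]
  simp [this]

theorem pd_kQ (i : Fin n) (y : Eu n) : pd i kQ y = - (y i * kG y) := by
  have h1 : Smooth (fun y : Eu n => 1 - ‖y‖ ^ 2) := contDiff_const.sub (contDiff_norm_sq ℝ)
  have h2 : Differentiable ℝ expNegInvGlue := (expNegInvGlue.contDiff (n := 1)).differentiable (by simp)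
  unfold kQ
  rw [pd_const_mul _ kQ0_smooth]
  have : pd i kQ0 y = deriv expNegInvGlue (1 - ‖y‖ ^ 2) * (0 - 2 * y i) := by
    unfold kQ0
    rw [pd_comp h2 h1, pd_sub contDiff_const (contDiff_norm_sq ℝ), pd_const, pd_norm_sq]
  rw [this]; unfold kG kG0; ring

theorem exists_kQ_lower : ∃ c > 0, ∀ y : Eu n, ‖y‖ ≤ 1 / 2 → c ≤ kQ y := by
  obtain ⟨z, hz, hm⟩ := (isCompact_closedBall (0 : Eu n) (1 / 2)).exists_isMinOn
    ⟨0, by simp⟩ kQ_smooth.continuous.continuousOn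
  rw [mem_closedBall, dist_zero_right] at hz
  refine ⟨kQ z, mul_pos (inv_pos.2 kc_pos) (kQ0_pos (by linarith)), fun y hy => ?_⟩
  exact hm (by rwa [mem_closedBall, dist_zero_right])

theorem exists_bound_of_compact {K : Eu n → ℝ} (hK : Continuous K) (hs : HasCompactSupport K) :
    ∃ C > 0, ∀ y, |K y| ≤ C := by
  obtain ⟨C, hC⟩ := hK.bounded_above_of_compact_support hs
  exact ⟨max C 1, by positivity, fun y => (hC y).trans (le_max_left _ _)⟩

/-- Average of `f` on the ball `B_r(x)` weighted by the kernel `K`. -/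
def avk {n : ℕ} (K f : Eu n → ℝ) (x : Eu n) (r : ℝ) : ℝ := ∫ y, f (x + r • y) * K y

variable {f g K : Eu n → ℝ} {x : Eu n} {r : ℝ}

theorem continuous_affine (hf : Continuous f) (x : Eu n) (r : ℝ) :
    Continuous fun y => f (x + r • y) := by fun_prop

theorem integrable_avk (hf : Continuous f) (hK : Continuous K) (hs : HasCompactSupport K)
    (x : Eu n) (r : ℝ) : Integrable fun y => f (x + r • y) * K y :=
  integrable_mul_of_compact (continuous_affine hf x r) hK hs

theorem avk_add (hf : Continuous f) (hg : Continuous g) (hK : Continuous K)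
    (hs : HasCompactSupport K) :
    avk K (fun y => f y + g y) x r = avk K f x r + avk K g x r := by
  unfold avk
  rw [← integral_add (integrable_avk hf hK hs x r) (integrable_avk hg hK hs x r)]
  congr 1; ext y; ring

theorem avk_const_mul (c : ℝ) : avk K (fun y => c * f y) x r = c * avk K f x r := by
  unfold avk; rw [← integral_const_mul]; congr 1; ext y; ring

theorem mem_of_lt_one {y : Eu n} (hr : 0 ≤ r) (hy : ‖y‖ ≤ 1) : x + r • y ∈ closedBall x r := by
  rw [mem_closedBall, dist_eq_norm, add_sub_cancel_left, norm_smul, Real.norm_of_nonneg hr]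
  nlinarith

theorem avk_mono (hf : Continuous f) (hg : Continuous g) (hK : Continuous K)
    (h0 : ∀ y, 0 ≤ K y) (h1 : ∀ y, 1 ≤ ‖y‖ → K y = 0) (hr : 0 ≤ r)
    (h : ∀ z ∈ closedBall x r, f z ≤ g z) : avk K f x r ≤ avk K g x r := by
  have hs := hasCompactSupport_of_unit h1
  refine integral_mono (integrable_avk hf hK hs x r) (integrable_avk hg hK hs x r) fun y => ?_
  rcases lt_or_ge ‖y‖ 1 with hy | hy
  · exact mul_le_mul_of_nonneg_right (h _ (mem_of_lt_one hr hy.le)) (h0 y)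
  · simp [h1 y hy]

theorem avk_nonneg (h0 : ∀ y, 0 ≤ K y) (h : ∀ z, 0 ≤ f z) : 0 ≤ avk K f x r :=
  integral_nonneg fun y => mul_nonneg (h _) (h0 y)

theorem avk_const (c : ℝ) : avk kG (fun _ => c) x r = c := by
  unfold avk; rw [integral_const_mul, integral_kG, mul_one]

theorem avk_zero : avk kG f x 0 = f x := by
  unfold avk; simp [integral_const_mul, integral_kG]

theorem avk_le (hf : Continuous f) (hr : 0 ≤ r) {M : ℝ} (h : ∀ z ∈ closedBall x r, f z ≤ M) :
    avk kG f x r ≤ M := by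
  rw [← avk_const (x := x) (r := r) M]
  exact avk_mono hf continuous_const kG_smooth.continuous kG_nonneg (fun _ => kG_eq_zero) hr h

theorem le_avk (hf : Continuous f) (hr : 0 ≤ r) {M : ℝ} (h : ∀ z ∈ closedBall x r, M ≤ f z) :
    M ≤ avk kG f x r := by
  rw [← avk_const (x := x) (r := r) M]
  exact avk_mono continuous_const hf kG_smooth.continuous kG_nonneg (fun _ => kG_eq_zero) hr h

theorem avk_kQ_le (hf : Continuous f) (h : ∀ z, 0 ≤ f z) : avk kQ f x r ≤ avk kG f x r :=
  integral_mono (integrable_avk hf kQ_smooth.continuous kQ_supp x r)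
    (integrable_avk hf kG_smooth.continuous kG_supp x r)
    fun y => mul_le_mul_of_nonneg_left (kQ_le_kG y) (h _)

/-- Crude bound of an average against an arbitrary bounded kernel. -/
theorem exists_avk_bound (hK : Continuous K) (h1 : ∀ y, 1 ≤ ‖y‖ → K y = 0) :
    ∃ C > 0, ∀ (f : Eu n → ℝ) (x : Eu n) (r M : ℝ), Continuous f → 0 ≤ r → 0 ≤ M →
      (∀ z ∈ closedBall x r, |f z| ≤ M) → |avk K f x r| ≤ C * M := by
  have hs := hasCompactSupport_of_unit h1
  have hi : Integrable fun y => |K y| := (hK.integrable_of_hasCompactSupport hs).abs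
  refine ⟨(∫ y, |K y|) + 1, by
    have : 0 ≤ ∫ y, |K y| := integral_nonneg fun y => abs_nonneg _
    linarith, fun f x r M hf hr hM h => ?_⟩
  have : |avk K f x r| ≤ ∫ y, M * |K y| := by
    refine (abs_integral_le_integral_abs).trans
      (integral_mono (integrable_avk hf hK hs x r).abs (hi.const_mul M) fun y => ?_)
    simp only [abs_mul]
    rcases lt_or_ge ‖y‖ 1 with hy | hy
    · exact mul_le_mul_of_nonneg_right (h _ (mem_of_lt_one hr hy.le)) (abs_nonneg _)
    · simp [h1 y hy]
  rw [integral_const_mul] at this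
  nlinarith

theorem integral_affine_pd_mul (hf : Smooth f) (hK : Smooth K) (hs : HasCompactSupport K)
    (i : Fin n) (x : Eu n) (r : ℝ) :
    r * avk K (pd i f) x r = - avk (pd i K) f x r := by
  have h := integral_pd_mul (hf.affine x r) hK hs i
  unfold avk
  rw [← integral_const_mul, ← h, pd_affine' hf]
  congr 1; ext y; ring

theorem integral_affine_lap_mul (hf : Smooth f) (hK : Smooth K) (hs : HasCompactSupport K)
    (x : Eu n) (r : ℝ) :
    r ^ 2 * avk K (lap f) x r = avk (lap K) f x r := by
  have h := integral_lap_mul (hf.affine x r) hK hs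
  unfold avk
  rw [← integral_const_mul, ← h]
  simp_rw [lap_affine hf]
  congr 1; ext y; ring

theorem hasDerivAt_avk_ray (hf : Smooth f) (hK : Continuous K) (hs : HasCompactSupport K)
    (x : Eu n) (r : ℝ) :
    HasDerivAt (avk K f x) (∫ y, (∑ i, y i * pd i f (x + r • y)) * K y) r := by
  refine hasDerivAt_integral_kernel (F := fun t y => f (x + t • y))
    (F' := fun t y => ∑ i, y i * pd i f (x + t • y)) ?_ ?_ (fun t y => hasDerivAt_ray hf x y t)
    hK hs r
  · have := hf.continuous; fun_prop
  · refine continuous_finsetSum _ fun i _ => ?_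
    have := (hf.pd i).continuous
    fun_prop

theorem hasDerivAt_avk (hf : Smooth f) (x : Eu n) (r : ℝ) :
    HasDerivAt (avk kG f x) (r * avk kQ (lap f) x r) r := by
  convert hasDerivAt_avk_ray hf kG_smooth.continuous kG_supp x r using 1
  have h1 : ∀ y, (∑ i, y i * pd i f (x + r • y)) * kG y
      = ∑ i, -(pd i f (x + r • y) * pd i kQ y) := fun y => by
    rw [Finset.sum_mul]; refine Finset.sum_congr rfl fun i _ => ?_
    rw [pd_kQ]; ring
  simp_rw [h1]
  rw [integral_finsetSum]
  · have : ∀ i, ∫ y, -(pd i f (x + r • y) * pd i kQ y) = r * avk kQ (pd i (pd i f)) x r := fun i => by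
      rw [integral_affine_pd_mul (hf.pd i) kQ_smooth kQ_supp, integral_neg]; rfl
    simp_rw [this]
    rw [← Finset.mul_sum]; congr 1
    unfold avk
    rw [← integral_finsetSum]
    · congr 1; ext y; rw [lap_eq hf, Finset.sum_mul]
    · exact fun i _ => integrable_avk ((hf.pd i).pd i).continuous kQ_smooth.continuous kQ_supp x r
  · exact fun i _ => (integrable_avk (hf.pd i).continuous (kQ_smooth.pd i).continuous
      (hasCompactSupport_pd kQ_supp) x r).neg

theorem hasDerivAt_avk_center (hf : Smooth f) (hK : Continuous K) (hs : HasCompactSupport K)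
    (x d : Eu n) (r s : ℝ) :
    HasDerivAt (fun s : ℝ => avk K f (x + s • d) r)
      (∑ j, d j * avk K (pd j f) (x + s • d) r) s := by
  have h := hasDerivAt_integral_kernel (F := fun t y => f ((x + t • d) + r • y))
    (F' := fun t y => ∑ i, d i * pd i f ((x + t • d) + r • y)) (by
      have := hf.continuous; fun_prop) (by
      refine continuous_finsetSum _ fun i _ => ?_
      have := (hf.pd i).continuous
      fun_prop) (fun t y => by
      have := hasDerivAt_ray hf (x + r • y) d t
      simp only [add_right_comm x _ (r • y)]
      exact this) hK hs s
  refine h.congr_deriv ?_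
  have he : ∀ y, (∑ i, d i * pd i f (x + s • d + r • y)) * K y
      = ∑ i, d i * (pd i f (x + s • d + r • y) * K y) := fun y => by
    rw [Finset.sum_mul]; exact Finset.sum_congr rfl fun i _ => by ring
  rw [integral_congr_ae (Filter.Eventually.of_forall he), integral_finsetSum]
  · refine Finset.sum_congr rfl fun i _ => ?_
    unfold avk; rw [← integral_const_mul]
  · exact fun i _ => (integrable_avk (hf.pd i).continuous hK hs (x + s • d) r).const_mul (d i)

end Kernel

section Means
variable {n : ℕ} {f g : Eu n → ℝ} {x : Eu n} {r : ℝ}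

theorem hasDerivAt_pd (hf : Smooth f) (i : Fin n) (x : Eu n) (t : ℝ) :
    HasDerivAt (fun s : ℝ => f (x + s • (EuclideanSpace.single i 1 : Eu n)))
      (pd i f (x + t • (EuclideanSpace.single i 1 : Eu n))) t := by
  refine (hasDerivAt_ray hf x (EuclideanSpace.single i 1) t).congr_deriv ?_
  simp

theorem pd_pd_nonpos_of_isLocalMax (hf : Smooth f) (h : IsLocalMax f x) (i : Fin n) :
    pd i (pd i f) x ≤ 0 := by
  set e : Eu n := EuclideanSpace.single i 1 with he
  set φ : ℝ → ℝ := fun s => f (x + s • e) with hφ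
  have h1 : deriv φ = fun t => pd i f (x + t • e) := funext fun t => (hasDerivAt_pd hf i x t).deriv
  have h2 : deriv (deriv φ) 0 = pd i (pd i f) x := by
    rw [h1, (hasDerivAt_pd (hf.pd i) i x 0).deriv]; simp
  have hc : Continuous fun s : ℝ => x + s • e := by fun_prop
  have hmax : IsLocalMax φ 0 := by
    have h0 : Filter.Tendsto (fun s : ℝ => x + s • e) (nhds 0) (nhds x) := by
      have := hc.tendsto 0; simpa using this
    have := h0.eventually h
    unfold IsLocalMax IsMaxFilter
    simpa [hφ] using this
  by_contra! hpos
  rw [← h2] at hpos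
  have hmin := isLocalMin_of_deriv_deriv_pos hpos hmax.deriv_eq_zero
    (hf.continuous.comp hc).continuousAt
  have heq : φ =ᶠ[nhds 0] fun _ => φ 0 := by
    filter_upwards [hmax, hmin] with s h1 h2 using le_antisymm h1 h2
  have : deriv (deriv φ) 0 = 0 := by
    rw [heq.deriv.deriv_eq]; simp
  linarith

theorem lap_nonpos_of_isLocalMax (hf : Smooth f) (h : IsLocalMax f x) : lap f x ≤ 0 := by
  rw [lap_eq hf]
  exact Finset.sum_nonpos fun i _ => pd_pd_nonpos_of_isLocalMax hf h i

theorem lap_norm_sub_sq (p x : Eu n) : lap (fun y => ‖y - p‖ ^ 2) x = 2 * n := by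
  have hs : Smooth (fun y : Eu n => ‖y - p‖ ^ 2) := (contDiff_id.sub contDiff_const).norm_sq ℝ
  have h1 : ∀ i, pd i (fun y : Eu n => ‖y - p‖ ^ 2) = fun y => 2 * (y i - p i) := fun i => by
    ext y
    have := pd_affine (i := i) (contDiff_norm_sq ℝ (E := Eu n) (n := (⊤ : ℕ∞))) (-p) 1 y
    simp only [one_smul, one_mul, pd_norm_sq] at this
    rw [show (fun y : Eu n => ‖y - p‖ ^ 2) = fun y => ‖-p + y‖ ^ 2 by ext y; congr 2; abel, this]
    simp; ring
  rw [lap_eq hs]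
  have : ∀ i, pd i (pd i (fun y : Eu n => ‖y - p‖ ^ 2)) x = 2 := fun i => by
    rw [h1, pd_const_mul _ ((Smooth.coord i).sub contDiff_const),
      pd_sub (Smooth.coord i) contDiff_const, pd_coord, pd_const]; simp
  simp [this, mul_comm]

/-- Maximum principle with a quadratic barrier. -/
theorem exists_quadratic_max (hg : Smooth g) {S : Set (Eu n)} (hS : IsClosed S) {x1 : Eu n}
    (hx1 : x1 ∈ S) {R a M : ℝ} (hR : 0 ≤ R) (ha : 0 ≤ a)
    (hM : ∀ x ∈ S, ‖x - x1‖ ≤ R → g x ≤ M) (hMR : M < g x1 + a * R ^ 2) :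
    ∃ x2 ∈ S, ‖x2 - x1‖ < R ∧ g x1 ≤ g x2 ∧ (x2 ∈ interior S → lap g x2 ≤ 2 * n * a) := by
  have hψ : Smooth (fun y => g y - a * ‖y - x1‖ ^ 2) :=
    hg.sub (contDiff_const.mul ((contDiff_id.sub contDiff_const).norm_sq ℝ))
  obtain ⟨x2, ⟨hx2S, hx2B⟩, hmax⟩ := ((isCompact_closedBall x1 R).inter_left hS).exists_isMaxOn
    ⟨x1, hx1, mem_closedBall_self hR⟩ hψ.continuous.continuousOn
  have h1 : g x1 ≤ g x2 - a * ‖x2 - x1‖ ^ 2 := by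
    have := hmax (⟨hx1, mem_closedBall_self hR⟩ : x1 ∈ S ∩ closedBall x1 R)
    simpa using this
  rw [mem_closedBall, dist_eq_norm] at hx2B
  have hlt : ‖x2 - x1‖ < R := by
    refine lt_of_le_of_ne hx2B fun h => ?_
    have := hM x2 hx2S hx2B
    rw [h] at h1; linarith
  refine ⟨x2, hx2S, hlt, by nlinarith [sq_nonneg ‖x2 - x1‖], fun h_int => ?_⟩
  have hloc : IsLocalMax (fun y => g y - a * ‖y - x1‖ ^ 2) x2 := by
    refine hmax.isLocalMax (Filter.inter_mem (mem_interior_iff_mem_nhds.1 h_int) ?_)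
    exact Filter.mem_of_superset (isOpen_ball.mem_nhds (by rwa [mem_ball, dist_eq_norm]))
      ball_subset_closedBall
  have := lap_nonpos_of_isLocalMax hψ hloc
  have hsq : Smooth (fun y => ‖y - x1‖ ^ 2) := (contDiff_id.sub contDiff_const).norm_sq ℝ
  rw [lap_sub hg (contDiff_const.mul hsq), lap_const_mul a hsq, lap_norm_sub_sq x1 x2] at this
  linarith

theorem avk_monotoneOn (hf : Smooth f) (h : ∀ z, 0 ≤ lap f z) (x : Eu n) :
    MonotoneOn (avk kG f x) (Set.Ici 0) := by
  refine monotoneOn_of_deriv_nonneg (convex_Ici 0)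
    (fun r _ => (hasDerivAt_avk hf x r).continuousAt.continuousWithinAt)
    (fun r _ => (hasDerivAt_avk hf x r).differentiableAt.differentiableWithinAt) fun r hr => ?_
  rw [interior_Ici, Set.mem_Ioi] at hr
  rw [(hasDerivAt_avk hf x r).deriv]
  exact mul_nonneg hr.le (avk_nonneg kQ_nonneg h)

theorem le_avk_of_lap_nonneg (hf : Smooth f) (h : ∀ z, 0 ≤ lap f z) (x : Eu n) (hr : 0 ≤ r) :
    f x ≤ avk kG f x r := by
  have := avk_monotoneOn hf h x (Set.mem_Ici.2 le_rfl) (Set.mem_Ici.2 hr) hr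
  rwa [avk_zero] at this

/-- Reverse mean value inequality. -/
theorem avk_le_of_lap_le (hg : Smooth g) (h0 : ∀ z, 0 ≤ g z) {K : ℝ} (hK : 0 ≤ K) (x : Eu n)
    (hr : 0 ≤ r) (h : ∀ z ∈ closedBall x r, lap g z ≤ K * g z) :
    avk kG g x r ≤ Real.exp (K * r ^ 2 / 2) * g x := by
  have hd : ∀ t, HasDerivAt (fun t => Real.exp (-(K * t ^ 2 / 2)) * avk kG g x t)
      (Real.exp (-(K * t ^ 2 / 2)) * (-(K * t)) * avk kG g x t
        + Real.exp (-(K * t ^ 2 / 2)) * (t * avk kQ (lap g) x t)) t := fun t => by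
    have h1 : HasDerivAt (fun t : ℝ => -(K * t ^ 2 / 2)) (-(K * t)) t := by
      have := (((hasDerivAt_pow 2 t).const_mul K).div_const 2).neg
      refine this.congr_deriv ?_; simp; ring
    exact h1.exp.mul (hasDerivAt_avk hg x t)
  have hanti : AntitoneOn (fun t => Real.exp (-(K * t ^ 2 / 2)) * avk kG g x t) (Set.Icc 0 r) := by
    refine antitoneOn_of_deriv_nonpos (convex_Icc 0 r)
      (fun t _ => (hd t).continuousAt.continuousWithinAt)
      (fun t _ => (hd t).differentiableAt.differentiableWithinAt) fun t ht => ?_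
    rw [interior_Icc] at ht
    rw [(hd t).deriv]
    have h2 : avk kQ (lap g) x t ≤ K * avk kG g x t := by
      refine le_trans ?_ (mul_le_mul_of_nonneg_left (avk_kQ_le hg.continuous h0) hK)
      rw [← avk_const_mul]
      exact avk_mono hg.lap.continuous (continuous_const.mul hg.continuous) kQ_smooth.continuous
        kQ_nonneg (fun _ => kQ_eq_zero) ht.1.le
        fun z hz => h z (closedBall_subset_closedBall ht.2.le hz)
    have h3 := Real.exp_pos (-(K * t ^ 2 / 2))
    have h4 : t * avk kQ (lap g) x t ≤ t * (K * avk kG g x t) := mul_le_mul_of_nonneg_left h2 ht.1.le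
    nlinarith [mul_le_mul_of_nonneg_left h4 h3.le]
  have := hanti (Set.left_mem_Icc.2 hr) (Set.right_mem_Icc.2 hr) hr
  simp only [avk_zero] at this
  rw [Real.exp_neg, ← div_eq_inv_mul, div_le_iff₀ (Real.exp_pos _)] at this
  simpa [mul_comm] using this

theorem integral_affine (Φ : Eu n → ℝ) (a : Eu n) {s : ℝ} (hs : 0 < s) :
    ∫ y, Φ (a + s • y) = (s ^ n)⁻¹ * ∫ y, Φ y := by
  have := Measure.integral_comp_smul (volume : Measure (Eu n)) (fun y => Φ (a + y)) s
  rw [this, integral_add_left_eq_self]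
  simp [abs_of_pos hs]

/-- Averages over a small ball are controlled by averages over a larger one. -/
theorem exists_avk_compare (n : ℕ) : ∃ C > 0, ∀ (f : Eu n → ℝ) (z x : Eu n) (ρ r : ℝ),
    Continuous f → (∀ y, 0 ≤ f y) → 0 < ρ → 0 < r → ‖z - x‖ + ρ ≤ r / 2 →
    avk kG f z ρ ≤ C * (r / ρ) ^ n * avk kQ f x r := by
  obtain ⟨c, hc, hcl⟩ := exists_kQ_lower (n := n)
  obtain ⟨M, hM, hMl⟩ := exists_bound_of_compact (kG_smooth (n := n)).continuous kG_supp
  refine ⟨M / c, by positivity, fun f z x ρ r hf h0 hρ hr hz => ?_⟩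
  set s := ρ / r
  set a : Eu n := r⁻¹ • (z - x)
  have hs : 0 < s := by positivity
  have h1 : avk kG f z ρ = (s ^ n)⁻¹ * ∫ y, f (x + r • y) * kG (s⁻¹ • (y - a)) := by
    rw [← integral_affine (fun y => f (x + r • y) * kG (s⁻¹ • (y - a))) a hs]
    unfold avk; congr 1; ext y
    have e1 : x + r • (a + s • y) = z + ρ • y := by
      simp only [a, s, smul_add, smul_smul]
      rw [mul_inv_cancel₀ hr.ne', mul_div_cancel₀ _ hr.ne']; simp; abel
    have e2 : s⁻¹ • (a + s • y - a) = y := by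
      rw [add_sub_cancel_left, smul_smul, inv_mul_cancel₀ hs.ne', one_smul]
    simp only [e1, e2]
  have e3 : (s ^ n)⁻¹ = (r / ρ) ^ n := by simp [s, ← inv_pow]
  have h2 : ∫ y, f (x + r • y) * kG (s⁻¹ • (y - a)) ≤ ∫ y, (M / c) * (f (x + r • y) * kQ y) := by
    refine integral_mono_of_nonneg (Filter.Eventually.of_forall fun y =>
      mul_nonneg (h0 _) (kG_nonneg _))
      ((integrable_avk hf kQ_smooth.continuous kQ_supp x r).const_mul _)
      (Filter.Eventually.of_forall fun y => ?_)
    have : kG (s⁻¹ • (y - a)) ≤ M / c * kQ y := by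
      rcases lt_or_ge ‖s⁻¹ • (y - a)‖ 1 with h | h
      · have hy : ‖y‖ ≤ 1 / 2 := by
          rw [norm_smul, norm_inv, Real.norm_of_nonneg hs.le, inv_mul_lt_iff₀ hs, mul_one] at h
          have h5 : ‖a‖ = ‖z - x‖ / r := by
            simp only [a]; rw [norm_smul, norm_inv, Real.norm_of_nonneg hr.le]; field_simp
          have h6 : ‖a‖ + s ≤ 1 / 2 := by
            rw [h5]; simp only [s]; rw [← add_div, div_le_iff₀ hr]; linarith
          calc ‖y‖ = ‖a + (y - a)‖ := by congr 1; abel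
            _ ≤ ‖a‖ + ‖y - a‖ := norm_add_le _ _
            _ ≤ 1 / 2 := by linarith
        have h7 := hcl y hy
        have h8 := (le_abs_self _).trans (hMl (s⁻¹ • (y - a)))
        rw [div_mul_eq_mul_div, le_div_iff₀ hc]
        nlinarith
      · rw [kG_eq_zero h]; exact mul_nonneg (by positivity) (kQ_nonneg y)
    nlinarith [h0 (x + r • y)]
  rw [integral_const_mul] at h2
  rw [h1, e3]
  calc (r / ρ) ^ n * _ ≤ (r / ρ) ^ n * (M / c * ∫ y, f (x + r • y) * kQ y) :=
        mul_le_mul_of_nonneg_left h2 (by positivity)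
    _ = _ := by unfold avk; ring

theorem lap_pd (hf : Smooth f) (i : Fin n) : lap (pd i f) = pd i (lap f) := by
  ext x
  rw [lap_eq (hf.pd i), show lap f = fun x => ∑ j, pd j (pd j f) x from funext (lap_eq hf),
    pd_sum _ fun j _ => (hf.pd j).pd j]
  refine Finset.sum_congr rfl fun j _ => ?_
  rw [pd_comm (hf.pd j), show pd j (pd i f) = pd i (pd j f) from funext fun y => pd_comm hf]

theorem hasDerivAt_avk_pd (hf : Smooth f) (i : Fin n) (x : Eu n) (r : ℝ) :
    HasDerivAt (avk kG (pd i f) x) (-avk (pd i kQ) (lap f) x r) r := by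
  refine (hasDerivAt_avk (hf.pd i) x r).congr_deriv ?_
  rw [lap_pd hf, integral_affine_pd_mul hf.lap kQ_smooth kQ_supp]

theorem pd_kQ_eq_zero (i : Fin n) {y : Eu n} (hy : 1 ≤ ‖y‖) : pd i kQ y = 0 := by
  rw [pd_kQ, kG_eq_zero hy]; simp

/-- Interior gradient representation. -/
theorem exists_gradient_bound (n : ℕ) : ∃ C > 0, ∀ (f : Eu n → ℝ) (i : Fin n) (x : Eu n) (r M : ℝ),
    Smooth f → 0 ≤ r → 0 ≤ M → (∀ z ∈ closedBall x r, |lap f z| ≤ M) →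
    |avk kG (pd i f) x r - pd i f x| ≤ C * M * r := by
  choose C hC h using fun i : Fin n => exists_avk_bound (kQ_smooth.pd i).continuous
    (fun y => pd_kQ_eq_zero (n := n) i)
  refine ⟨1 + ∑ i, C i, by have := Finset.sum_nonneg fun i (_ : i ∈ Finset.univ) => (hC i).le; linarith,
    fun f i x r M hf hr hM hb => ?_⟩
  have hle : C i ≤ 1 + ∑ i, C i := by
    have := Finset.single_le_sum (fun i _ => (hC i).le) (Finset.mem_univ i); linarith
  have := norm_image_sub_le_of_norm_deriv_le_segment' (f := avk kG (pd i f) x) (a := 0) (b := r)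
    (C := (1 + ∑ i, C i) * M) (fun t _ => (hasDerivAt_avk_pd hf i x t).hasDerivWithinAt)
    (fun t ht => ?_) r (Set.right_mem_Icc.2 hr)
  · rw [avk_zero] at this; simpa using this
  · rw [norm_neg]
    refine (h i (lap f) x t M hf.lap.continuous ht.1 hM fun z hz => hb z ?_).trans
      (mul_le_mul_of_nonneg_right hle hM)
    exact closedBall_subset_closedBall ht.2.le hz

end Means

section Solutions
variable {n : ℕ}

/-- Squared length of the gradient. -/
def gsq {n : ℕ} (f : Eu n → ℝ) (x : Eu n) : ℝ := ∑ i, pd i f x ^ 2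

/-- Energy density. -/
def dens {n : ℕ} (u v : Eu n → ℝ) (x : Eu n) : ℝ := gsq u x + gsq v x + u x ^ 2 * v x ^ 2

/-- Minimizing solutions of linear growth; minimality is expressed through energy differences. -/
structure Sol {n : ℕ} (u v : Eu n → ℝ) : Prop where
  su : Smooth u
  sv : Smooth v
  pu : ∀ x, 0 < u x
  pv : ∀ x, 0 < v x
  lu : ∀ x, lap u x = u x * v x ^ 2
  lv : ∀ x, lap v x = v x * u x ^ 2
  min : ∀ ub vb : Eu n → ℝ, Smooth ub → Smooth vb → HasCompactSupport (fun y => ub y - u y) →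
    HasCompactSupport (fun y => vb y - v y) → 0 ≤ ∫ y, (dens ub vb y - dens u v y)
  growth : ∃ C > 0, ∀ x, u x + v x ≤ C * (1 + ‖x‖)

variable {u v f : Eu n → ℝ} {x : Eu n} {r : ℝ}

theorem Smooth.gsq (hf : Smooth f) : Smooth (gsq f) :=
  ContDiff.sum fun i _ => (hf.pd i).pow 2

theorem Smooth.dens (hu : Smooth u) (hv : Smooth v) : Smooth (dens u v) :=
  (hu.gsq.add hv.gsq).add ((hu.pow 2).mul (hv.pow 2))

theorem gsq_nonneg (f : Eu n → ℝ) (x : Eu n) : 0 ≤ gsq f x :=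
  Finset.sum_nonneg fun _ _ => sq_nonneg _

theorem dens_nonneg (u v : Eu n → ℝ) (x : Eu n) : 0 ≤ dens u v x := by
  have := gsq_nonneg u x; have := gsq_nonneg v x; unfold dens; positivity

theorem dens_comm (u v : Eu n → ℝ) (x : Eu n) : dens u v x = dens v u x := by
  unfold dens; ring

theorem dens_affine (hu : Smooth u) (hv : Smooth v) (p : Eu n) (r : ℝ) (y : Eu n) :
    dens (fun y => r * u (p + r • y)) (fun y => r * v (p + r • y)) y
      = r ^ 4 * dens u v (p + r • y) := by
  have key : ∀ {f : Eu n → ℝ}, Smooth f →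
      gsq (fun y => r * f (p + r • y)) y = r ^ 4 * gsq f (p + r • y) := fun {f} hf => by
    unfold gsq
    rw [Finset.mul_sum]
    refine Finset.sum_congr rfl fun i _ => ?_
    rw [pd_const_mul r (hf.affine p r), pd_affine hf]; ring
  unfold dens
  rw [key hu, key hv]; ring

theorem gsq_congr_of_notMem {f g : Eu n → ℝ} (hf : Smooth f) (hg : Smooth g)
    (hx : x ∉ tsupport (fun y => f y - g y)) : f x = g x ∧ gsq f x = gsq g x := by
  have h0 : (fun y => f y - g y) =ᶠ[nhds x] 0 := notMem_tsupport_iff_eventuallyEq.1 hx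
  refine ⟨sub_eq_zero.1 h0.self_of_nhds, ?_⟩
  unfold gsq
  refine Finset.sum_congr rfl fun i _ => ?_
  have : pd i f x = pd i g x := by
    have h1 := pd_sub (i := i) (x := x) hf hg
    have h2 : pd i (fun y => f y - g y) x = 0 := by
      unfold pd; rw [h0.fderiv_eq]; simp
    linarith
  rw [this]

theorem sol_of_isLocalMinimizer (hs : IsSolution u v) (hm : IsLocalMinimizer u v) {C : ℝ}
    (hC : 0 < C) (hg : ∀ x, u x + v x ≤ C * (1 + ‖x‖)) : Sol u v := by
  obtain ⟨su, sv, pu, pv, lu, lv⟩ := hs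
  refine ⟨su, sv, pu, pv, lu, lv, fun ub vb sub svb hub hvb => ?_, C, hC, hg⟩
  obtain ⟨R1, hR1⟩ := (hub.isCompact.union hvb.isCompact).isBounded.subset_closedBall 0
  set R := max R1 0 + 1
  have hR : 0 < R := by positivity
  have hout : ∀ x ∉ ball (0 : Eu n) R, x ∉ tsupport (fun y => ub y - u y) ∧
      x ∉ tsupport (fun y => vb y - v y) := fun x hx => by
    have : x ∉ closedBall (0 : Eu n) R1 := fun h => hx (by
      rw [mem_closedBall] at h; rw [mem_ball]
      exact lt_of_le_of_lt (h.trans (le_max_left _ _)) (lt_add_one _))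
    exact ⟨fun h => this (hR1 (Or.inl h)), fun h => this (hR1 (Or.inr h))⟩
  have hE : ∀ f g : Eu n → ℝ, energy f g R = ∫ y in ball 0 R, dens f g y := fun f g => by
    unfold energy dens gsq
    simp_rw [gradient_norm_sq]
  have key := hm R hR ub vb sub svb fun x hx =>
    ⟨(gsq_congr_of_notMem sub su (hout x hx).1).1, (gsq_congr_of_notMem svb sv (hout x hx).2).1⟩
  rw [hE, hE] at key
  have hi : ∀ f g : Eu n → ℝ, Smooth f → Smooth g → IntegrableOn (dens f g) (ball 0 R) :=
    fun f g hf hg => ((hf.dens hg).continuous.continuousOn.integrableOn_compact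
      (isCompact_closedBall 0 R)).mono_set ball_subset_closedBall
  have hset : ∫ y, (dens ub vb y - dens u v y) = ∫ y in ball 0 R, (dens ub vb y - dens u v y) := by
    refine (setIntegral_eq_integral_of_forall_compl_eq_zero fun x hx => ?_).symm
    have h1 := gsq_congr_of_notMem sub su (hout x hx).1
    have h2 := gsq_congr_of_notMem svb sv (hout x hx).2
    unfold dens
    rw [h1.1, h1.2, h2.1, h2.2]; ring
  rw [hset, integral_sub (hi _ _ sub svb) (hi _ _ su sv)]
  linarith

theorem Sol.swap (h : Sol u v) : Sol v u := by
  refine ⟨h.sv, h.su, h.pv, h.pu, h.lv, h.lu, fun ub vb hub hvb h1 h2 => ?_, ?_⟩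
  · have := h.min vb ub hvb hub h2 h1
    simpa only [dens_comm] using this
  · obtain ⟨C, hC, hg⟩ := h.growth
    exact ⟨C, hC, fun x => by rw [add_comm]; exact hg x⟩

theorem Sol.rescale (h : Sol u v) (p : Eu n) (hr : 0 < r) :
    Sol (fun y => r * u (p + r • y)) (fun y => r * v (p + r • y)) := by
  have hr' := hr.ne'
  refine ⟨contDiff_const.mul (h.su.affine p r), contDiff_const.mul (h.sv.affine p r),
    fun y => mul_pos hr (h.pu _), fun y => mul_pos hr (h.pv _), fun y => ?_, fun y => ?_, ?_, ?_⟩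
  · rw [lap_const_mul r (h.su.affine p r), lap_affine h.su, h.lu]; ring
  · rw [lap_const_mul r (h.sv.affine p r), lap_affine h.sv, h.lv]; ring
  · intro Ub Vb sU sV cU cV
    set q : Eu n := -(r⁻¹ • p)
    have e1 : ∀ y, q + r⁻¹ • (p + r • y) = y := fun y => by
      simp only [q, smul_add, smul_smul, inv_mul_cancel₀ hr', one_smul]; abel
    have e2 : ∀ x, p + r • (q + r⁻¹ • x) = x := fun x => by
      simp only [q, smul_add, smul_neg, smul_smul, mul_inv_cancel₀ hr', one_smul]; abel
    have sub := contDiff_const (c := r⁻¹).mul (sU.affine q r⁻¹)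
    have svb := contDiff_const (c := r⁻¹).mul (sV.affine q r⁻¹)
    have hco : ∀ {F f : Eu n → ℝ}, HasCompactSupport (fun y => F y - r * f (p + r • y)) →
        HasCompactSupport (fun x => r⁻¹ * F (q + r⁻¹ • x) - f x) := fun {F f} hc => by
      let φ : Eu n ≃ₜ Eu n :=
        ⟨⟨fun x => q + r⁻¹ • x, fun y => p + r • y, e2, e1⟩, by fun_prop, by fun_prop⟩
      have := (hc.comp_homeomorph φ).mul_left (f := fun _ => r⁻¹)
      refine (congrArg HasCompactSupport (funext fun x => ?_)).mp this
      simp only [Pi.mul_apply, Function.comp, φ, Homeomorph.homeomorph_mk_coe, Equiv.coe_fn_mk, e2]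
      field_simp
    have key := h.min _ _ sub svb (hco cU) (hco cV)
    have hU : ∀ {F : Eu n → ℝ}, F = fun y => r * (r⁻¹ * F (q + r⁻¹ • (p + r • y))) := fun {F} => by
      ext y; rw [e1, ← mul_assoc, mul_inv_cancel₀ hr', one_mul]
    have hd : ∀ y, dens Ub Vb y - dens (fun y => r * u (p + r • y)) (fun y => r * v (p + r • y)) y
        = r ^ 4 * (dens (fun x => r⁻¹ * Ub (q + r⁻¹ • x)) (fun x => r⁻¹ * Vb (q + r⁻¹ • x))
            (p + r • y) - dens u v (p + r • y)) := fun y => by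
      rw [dens_affine h.su h.sv, mul_sub, ← dens_affine sub svb p r y, ← hU, ← hU]
    simp_rw [hd]
    rw [integral_const_mul, integral_affine (fun x => dens (fun x => r⁻¹ * Ub (q + r⁻¹ • x))
      (fun x => r⁻¹ * Vb (q + r⁻¹ • x)) x - dens u v x) p hr]
    positivity
  · obtain ⟨C, hC, hg⟩ := h.growth
    refine ⟨r * C * (1 + ‖p‖ + r), by positivity, fun y => ?_⟩
    have h1 := hg (p + r • y)
    have h2 : ‖p + r • y‖ ≤ ‖p‖ + r * ‖y‖ := by
      refine (norm_add_le _ _).trans ?_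
      rw [norm_smul, Real.norm_of_nonneg hr.le]
    have h3 : 1 + ‖p + r • y‖ ≤ (1 + ‖p‖ + r) * (1 + ‖y‖) := by
      nlinarith [norm_nonneg p, norm_nonneg y, mul_nonneg (norm_nonneg p) (norm_nonneg y)]
    calc r * u (p + r • y) + r * v (p + r • y) = r * (u (p + r • y) + v (p + r • y)) := by ring
      _ ≤ r * (C * (1 + ‖p + r • y‖)) := mul_le_mul_of_nonneg_left h1 hr.le
      _ ≤ r * (C * ((1 + ‖p‖ + r) * (1 + ‖y‖))) := by gcongr
      _ = _ := by ring

end Solutions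

section Frequency
variable {n : ℕ} {u v f : Eu n → ℝ} {x : Eu n} {r : ℝ}

/-- Weighted height. -/
def hgt {n : ℕ} (u v : Eu n → ℝ) (x : Eu n) (r : ℝ) : ℝ :=
  avk kG (fun y => u y ^ 2 + v y ^ 2) x r

/-- Weighted energy. -/
def eng {n : ℕ} (u v : Eu n → ℝ) (x : Eu n) (r : ℝ) : ℝ := r ^ 2 * avk kQ (dens u v) x r

/-- Weighted interaction energy. -/
def itr {n : ℕ} (u v : Eu n → ℝ) (x : Eu n) (r : ℝ) : ℝ :=
  r ^ 2 * avk kQ (fun y => u y ^ 2 * v y ^ 2) x r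

/-- Radial derivative. -/
def rad {n : ℕ} (f : Eu n → ℝ) (x : Eu n) (r : ℝ) (y : Eu n) : ℝ :=
  ∑ i, y i * pd i f (x + r • y)

theorem rad_smooth (hf : Smooth f) (x : Eu n) (r : ℝ) : Smooth (rad f x r) :=
  ContDiff.sum fun i _ => (Smooth.coord i).mul ((hf.pd i).affine x r)

theorem pd_rad (hf : Smooth f) (x : Eu n) (r : ℝ) (i : Fin n) (y : Eu n) :
    pd i (rad f x r) y = pd i f (x + r • y) + r * ∑ j, y j * pd j (pd i f) (x + r • y) := by
  unfold rad
  rw [pd_sum _ fun j _ => (Smooth.coord j).mul ((hf.pd j).affine x r)]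
  have : ∀ j, pd i (fun y : Eu n => y j * pd j f (x + r • y)) y
      = (if i = j then pd i f (x + r • y) else 0) + r * (y j * pd j (pd i f) (x + r • y)) :=
    fun j => by
      rw [pd_mul (Smooth.coord j) ((hf.pd j).affine x r), pd_affine (hf.pd j), pd_coord,
        pd_comm hf]
      by_cases h : i = j
      · subst h; simp; ring
      · simp [h]; ring
  simp_rw [this]
  rw [Finset.sum_add_distrib, Finset.mul_sum]
  simp

theorem pd_gsq (hf : Smooth f) (j : Fin n) (x : Eu n) :
    pd j (gsq f) x = ∑ i, 2 * pd i f x * pd j (pd i f) x := by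
  unfold gsq
  rw [pd_sum _ fun i _ => (hf.pd i).pow 2]
  exact Finset.sum_congr rfl fun i _ => pd_sq (hf.pd i)

theorem integral_eq_zero_of_div {F : Fin n → Eu n → ℝ} (hF : ∀ i, Smooth (F i))
    (hs : ∀ i, HasCompactSupport (F i)) : ∫ y, ∑ i, pd i (F i) y = 0 := by
  rw [integral_finsetSum _ fun i _ => ((hF i).pd i).continuous.integrable_of_hasCompactSupport
    (hasCompactSupport_pd (hs i))]
  exact Finset.sum_eq_zero fun i _ => integral_pd_eq_zero (hF i) (hs i) i

/-- Rellich–Pohozaev identity for one function. -/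
theorem pohozaev_aux (hf : Smooth f) (x : Eu n) (r : ℝ) :
    ∫ y, ((2 * gsq f (x + r • y) + r * rad (gsq f) x r y
        + 2 * r * rad f x r y * lap f (x + r • y)) * kQ y - 2 * rad f x r y ^ 2 * kG y) = 0 := by
  have hR := rad_smooth hf x r
  have h1 : ∀ i, Smooth fun y => rad f x r y * pd i f (x + r • y) :=
    fun i => hR.mul ((hf.pd i).affine x r)
  have h0 := integral_eq_zero_of_div
    (F := fun i y => (2 * (rad f x r y * pd i f (x + r • y))) * kQ y)
    (fun i => (contDiff_const.mul (h1 i)).mul kQ_smooth) (fun i => kQ_supp.mul_left)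
  rw [← h0]; congr 1; ext y
  have h2 : ∀ i, pd i (fun y => (2 * (rad f x r y * pd i f (x + r • y))) * kQ y) y
      = (2 * pd i f (x + r • y) ^ 2
        + r * (∑ j, y j * (2 * pd i f (x + r • y) * pd j (pd i f) (x + r • y)))
        + 2 * r * rad f x r y * pd i (pd i f) (x + r • y)) * kQ y
        - 2 * rad f x r y * (y i * pd i f (x + r • y)) * kG y := fun i => by
    rw [pd_mul (contDiff_const.mul (h1 i)) kQ_smooth, pd_const_mul 2 (h1 i),
      pd_mul hR ((hf.pd i).affine x r), pd_affine (hf.pd i), pd_rad hf, pd_kQ]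
    have : ∑ j, y j * (2 * pd i f (x + r • y) * pd j (pd i f) (x + r • y))
      = 2 * pd i f (x + r • y) * ∑ j, y j * pd j (pd i f) (x + r • y) := by
      rw [Finset.mul_sum]; exact Finset.sum_congr rfl fun j _ => by ring
    rw [this]; ring
  simp_rw [h2]
  rw [Finset.sum_sub_distrib, ← Finset.sum_mul, ← Finset.sum_mul, ← Finset.mul_sum,
    Finset.sum_add_distrib, Finset.sum_add_distrib, ← Finset.mul_sum, ← Finset.mul_sum,
    ← Finset.mul_sum, Finset.sum_comm]
  have h3 : rad (gsq f) x r y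
      = ∑ j, ∑ i, y j * (2 * pd i f (x + r • y) * pd j (pd i f) (x + r • y)) := by
    unfold rad
    refine Finset.sum_congr rfl fun j _ => ?_
    rw [pd_gsq hf, Finset.mul_sum]
  rw [← h3, ← lap_eq hf]
  unfold gsq
  change _ = _ - 2 * rad f x r y * rad f x r y * kG y
  ring

theorem integral_linear_combination₃ {f₁ f₂ f₃ : Eu n → ℝ} (h₁ : Integrable f₁)
    (h₂ : Integrable f₂) (h₃ : Integrable f₃) (a b c : ℝ) :
    ∫ y, (a * f₁ y + b * f₂ y + c * f₃ y) = a * (∫ y, f₁ y) + b * (∫ y, f₂ y) + c * ∫ y, f₃ y := by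
  have j₁ : Integrable fun y => a * f₁ y + b * f₂ y := (h₁.const_mul a).add (h₂.const_mul b)
  rw [integral_add j₁ (h₃.const_mul c), integral_add (h₁.const_mul a) (h₂.const_mul b),
    integral_const_mul, integral_const_mul, integral_const_mul]

/-- Weighted radial energy. -/
def zrad {n : ℕ} (u v : Eu n → ℝ) (x : Eu n) (r : ℝ) : ℝ :=
  r ^ 2 * ∫ y, (rad u x r y ^ 2 + rad v x r y ^ 2) * kG y

namespace Sol

theorem smooth_sq (h : Sol u v) : Smooth fun y => u y ^ 2 + v y ^ 2 :=
  (h.su.pow 2).add (h.sv.pow 2)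

theorem smooth_itr (h : Sol u v) : Smooth fun y => u y ^ 2 * v y ^ 2 :=
  (h.su.pow 2).mul (h.sv.pow 2)

theorem lap_sq_add (h : Sol u v) (x : Eu n) :
    lap (fun y => u y ^ 2 + v y ^ 2) x = 2 * (dens u v x + u x ^ 2 * v x ^ 2) := by
  rw [lap_add (h.su.pow 2) (h.sv.pow 2), lap_sq h.su, lap_sq h.sv, h.lu, h.lv]
  unfold dens gsq; ring

theorem lap_sq_nonneg (h : Sol u v) (x : Eu n) : 0 ≤ lap (fun y => u y ^ 2 + v y ^ 2) x := by
  rw [h.lap_sq_add]; have := dens_nonneg u v x; positivity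

theorem hgt_deriv (h : Sol u v) (x : Eu n) (r : ℝ) :
    HasDerivAt (hgt u v x) (2 * r * (avk kQ (dens u v) x r
      + avk kQ (fun y => u y ^ 2 * v y ^ 2) x r)) r := by
  refine (hasDerivAt_avk h.smooth_sq x r).congr_deriv ?_
  rw [show lap (fun y => u y ^ 2 + v y ^ 2) = _ from funext h.lap_sq_add, avk_const_mul,
    avk_add (h.su.dens h.sv).continuous h.smooth_itr.continuous kQ_smooth.continuous kQ_supp]
  ring

theorem rad_sq_add (h : Sol u v) (x : Eu n) (r : ℝ) (y : Eu n) :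
    rad (fun y => u y ^ 2 + v y ^ 2) x r y
      = 2 * (u (x + r • y) * rad u x r y + v (x + r • y) * rad v x r y) := by
  unfold rad
  rw [Finset.mul_sum, Finset.mul_sum, ← Finset.sum_add_distrib, Finset.mul_sum]
  refine Finset.sum_congr rfl fun i _ => ?_
  rw [pd_add (h.su.pow 2) (h.sv.pow 2), pd_sq h.su, pd_sq h.sv]; ring

theorem eng_add_itr (h : Sol u v) (x : Eu n) (r : ℝ) : eng u v x r + itr u v x r
    = r * ∫ y, (u (x + r • y) * rad u x r y + v (x + r • y) * rad v x r y) * kG y := by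
  have h1 := (h.hgt_deriv x r).unique
    (hasDerivAt_avk_ray h.smooth_sq kG_smooth.continuous kG_supp x r)
  have h2 : ∀ y, (∑ i, y i * pd i (fun y => u y ^ 2 + v y ^ 2) (x + r • y)) * kG y
      = 2 * ((u (x + r • y) * rad u x r y + v (x + r • y) * rad v x r y) * kG y) := fun y => by
    have := h.rad_sq_add x r y
    unfold rad at this ⊢; rw [this]; ring
  simp_rw [h2] at h1
  rw [integral_const_mul] at h1
  unfold eng itr
  linear_combination r / 2 * h1

theorem eng_deriv (h : Sol u v) (x : Eu n) (r : ℝ) : ∃ D', HasDerivAt (eng u v x) D' r ∧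
    r * D' = 2 * zrad u v x r + 2 * itr u v x r := by
  have hd : Smooth (dens u v) := h.su.dens h.sv
  have h1 := ((hasDerivAt_pow 2 r).mul
    (hasDerivAt_avk_ray hd kQ_smooth.continuous kQ_supp x r))
  refine ⟨_, h1, ?_⟩
  have hA := pohozaev_aux h.su x r
  have hB := pohozaev_aux h.sv x r
  have ci : ∀ {F : Eu n → ℝ}, Smooth F → Integrable fun y => F y * kQ y :=
    fun hF => integrable_mul_of_compact hF.continuous kQ_smooth.continuous kQ_supp
  have cg : ∀ {F : Eu n → ℝ}, Smooth F → Integrable fun y => F y * kG y :=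
    fun hF => integrable_mul_of_compact hF.continuous kG_smooth.continuous kG_supp
  have hI : ∀ {f : Eu n → ℝ}, Smooth f → Integrable fun y =>
      ((2 * gsq f (x + r • y) + r * rad (gsq f) x r y
        + 2 * r * rad f x r y * lap f (x + r • y)) * kQ y - 2 * rad f x r y ^ 2 * kG y) := fun {f} hf =>
    (ci (((contDiff_const.mul (hf.gsq.affine x r)).add
      (contDiff_const.mul (rad_smooth hf.gsq x r))).add
      ((contDiff_const.mul (rad_smooth hf x r)).mul (hf.lap.affine x r)))).sub
      (cg (contDiff_const.mul ((rad_smooth hf x r).pow 2)))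
  have hsum := integral_add (hI h.su) (hI h.sv)
  rw [hA, hB, add_zero] at hsum
  have hpt : ∀ y, ((2 * gsq u (x + r • y) + r * rad (gsq u) x r y
        + 2 * r * rad u x r y * lap u (x + r • y)) * kQ y - 2 * rad u x r y ^ 2 * kG y)
      + ((2 * gsq v (x + r • y) + r * rad (gsq v) x r y
        + 2 * r * rad v x r y * lap v (x + r • y)) * kQ y - 2 * rad v x r y ^ 2 * kG y)
      = 2 * (dens u v (x + r • y) * kQ y - u (x + r • y) ^ 2 * v (x + r • y) ^ 2 * kQ y)
        + r * (rad (dens u v) x r y * kQ y)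
        + (-2) * ((rad u x r y ^ 2 + rad v x r y ^ 2) * kG y) := fun y => by
    have e1 : rad (dens u v) x r y = rad (gsq u) x r y + rad (gsq v) x r y
        + 2 * (u (x + r • y) * v (x + r • y) ^ 2 * rad u x r y
          + v (x + r • y) * u (x + r • y) ^ 2 * rad v x r y) := by
      unfold rad
      simp only [Finset.mul_sum]
      rw [← Finset.sum_add_distrib, ← Finset.sum_add_distrib, Finset.mul_sum,
        ← Finset.sum_add_distrib]
      refine Finset.sum_congr rfl fun i _ => ?_
      have : pd i (dens u v) (x + r • y) = pd i (gsq u) (x + r • y) + pd i (gsq v) (x + r • y)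
          + (u (x + r • y) ^ 2 * (2 * v (x + r • y) * pd i v (x + r • y))
            + v (x + r • y) ^ 2 * (2 * u (x + r • y) * pd i u (x + r • y))) := by
        unfold dens
        rw [pd_add (h.su.gsq.add h.sv.gsq) h.smooth_itr, pd_add h.su.gsq h.sv.gsq,
          pd_mul (h.su.pow 2) (h.sv.pow 2), pd_sq h.su, pd_sq h.sv]
      rw [this]; ring
    rw [e1, h.lu, h.lv]; unfold dens; ring
  simp_rw [hpt] at hsum
  have i1 := ci (hd.affine x r)
  have i2 := ci (h.smooth_itr.affine x r)
  have i3 := ci (rad_smooth hd x r)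
  have i4 := cg (((rad_smooth h.su x r).pow 2).add ((rad_smooth h.sv x r).pow 2))
  have i12 : Integrable fun y => dens u v (x + r • y) * kQ y
      - u (x + r • y) ^ 2 * v (x + r • y) ^ 2 * kQ y := i1.sub i2
  rw [integral_linear_combination₃ i12 i3 i4, integral_sub i1 i2] at hsum
  unfold zrad itr
  change r * (↑2 * r ^ (2 - 1) * (∫ y, dens u v (x + r • y) * kQ y)
    + r ^ 2 * ∫ y, rad (dens u v) x r y * kQ y) = 2 * (r ^ 2 * _)
    + 2 * (r ^ 2 * ∫ y, u (x + r • y) ^ 2 * v (x + r • y) ^ 2 * kQ y)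
  norm_num
  linear_combination r ^ 2 * hsum

theorem cauchy_schwarz (h : Sol u v) (x : Eu n) (r : ℝ) :
    (eng u v x r + itr u v x r) ^ 2 ≤ zrad u v x r * hgt u v x r := by
  rw [h.eng_add_itr]
  have cg : ∀ {F : Eu n → ℝ}, Smooth F → Integrable fun y => F y * kG y :=
    fun hF => integrable_mul_of_compact hF.continuous kG_smooth.continuous kG_supp
  have ha := rad_smooth h.su x r
  have hb := rad_smooth h.sv x r
  have hu := h.su.affine x r
  have hv := h.sv.affine x r
  have i1 := cg ((hu.pow 2).add (hv.pow 2))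
  have i2 := cg ((hu.mul ha).add (hv.mul hb))
  have i3 := cg ((ha.pow 2).add (hb.pow 2))
  have hq : ∀ t : ℝ, 0 ≤ (∫ y, (u (x + r • y) ^ 2 + v (x + r • y) ^ 2) * kG y) * (t * t)
      + (2 * ∫ y, (u (x + r • y) * rad u x r y + v (x + r • y) * rad v x r y) * kG y) * t
      + ∫ y, (rad u x r y ^ 2 + rad v x r y ^ 2) * kG y := fun t => by
    have h0 : 0 ≤ ∫ y, ((u (x + r • y) * t + rad u x r y) ^ 2
        + (v (x + r • y) * t + rad v x r y) ^ 2) * kG y :=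
      integral_nonneg fun y => mul_nonneg (by positivity) (kG_nonneg y)
    have hpt : ∀ y, ((u (x + r • y) * t + rad u x r y) ^ 2
        + (v (x + r • y) * t + rad v x r y) ^ 2) * kG y
        = (t * t) * ((u (x + r • y) ^ 2 + v (x + r • y) ^ 2) * kG y)
        + (2 * t) * ((u (x + r • y) * rad u x r y + v (x + r • y) * rad v x r y) * kG y)
        + 1 * ((rad u x r y ^ 2 + rad v x r y ^ 2) * kG y) := fun y => by ring
    simp_rw [hpt] at h0
    rw [integral_linear_combination₃ i1 i2 i3] at h0
    linarith
  have := discrim_le_zero hq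
  unfold discrim at this
  unfold zrad hgt avk
  nlinarith [sq_nonneg r]

theorem itr_nonneg (_h : Sol u v) : 0 ≤ itr u v x r :=
  mul_nonneg (sq_nonneg r) (avk_nonneg kQ_nonneg fun z => by positivity)

theorem itr_le_eng (h : Sol u v) : itr u v x r ≤ eng u v x r :=
  mul_le_mul_of_nonneg_left (integral_mono
    (integrable_avk h.smooth_itr.continuous kQ_smooth.continuous kQ_supp x r)
    (integrable_avk (h.su.dens h.sv).continuous kQ_smooth.continuous kQ_supp x r)
    fun y => mul_le_mul_of_nonneg_right (by
      have := gsq_nonneg u (x + r • y); have := gsq_nonneg v (x + r • y)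
      unfold dens; linarith) (kQ_nonneg y)) (sq_nonneg r)

theorem sq_le_hgt (h : Sol u v) (hr : 0 ≤ r) : u x ^ 2 + v x ^ 2 ≤ hgt u v x r :=
  le_avk_of_lap_nonneg h.smooth_sq h.lap_sq_nonneg x hr

theorem hgt_pos (h : Sol u v) (hr : 0 ≤ r) : 0 < hgt u v x r :=
  lt_of_lt_of_le (by have := h.pu x; have := h.pv x; positivity) (h.sq_le_hgt hr)

theorem hgt_mono (h : Sol u v) (x : Eu n) : MonotoneOn (hgt u v x) (Set.Ici 0) :=
  avk_monotoneOn h.smooth_sq h.lap_sq_nonneg x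

end Sol

/-- Frequency. -/
def freq {n : ℕ} (u v : Eu n → ℝ) (x : Eu n) (r : ℝ) : ℝ := eng u v x r / hgt u v x r

namespace Sol

theorem freq_deriv (h : Sol u v) (x : Eu n) (hr : 0 < r) : ∃ N', HasDerivAt (freq u v x) N' r ∧
    2 * itr u v x r ≤ r * N' * hgt u v x r := by
  obtain ⟨D', hD, hD'⟩ := h.eng_deriv x r
  have hH := h.hgt_deriv x r
  have hpos := h.hgt_pos (x := x) hr.le
  have hX : r * (2 * r * (avk kQ (dens u v) x r + avk kQ (fun y => u y ^ 2 * v y ^ 2) x r))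
      = 2 * (eng u v x r + itr u v x r) := by unfold eng itr; ring
  set H' := 2 * r * (avk kQ (dens u v) x r + avk kQ (fun y => u y ^ 2 * v y ^ 2) x r)
  refine ⟨_, hD.div hH hpos.ne', ?_⟩
  have hcs := h.cauchy_schwarz x r
  have hB := h.itr_nonneg (x := x) (r := r)
  have hE := hB.trans (h.itr_le_eng (x := x) (r := r))
  have e : r * ((D' * hgt u v x r - eng u v x r * H') / hgt u v x r ^ 2) * hgt u v x r
      = (r * D' * hgt u v x r - eng u v x r * (r * H')) / hgt u v x r := by
    field_simp
  rw [e, hD', hX, le_div_iff₀ hpos]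
  nlinarith [mul_nonneg hB hE]

theorem freq_monotoneOn (h : Sol u v) (x : Eu n) : MonotoneOn (freq u v x) (Set.Ioi 0) := by
  refine monotoneOn_of_deriv_nonneg (convex_Ioi 0) (fun r hr => ?_) (fun r hr => ?_) fun r hr => ?_
  · obtain ⟨N', hN, -⟩ := h.freq_deriv x hr
    exact hN.continuousAt.continuousWithinAt
  · rw [interior_Ioi] at hr
    obtain ⟨N', hN, -⟩ := h.freq_deriv x hr
    exact hN.differentiableAt.differentiableWithinAt
  · rw [interior_Ioi] at hr
    obtain ⟨N', hN, hl⟩ := h.freq_deriv x hr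
    rw [hN.deriv]
    have h1 := h.itr_nonneg (x := x) (r := r)
    have h2 := h.hgt_pos (x := x) (r := r) (Set.mem_Ioi.1 hr).le
    have h3 : 0 < r * hgt u v x r := mul_pos hr h2
    by_contra! hneg
    nlinarith [mul_pos h3 (neg_pos.2 hneg)]

theorem log_hgt_deriv (h : Sol u v) (x : Eu n) (hr : 0 < r) :
    HasDerivAt (fun r => Real.log (hgt u v x r))
      (2 * (freq u v x r + itr u v x r / hgt u v x r) / r) r := by
  refine ((h.hgt_deriv x r).log (h.hgt_pos hr.le).ne').congr_deriv ?_
  have := (h.hgt_pos (x := x) hr.le).ne'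
  unfold freq eng itr
  field_simp

theorem log_hgt_lower (h : Sol u v) {c ρ R : ℝ} (hρ : 0 < ρ) (hR : ρ ≤ R)
    (hc : c ≤ freq u v x ρ) :
    Real.log (hgt u v x ρ) + 2 * c * (Real.log R - Real.log ρ) ≤ Real.log (hgt u v x R) := by
  have hm : MonotoneOn (fun r => Real.log (hgt u v x r) - 2 * c * Real.log r) (Set.Icc ρ R) := by
    have hd : ∀ r, ρ ≤ r → HasDerivAt (fun r => Real.log (hgt u v x r) - 2 * c * Real.log r)
        (2 * (freq u v x r + itr u v x r / hgt u v x r) / r - 2 * c * r⁻¹) r := fun r hr =>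
      (h.log_hgt_deriv x (hρ.trans_le hr)).sub
        ((Real.hasDerivAt_log (hρ.trans_le hr).ne').const_mul _)
    refine monotoneOn_of_deriv_nonneg (convex_Icc ρ R)
      (fun r hr => (hd r hr.1).continuousAt.continuousWithinAt) (fun r hr => ?_) fun r hr => ?_
    · rw [interior_Icc] at hr
      exact (hd r hr.1.le).differentiableAt.differentiableWithinAt
    · rw [interior_Icc] at hr
      rw [(hd r hr.1.le).deriv]
      have hr0 := hρ.trans hr.1
      have h1 := hc.trans (h.freq_monotoneOn x (Set.mem_Ioi.2 hρ) (Set.mem_Ioi.2 hr0) hr.1.le)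
      have h2 := div_nonneg (h.itr_nonneg (x := x) (r := r)) (h.hgt_pos (x := x) hr0.le).le
      have : 2 * (freq u v x r + itr u v x r / hgt u v x r) / r - 2 * c * r⁻¹
          = 2 * (freq u v x r + itr u v x r / hgt u v x r - c) / r := by field_simp
      rw [this]
      exact div_nonneg (by linarith) hr0.le
  have := hm (Set.left_mem_Icc.2 hR) (Set.right_mem_Icc.2 hR) hR
  simp only at this
  linarith

theorem freq_le_one (h : Sol u v) (hr : 0 < r) : freq u v x r ≤ 1 := by
  by_contra! hN
  obtain ⟨C, hC, hg⟩ := h.growth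
  set c := freq u v x r with hc
  have hup : ∀ R, r ≤ R → 1 ≤ R →
      Real.log (hgt u v x R) ≤ 2 * Real.log (C * (2 + ‖x‖)) + 2 * Real.log R := by
    intro R hR hR1
    have hR0 : 0 < R := by linarith
    have h1 : hgt u v x R ≤ (C * (2 + ‖x‖) * R) ^ 2 := by
      refine avk_le h.smooth_sq.continuous hR0.le fun z hz => ?_
      have hz' : ‖z‖ ≤ ‖x‖ + R := by
        rw [mem_closedBall, dist_eq_norm] at hz
        have := norm_add_le (z - x) x
        rw [sub_add_cancel] at this; linarith
      have h2 : u z + v z ≤ C * (2 + ‖x‖) * R := by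
        refine (hg z).trans ?_
        rw [mul_assoc]
        refine mul_le_mul_of_nonneg_left ?_ hC.le
        nlinarith [norm_nonneg x]
      have := h.pu z; have := h.pv z
      nlinarith [mul_pos (h.pu z) (h.pv z)]
    have hpos : 0 < C * (2 + ‖x‖) := by positivity
    have h3 := Real.log_le_log (h.hgt_pos hR0.le) h1
    rw [Real.log_pow, Real.log_mul hpos.ne' hR0.ne'] at h3
    push_cast at h3; linarith
  have hlog := Real.tendsto_log_atTop
  set A := 2 * Real.log (C * (2 + ‖x‖)) - Real.log (hgt u v x r) + 2 * c * Real.log r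
  have hev := hlog.eventually_gt_atTop (A / (2 * (c - 1)))
  obtain ⟨R, hR1, hR2, hR3⟩ := (hev.and
    ((Filter.eventually_ge_atTop r).and (Filter.eventually_ge_atTop 1))).exists
  have h1 := h.log_hgt_lower (x := x) hr hR2 hc.ge
  have h2 := hup R hR2 hR3
  rw [div_lt_iff₀ (by linarith)] at hR1
  have : A = 2 * Real.log (C * (2 + ‖x‖)) - Real.log (hgt u v x r) + 2 * c * Real.log r := rfl
  nlinarith

theorem eng_le_hgt (h : Sol u v) (hr : 0 < r) : eng u v x r ≤ hgt u v x r := by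
  have := h.freq_le_one (x := x) hr
  unfold freq at this
  rwa [div_le_one (h.hgt_pos hr.le)] at this

theorem hgt_doubling (h : Sol u v) {R : ℝ} (hr : 0 < r) (hR : r ≤ R) :
    hgt u v x R ≤ Real.exp 1 * (R / r) ^ 2 * hgt u v x r := by
  have hm : AntitoneOn (fun r => Real.log (hgt u v x r) - 2 * Real.log r - freq u v x r)
      (Set.Icc r R) := by
    have hd : ∀ s, r ≤ s → ∃ N', 2 * itr u v x s ≤ s * N' * hgt u v x s ∧ HasDerivAt
        (fun r => Real.log (hgt u v x r) - 2 * Real.log r - freq u v x r)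
        (2 * (freq u v x s + itr u v x s / hgt u v x s) / s - 2 * s⁻¹ - N') s := fun s hs => by
      obtain ⟨N', hN, hl⟩ := h.freq_deriv x (hr.trans_le hs)
      exact ⟨N', hl, ((h.log_hgt_deriv x (hr.trans_le hs)).sub
        ((Real.hasDerivAt_log (hr.trans_le hs).ne').const_mul _)).sub hN⟩
    refine antitoneOn_of_deriv_nonpos (convex_Icc r R) (fun s hs => ?_) (fun s hs => ?_)
      fun s hs => ?_
    · obtain ⟨N', -, hd⟩ := hd s hs.1
      exact hd.continuousAt.continuousWithinAt
    · rw [interior_Icc] at hs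
      obtain ⟨N', -, hd⟩ := hd s hs.1.le
      exact hd.differentiableAt.differentiableWithinAt
    · rw [interior_Icc] at hs
      obtain ⟨N', hl, hd⟩ := hd s hs.1.le
      rw [hd.deriv]
      have hs0 := hr.trans hs.1
      have hH := h.hgt_pos (x := x) hs0.le
      have h1 : 2 * (itr u v x s / hgt u v x s) ≤ s * N' := by
        rw [← mul_div_assoc, div_le_iff₀ hH]; exact hl
      have h2 := h.freq_le_one (x := x) hs0
      have : 2 * (freq u v x s + itr u v x s / hgt u v x s) / s - 2 * s⁻¹ - N'
          = (2 * freq u v x s - 2 + (2 * (itr u v x s / hgt u v x s) - s * N')) / s := by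
        field_simp; ring
      rw [this]
      exact div_nonpos_of_nonpos_of_nonneg (by linarith) hs0.le
  have h1 := hm (Set.left_mem_Icc.2 hR) (Set.right_mem_Icc.2 hR) hR
  simp only at h1
  have hR0 := hr.trans_le hR
  have h2 : 0 ≤ freq u v x r :=
    div_nonneg (h.itr_nonneg.trans h.itr_le_eng) (h.hgt_pos hr.le).le
  have h3 := h.freq_le_one (x := x) hR0
  have hpos := h.hgt_pos (x := x) hr.le
  rw [← Real.log_le_log_iff (h.hgt_pos hR0.le) (by positivity),
    Real.log_mul (by positivity) hpos.ne', Real.log_mul (by positivity) (by positivity),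
    Real.log_exp, Real.log_pow, Real.log_div hR0.ne' hr.ne']
  push_cast; linarith

end Sol
end Frequency

section Heights
variable {n : ℕ} {u v f : Eu n → ℝ} {x : Eu n} {r : ℝ}

theorem avk_affine (K f : Eu n → ℝ) (p y : Eu n) (r s : ℝ) :
    avk K (fun z => f (p + r • z)) y s = avk K f (p + r • y) (r * s) := by
  unfold avk; congr 1; ext z
  simp only [smul_add, smul_smul, add_assoc]

theorem hgt_affine (u v : Eu n → ℝ) (p y : Eu n) (r s : ℝ) :
    hgt (fun y => r * u (p + r • y)) (fun y => r * v (p + r • y)) y s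
      = r ^ 2 * hgt u v (p + r • y) (r * s) := by
  unfold hgt
  rw [← avk_affine, ← avk_const_mul]; congr 1; ext z; ring

theorem eng_affine (hu : Smooth u) (hv : Smooth v) (p y : Eu n) (r s : ℝ) :
    eng (fun y => r * u (p + r • y)) (fun y => r * v (p + r • y)) y s
      = r ^ 2 * eng u v (p + r • y) (r * s) := by
  unfold eng
  rw [show dens (fun y => r * u (p + r • y)) (fun y => r * v (p + r • y))
    = _ from funext (dens_affine hu hv p r), avk_const_mul, avk_affine]
  ring

theorem hgt_comm (u v : Eu n → ℝ) (x : Eu n) (r : ℝ) : hgt u v x r = hgt v u x r := by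
  unfold hgt; congr 1; ext y; ring

theorem exists_hgt_compare (n : ℕ) {Λ : ℝ} (hΛ : 0 ≤ Λ) : ∃ C ≥ 1, ∀ u v : Eu n → ℝ, Sol u v →
    ∀ x z r, 0 < r → ‖z - x‖ ≤ Λ * r → hgt u v z r ≤ C * hgt u v x r := by
  obtain ⟨C, hC, hcmp⟩ := exists_avk_compare n
  refine ⟨1 + C * (2 * (Λ + 1)) ^ n * (Real.exp 1 * (2 * (Λ + 1)) ^ 2),
    le_add_of_nonneg_right (by positivity), fun u v h x z r hr hz => ?_⟩
  have h1 := hcmp _ z x r (2 * (Λ + 1) * r) h.smooth_sq.continuous (fun y => by positivity) hr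
    (by positivity) (by nlinarith)
  have h2 := avk_kQ_le (x := x) (r := 2 * (Λ + 1) * r) h.smooth_sq.continuous
    (fun y => by positivity)
  have h3 := h.hgt_doubling (x := x) hr (R := 2 * (Λ + 1) * r) (by nlinarith)
  have e : 2 * (Λ + 1) * r / r = 2 * (Λ + 1) := by field_simp
  rw [e] at h1 h3
  have hH := (h.hgt_pos (x := x) hr.le).le
  calc hgt u v z r ≤ C * (2 * (Λ + 1)) ^ n * hgt u v x (2 * (Λ + 1) * r) :=
        h1.trans (mul_le_mul_of_nonneg_left h2 (by positivity))
    _ ≤ C * (2 * (Λ + 1)) ^ n * (Real.exp 1 * (2 * (Λ + 1)) ^ 2 * hgt u v x r) := by gcongr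
    _ ≤ _ := by nlinarith

theorem exists_sup_bound (n : ℕ) {Λ : ℝ} (hΛ : 0 ≤ Λ) : ∃ C ≥ 1, ∀ u v : Eu n → ℝ, Sol u v →
    ∀ x z r, 0 < r → ‖z - x‖ ≤ Λ * r → u z ^ 2 + v z ^ 2 ≤ C * hgt u v x r := by
  obtain ⟨C, hC, h⟩ := exists_hgt_compare n hΛ
  exact ⟨C, hC, fun u v hs x z r hr hz => (hs.sq_le_hgt hr.le).trans (h u v hs x z r hr hz)⟩

theorem norm_le_of_mem {z x : Eu n} {ρ : ℝ} (hz : z ∈ closedBall x ρ) : ‖z‖ ≤ ‖x‖ + ρ := by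
  rw [mem_closedBall, dist_eq_norm] at hz
  have := norm_add_le (z - x) x
  rw [sub_add_cancel] at this; linarith

theorem exists_eng_lower (n : ℕ) : ∃ c > 0, c ≤ 1 / 2 ∧ ∀ u v : Eu n → ℝ, Sol u v → u 0 = v 0 →
    hgt u v 0 1 = 1 → c ≤ eng u v 0 1 := by
  obtain ⟨C, hC, hsup⟩ := exists_sup_bound n (Λ := 2) (by norm_num)
  obtain ⟨C1, hC1, hcmp⟩ := exists_avk_compare n
  set E := Real.exp ((1 + C) ^ 2 * 1 ^ 2 / 2)
  have hE : 0 < E := Real.exp_pos _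
  set m0 := 1 / (2 * (1 + C) * E)
  set c2 := m0 / (C1 * 8 ^ n * E)
  have hm0 : 0 < m0 := by positivity
  have hc2 : 0 < c2 := by positivity
  have lower : ∀ u v : Eu n → ℝ, Sol u v → (∀ z, ‖z‖ ≤ 2 → v z ≤ 1 + C) → m0 ≤ u 0 →
      ∀ z, ‖z‖ ≤ 1 / 4 → c2 ≤ u z := fun u v h hb hm z hz => by
    have h1 := le_avk_of_lap_nonneg h.su (fun z => by
      rw [h.lu]; have := h.pu z; positivity) 0 (r := 1 / 8) (by norm_num)
    have h2 := hcmp u 0 z (1 / 8) 1 h.su.continuous (fun y => (h.pu y).le) (by norm_num)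
      (by norm_num) (by rw [zero_sub, norm_neg]; linarith)
    have h3 := avk_kQ_le (x := z) (r := 1) h.su.continuous (fun y => (h.pu y).le)
    have h4 := avk_le_of_lap_le h.su (fun y => (h.pu y).le) (K := (1 + C) ^ 2) (by positivity) z
      (r := 1) (by norm_num) (fun y hy => by
        have h5 := hb y (by have := norm_le_of_mem hy; linarith)
        rw [h.lu, mul_comm]
        exact mul_le_mul_of_nonneg_right (pow_le_pow_left₀ (h.pv y).le h5 2) (h.pu y).le)
    rw [show (1 : ℝ) / (1 / 8) = 8 by norm_num] at h2
    have h6 : m0 ≤ C1 * 8 ^ n * (E * u z) :=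
      hm.trans (h1.trans (h2.trans (mul_le_mul_of_nonneg_left (h3.trans h4) (by positivity))))
    rw [div_le_iff₀ (by positivity)]; linarith
  refine ⟨min (1 / 2) (c2 ^ 4 / (C1 * 8 ^ n)), by positivity, min_le_left _ _,
    fun u v h h0 h1 => (min_le_right _ _).trans ?_⟩
  have hsup' : ∀ z, ‖z‖ ≤ 2 → u z ≤ 1 + C ∧ v z ≤ 1 + C := fun z hz => by
    have := hsup u v h 0 z 1 one_pos (by simpa using hz)
    rw [h1] at this
    constructor <;> nlinarith [sq_nonneg (u z), sq_nonneg (v z), h.pu z, h.pv z]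
  have hg : Smooth (fun y => u y + v y) := h.su.add h.sv
  have h2 : hgt u v 0 1 ≤ (1 + C) * avk kG (fun y => u y + v y) 0 1 := by
    rw [← avk_const_mul]
    refine avk_mono h.smooth_sq.continuous (continuous_const.mul hg.continuous)
      kG_smooth.continuous kG_nonneg (fun _ => kG_eq_zero) zero_le_one fun z hz => ?_
    have hz' := hsup' z (by have := norm_le_of_mem hz; rw [norm_zero] at this; linarith)
    nlinarith [h.pu z, h.pv z]
  have h3 := avk_le_of_lap_le hg (fun y => (add_pos (h.pu y) (h.pv y)).le) (K := (1 + C) ^ 2)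
    (by positivity) 0 (r := 1) (by norm_num) (fun z hz => by
      have hz' := hsup' z (by have := norm_le_of_mem hz; rw [norm_zero] at this; linarith)
      rw [lap_add h.su h.sv, h.lu, h.lv]
      have := pow_le_pow_left₀ (h.pv z).le hz'.2 2
      have := pow_le_pow_left₀ (h.pu z).le hz'.1 2
      nlinarith [h.pu z, h.pv z])
  have hm : m0 ≤ u 0 := by
    rw [h1] at h2
    have : 1 ≤ (1 + C) * (E * (u 0 + v 0)) :=
      h2.trans (mul_le_mul_of_nonneg_left h3 (by positivity))
    rw [← h0] at this
    rw [div_le_iff₀ (by positivity)]; linarith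
  have hl1 := lower u v h (fun z hz => (hsup' z hz).2) hm
  have hl2 := lower v u h.swap (fun z hz => (hsup' z hz).1) (h0 ▸ hm)
  have h4 := hcmp (fun y => u y ^ 2 * v y ^ 2) 0 0 (1 / 8) 1 h.smooth_itr.continuous
    (fun y => by positivity) (by norm_num) (by norm_num) (by simp; norm_num)
  have h5 : c2 ^ 4 ≤ avk kG (fun y => u y ^ 2 * v y ^ 2) 0 (1 / 8) := by
    refine le_avk h.smooth_itr.continuous (by norm_num) fun z hz => ?_
    have hz' : ‖z‖ ≤ 1 / 4 := by have := norm_le_of_mem hz; rw [norm_zero] at this; linarith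
    have a1 := pow_le_pow_left₀ hc2.le (hl1 z hz') 2
    have a2 := pow_le_pow_left₀ hc2.le (hl2 z hz') 2
    calc c2 ^ 4 = c2 ^ 2 * c2 ^ 2 := by ring
      _ ≤ _ := mul_le_mul a1 a2 (by positivity) (by positivity)
  rw [show (1 : ℝ) / (1 / 8) = 8 by norm_num] at h4
  have h6 := h.itr_le_eng (x := 0) (r := 1)
  have h7 : itr u v 0 1 = avk kQ (fun y => u y ^ 2 * v y ^ 2) 0 1 := by unfold itr; ring
  rw [div_le_iff₀ (by positivity)]
  calc c2 ^ 4 ≤ _ := h5.trans h4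
    _ ≤ C1 * 8 ^ n * eng u v 0 1 := by
      rw [← h7]; exact mul_le_mul_of_nonneg_left h6 (by positivity)
    _ = _ := by ring

/-- Decay at points of equality. -/
theorem exists_zero_decay (n : ℕ) : ∃ β : ℝ, 2 / 3 ≤ β ∧ β < 1 ∧ ∀ u v : Eu n → ℝ, Sol u v →
    ∀ p, u p = v p → 1 ≤ hgt u v p 1 → u p ^ 2 ≤ hgt u v p 1 ^ β := by
  obtain ⟨c, hc, hc2, hlow⟩ := exists_eng_lower n
  refine ⟨1 / (1 + c), by rw [le_div_iff₀ (by positivity)]; linarith,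
    by rw [div_lt_iff₀ (by positivity)]; linarith, fun u v h p hp h1 => ?_⟩
  have hcont : ContinuousOn (fun ρ => ρ ^ 2 * hgt u v p ρ) (Set.Icc 0 1) := fun ρ _ =>
    ((continuous_pow 2).continuousAt.mul (h.hgt_deriv p ρ).continuousAt).continuousWithinAt
  obtain ⟨ρ, ⟨hρ0, hρ1⟩, hρ⟩ := intermediate_value_Icc zero_le_one hcont
    (show (1 : ℝ) ∈ _ by constructor <;> simp [h1])
  simp only at hρ
  have hρpos : 0 < ρ := lt_of_le_of_ne hρ0 fun h => by rw [← h] at hρ; simp at hρ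
  have hS := h.rescale p hρpos
  have h2 := hlow _ _ hS (by simp [hp]) (by rw [hgt_affine]; simpa using hρ)
  rw [eng_affine h.su h.sv] at h2
  simp only [smul_zero, add_zero, mul_one] at h2
  have hH := h.hgt_pos (x := p) hρ0
  have h3 : c ≤ freq u v p ρ := by
    unfold freq
    rw [le_div_iff₀ hH]
    have : 0 < ρ ^ 2 := by positivity
    nlinarith
  have h4 := h.log_hgt_lower (x := p) hρpos hρ1 h3
  have h5 : Real.log (hgt u v p ρ) = -2 * Real.log ρ := by
    have := congrArg Real.log hρ
    rw [Real.log_mul (by positivity) hH.ne', Real.log_pow, Real.log_one] at this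
    push_cast at this; linarith
  have h6 : u p ^ 2 ≤ hgt u v p ρ :=
    (le_add_of_nonneg_right (sq_nonneg _)).trans (h.sq_le_hgt hρ0)
  refine h6.trans ?_
  rw [← Real.log_le_log_iff hH (Real.rpow_pos_of_pos (by linarith) _), Real.log_rpow (by linarith),
    div_mul_eq_mul_div, le_div_iff₀ (by positivity)]
  rw [Real.log_one, h5] at h4
  rw [h5]; linarith

/-- The smaller component is controlled by a power of the height below one half. -/
theorem exists_min_bound (n : ℕ) : ∃ γ : ℝ, 1 / 3 ≤ γ ∧ γ < 1 / 2 ∧ ∃ C ≥ 1, ∀ u v : Eu n → ℝ,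
    Sol u v → C ≤ hgt u v 0 1 → ∀ z, ‖z‖ ≤ 8 → min (u z) (v z) ≤ C * hgt u v 0 1 ^ γ := by
  obtain ⟨β, hβ, hβ1, hdec⟩ := exists_zero_decay n
  obtain ⟨C1, hC1, hcmp⟩ := exists_hgt_compare n (Λ := 16) (by norm_num)
  obtain ⟨C2, hC2, hsup⟩ := exists_sup_bound n (Λ := 16) (by norm_num)
  set A : ℝ := 1 + n * C2
  have hA : 1 ≤ A := le_add_of_nonneg_right (by positivity)
  set C := 2 * A * C1 with hCdef
  have hCC1 : C1 ≤ C := by nlinarith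
  have key : ∀ u v : Eu n → ℝ, Sol u v → C ≤ hgt u v 0 1 → ∀ z, ‖z‖ ≤ 8 → u z ≤ v z →
      u z ≤ C * hgt u v 0 1 ^ (β / 2) := by
    intro u v h hH x1 hx1 hle
    set H := hgt u v 0 1
    by_contra! hs
    have hC1H : C1 ≤ H := hCC1.trans hH
    have hH0 : 0 < H := by linarith
    have hH1 : 1 ≤ H := hC1.trans hC1H
    have hpow : 0 < H ^ (β / 2) := Real.rpow_pos_of_pos hH0 _
    have hzero : ∀ p, ‖p‖ ≤ 16 → u p = v p → u p ≤ C1 * H ^ (β / 2) := fun p hp hpe => by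
      have h1 := hcmp u v h 0 p 1 one_pos (by simpa using hp)
      have h2 := hcmp u v h p 0 1 one_pos (by simpa using hp)
      have h3 : 1 ≤ hgt u v p 1 := by
        have h4 : C1 * 1 ≤ C1 * hgt u v p 1 := by linarith
        exact le_of_mul_le_mul_left h4 (by linarith)
      have h4 := hdec u v h p hpe h3
      have h5 : hgt u v p 1 ^ β ≤ (C1 * H) ^ β :=
        Real.rpow_le_rpow (by linarith) h1 (by linarith)
      have h6 : (C1 * H) ^ β ≤ (C1 * H ^ (β / 2)) ^ 2 := by
        rw [Real.mul_rpow (by linarith) hH0.le, mul_pow, ← Real.rpow_natCast (H ^ (β / 2)) 2,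
          ← Real.rpow_mul hH0.le]
        have : β / 2 * (2 : ℕ) = β := by push_cast; ring
        rw [this]
        refine mul_le_mul_of_nonneg_right ?_ (Real.rpow_nonneg hH0.le _)
        calc C1 ^ β ≤ C1 ^ (1 : ℝ) := Real.rpow_le_rpow_of_exponent_le hC1 hβ1.le
          _ = C1 := Real.rpow_one _
          _ ≤ C1 ^ 2 := by nlinarith
      have h7 : u p ^ 2 ≤ (C1 * H ^ (β / 2)) ^ 2 := h4.trans (h5.trans h6)
      exact (sq_le_sq₀ (h.pu p).le (by positivity)).1 h7
    set M := Real.sqrt (C2 * H)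
    have hM0 : 0 ≤ M := Real.sqrt_nonneg _
    have hM : ∀ z, ‖z‖ ≤ 16 → u z ≤ M := fun z hz => by
      have := hsup u v h 0 z 1 one_pos (by simpa using hz)
      exact Real.le_sqrt_of_sq_le (by nlinarith [sq_nonneg (v z)])
    obtain ⟨x2, hx2S, hx2R, hx2u, hx2l⟩ := exists_quadratic_max h.su
      (S := {z | u z ≤ v z}) (isClosed_le h.su.continuous h.sv.continuous) (x1 := x1) hle
      (R := 8) (a := M / 64) (M := M) (by norm_num) (by positivity)
      (fun z _ hz => hM z (by
        have := norm_add_le (z - x1) x1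
        rw [sub_add_cancel] at this; linarith)) (by have := h.pu x1; linarith)
    have hx2 : ‖x2‖ ≤ 16 := by
      have := norm_add_le (x2 - x1) x1
      rw [sub_add_cancel] at this; linarith
    have hs2 : C * H ^ (β / 2) < u x2 := hs.trans_le hx2u
    rcases (show u x2 ≤ v x2 from hx2S).lt_or_eq with hlt | heq
    · have h_int : x2 ∈ interior {z | u z ≤ v z} :=
        mem_interior.2 ⟨{z | u z < v z}, fun z hz => show u z ≤ v z from
          le_of_lt (show u z < v z from hz),
          isOpen_lt h.su.continuous h.sv.continuous, hlt⟩
      have h1 := hx2l h_int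
      rw [h.lu] at h1
      have h2 : (C * H ^ (β / 2)) ^ 3 ≤ u x2 * v x2 ^ 2 := by
        have a1 : (C * H ^ (β / 2)) ^ 3 ≤ u x2 ^ 3 := pow_le_pow_left₀ (by positivity) hs2.le 3
        have a2 : u x2 ^ 2 ≤ v x2 ^ 2 := pow_le_pow_left₀ (h.pu x2).le hlt.le 2
        nlinarith [h.pu x2]
      have h3 : H ≤ (H ^ (β / 2)) ^ 3 := by
        rw [← Real.rpow_natCast, ← Real.rpow_mul hH0.le]
        conv_lhs => rw [← Real.rpow_one H]
        exact Real.rpow_le_rpow_of_exponent_le hH1 (by push_cast; linarith)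
      have h4 : M ≤ C2 * H := by
        rw [Real.sqrt_le_left (by positivity)]
        nlinarith [mul_le_mul hC2 hH1 zero_le_one (by linarith)]
      have h5 : C ^ 3 * H ≤ 2 * n * (C2 * H / 64) := by
        have : C ^ 3 * H ≤ (C * H ^ (β / 2)) ^ 3 := by
          rw [mul_pow C]
          exact mul_le_mul_of_nonneg_left h3 (pow_nonneg (by linarith) _)
        refine this.trans (h2.trans (h1.trans ?_))
        gcongr
      have h6 : C ^ 3 ≤ n * C2 := by
        have : C ^ 3 * H ≤ (n * C2) * H := by nlinarith [mul_nonneg (Nat.cast_nonneg (α := ℝ) n) (mul_nonneg (by linarith : 0 ≤ C2) hH0.le)]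
        exact le_of_mul_le_mul_right this hH0
      have h7 : A ≤ C := by nlinarith
      have h8 : C ≤ C ^ 3 := by nlinarith [sq_nonneg C, mul_nonneg (by linarith : (0:ℝ) ≤ C - 1) (by linarith : (0:ℝ) ≤ C)]
      have : A = 1 + n * C2 := rfl
      linarith
    · have := hzero x2 hx2 heq
      have h9 : C1 * H ^ (β / 2) ≤ C * H ^ (β / 2) := mul_le_mul_of_nonneg_right hCC1 hpow.le
      linarith
  refine ⟨β / 2, by linarith, by linarith, C, by linarith, fun u v h hH z hz => ?_⟩
  rcases le_total (u z) (v z) with hle | hle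
  · rw [min_eq_left hle]; exact key u v h hH z hz hle
  · rw [min_eq_right hle]
    rw [hgt_comm] at hH ⊢
    exact key v u h.swap hH z hz hle

end Heights

section Competitor
variable {n : ℕ} {u v f : Eu n → ℝ} {x : Eu n} {r : ℝ}

theorem deriv_expNegInvGlue (t : ℝ) :
    deriv expNegInvGlue t = (t⁻¹) ^ 2 * expNegInvGlue t := by
  have h := expNegInvGlue.hasDerivAt_polynomial_eval_inv_mul 1 t
  simp only [Polynomial.eval_one, one_mul, Polynomial.derivative_one, sub_zero, mul_one,
    Polynomial.eval_pow, Polynomial.eval_X] at h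
  exact h.deriv

theorem deriv_mul_glue (t : ℝ) :
    HasDerivAt (fun t => t * expNegInvGlue t)
      (expNegInvGlue t + t * ((t⁻¹) ^ 2 * expNegInvGlue t)) t := by
  have h : DifferentiableAt ℝ expNegInvGlue t :=
    ((expNegInvGlue.contDiff (n := 1)).differentiable (by simp)).differentiableAt
  refine ((hasDerivAt_id t).mul h.hasDerivAt).congr_deriv ?_
  rw [deriv_expNegInvGlue]; simp

/-- Smooth truncations of the positive part at height `a * s`. -/
structure IsTrunc (s a : ℝ) (Θ : ℝ → ℝ) : Prop where
  smooth : ContDiff ℝ (⊤ : ℕ∞) Θ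
  zero : ∀ t ≤ a * s, Θ t = 0 ∧ deriv Θ t = 0
  deriv_mem : ∀ t, 0 ≤ deriv Θ t ∧ deriv Θ t ≤ 1
  nonneg : ∀ t, 0 ≤ Θ t
  le_self : ∀ t, 0 ≤ t → Θ t ≤ t
  self_le : ∀ t, t ≤ Θ t + (1 + a) * s

theorem exists_trunc {s a : ℝ} (hs : 0 < s) (ha : 0 ≤ a) : ∃ Θ : ℝ → ℝ, IsTrunc s a Θ := by
  have hval : ∀ t : ℝ, 0 < t → expNegInvGlue t = Real.exp (-t⁻¹) := fun t ht => by
    simp [expNegInvGlue, not_le.2 ht]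
  set θ : ℝ → ℝ := fun t => t * expNegInvGlue t
  have hθ : ContDiff ℝ (⊤ : ℕ∞) θ := contDiff_id.mul expNegInvGlue.contDiff
  have hd : ∀ t, HasDerivAt (fun t => s * θ (t / s - a))
      (expNegInvGlue (t / s - a)
        + (t / s - a) * (((t / s - a)⁻¹) ^ 2 * expNegInvGlue (t / s - a))) t := fun t => by
    have h1 : HasDerivAt (fun t : ℝ => t / s - a) (1 / s) t :=
      ((hasDerivAt_id t).div_const s).sub_const a
    refine (((deriv_mul_glue (t / s - a)).comp t h1).const_mul s).congr_deriv ?_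
    field_simp
  have h0 : ∀ t ≤ a * s, expNegInvGlue (t / s - a) = 0 := fun t ht =>
    expNegInvGlue.zero_of_nonpos (by rw [sub_nonpos, div_le_iff₀ hs]; exact ht)
  have hnn : ∀ t, 0 ≤ s * θ (t / s - a) := fun t => by
    rcases le_or_gt t (a * s) with ht | ht
    · simp only [θ, h0 t ht, mul_zero, le_refl]
    · have : 0 < t / s - a := by rw [sub_pos, lt_div_iff₀ hs]; exact ht
      exact mul_nonneg hs.le (mul_nonneg this.le (expNegInvGlue.nonneg _))
  refine ⟨fun t => s * θ (t / s - a),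
    contDiff_const.mul (hθ.comp ((contDiff_id.div_const s).sub contDiff_const)),
    fun t ht => ⟨by simp only [θ, h0 t ht, mul_zero], by
      rw [(hd t).deriv, h0 t ht]; simp⟩, fun t => ?_, hnn, fun t ht => ?_, fun t => ?_⟩
  · rw [(hd t).deriv]
    rcases le_or_gt t (a * s) with ht | ht
    · rw [h0 t ht]; simp
    · have hp : 0 < t / s - a := by rw [sub_pos, lt_div_iff₀ hs]; exact ht
      set τ := t / s - a
      have h1 : expNegInvGlue τ + τ * ((τ⁻¹) ^ 2 * expNegInvGlue τ)
          = (1 + τ⁻¹) * Real.exp (-τ⁻¹) := by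
        rw [hval τ hp]; field_simp
      have hi : 0 < τ⁻¹ := inv_pos.2 hp
      rw [h1]
      refine ⟨by positivity, ?_⟩
      rw [Real.exp_neg, ← div_eq_mul_inv, div_le_one (Real.exp_pos _), add_comm]
      exact Real.add_one_le_exp _
  · rcases le_or_gt t (a * s) with h1 | h1
    · simp only [θ, h0 t h1, mul_zero]; exact ht
    · have hp : 0 < t / s - a := by rw [sub_pos, lt_div_iff₀ hs]; exact h1
      have h2 : expNegInvGlue (t / s - a) ≤ 1 := by
        rw [hval _ hp, Real.exp_le_one_iff]; have := inv_pos.2 hp; linarith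
      calc s * θ (t / s - a) ≤ s * ((t / s - a) * 1) := by
            refine mul_le_mul_of_nonneg_left (mul_le_mul_of_nonneg_left h2 hp.le) hs.le
        _ = t - s * a := by field_simp
        _ ≤ t := by nlinarith
  · rcases le_or_gt t (a * s) with h1 | h1
    · have := hnn t; nlinarith
    · have hp : 0 < t / s - a := by rw [sub_pos, lt_div_iff₀ hs]; exact h1
      have h2 : t / s - a - 1 ≤ θ (t / s - a) := by
        have h3 := Real.add_one_le_exp (-(t / s - a)⁻¹)
        simp only [θ]
        rw [hval _ hp]
        set τ := t / s - a
        have h4 : τ * (-τ⁻¹ + 1) ≤ τ * Real.exp (-τ⁻¹) := mul_le_mul_of_nonneg_left h3 hp.le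
        have h5 : τ * τ⁻¹ = 1 := mul_inv_cancel₀ hp.ne'
        linarith
      have h3 := mul_le_mul_of_nonneg_left h2 hs.le
      have h4 : s * (t / s - a - 1) = t - (1 + a) * s := by field_simp; ring
      linarith

/-- Competitor obtained by segregating the two components. -/
def cmpU {n : ℕ} (Θ Ψ : ℝ → ℝ) (χ q u v : Eu n → ℝ) (τ : ℝ) (y : Eu n) : ℝ :=
  u y + χ y * (Ψ (Θ (u y) - Θ (v y) + τ * q y) - u y)

variable {Θ Ψ : ℝ → ℝ} {χ q : Eu n → ℝ} {s τ : ℝ}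

theorem smooth_cmpU (hΘ : IsTrunc s 1 Θ) (hΨ : IsTrunc s 0 Ψ) (hχ : Smooth χ) (hq : Smooth q)
    (hu : Smooth u) (hv : Smooth v) : Smooth (cmpU Θ Ψ χ q u v τ) :=
  hu.add (hχ.mul ((hΨ.smooth.comp (((hΘ.smooth.comp hu).sub (hΘ.smooth.comp hv)).add
    (contDiff_const.mul hq))).sub hu))

theorem pd_trunc_sub (hΘ : IsTrunc s 1 Θ) (hu : Smooth u) (hv : Smooth v) (i : Fin n) (y : Eu n) :
    pd i (fun y => Θ (u y) - Θ (v y)) y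
      = deriv Θ (u y) * pd i u y - deriv Θ (v y) * pd i v y := by
  have hd : Differentiable ℝ Θ := hΘ.smooth.differentiable (by simp)
  rw [pd_sub (f := fun y => Θ (u y)) (g := fun y => Θ (v y)) (hΘ.smooth.comp hu)
    (hΘ.smooth.comp hv), pd_comp hd hu, pd_comp hd hv]

theorem pd_cmpU (hΘ : IsTrunc s 1 Θ) (hΨ : IsTrunc s 0 Ψ) (hχ : Smooth χ) (hq : Smooth q)
    (hu : Smooth u) (hv : Smooth v) (i : Fin n) (y : Eu n) :
    pd i (cmpU Θ Ψ χ q u v τ) y = pd i u y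
      + χ y * (deriv Ψ (Θ (u y) - Θ (v y) + τ * q y) * (deriv Θ (u y) * pd i u y
        - deriv Θ (v y) * pd i v y + τ * pd i q y) - pd i u y)
      + (Ψ (Θ (u y) - Θ (v y) + τ * q y) - u y) * pd i χ y := by
  have hW : Smooth fun y => Θ (u y) - Θ (v y) := (hΘ.smooth.comp hu).sub (hΘ.smooth.comp hv)
  have hZ : Smooth fun y => Θ (u y) - Θ (v y) + τ * q y := hW.add (contDiff_const.mul hq)
  have hP : Smooth fun y => Ψ (Θ (u y) - Θ (v y) + τ * q y) := hΨ.smooth.comp hZ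
  unfold cmpU
  rw [pd_add hu (hχ.mul (hP.sub hu)), pd_mul hχ (hP.sub hu), pd_sub hP hu,
    pd_comp (hΨ.smooth.differentiable (by simp)) hZ, pd_add hW (contDiff_const.mul hq),
    pd_const_mul τ hq, pd_trunc_sub hΘ hu hv]
  ring

theorem dens_eq_sum (u v : Eu n → ℝ) (y : Eu n) :
    dens u v y = ∑ i, (pd i u y ^ 2 + pd i v y ^ 2) + u y ^ 2 * v y ^ 2 := by
  unfold dens gsq; rw [Finset.sum_add_distrib]

/-- Bound for the density of the segregated competitor. -/
def cmpErr {n : ℕ} (Θ : ℝ → ℝ) (χ q u v : Eu n → ℝ) (s τ : ℝ) (y : Eu n) : ℝ :=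
  ∑ i, (2 * τ * (pd i (fun y => Θ (u y) - Θ (v y)) y * pd i q y) + τ ^ 2 * pd i q y ^ 2
    + 6 * s * ((|pd i u y| + |pd i v y|) * |pd i χ y|) + 18 * s ^ 2 * pd i χ y ^ 2)

theorem sq_sub_le {A a k c K : ℝ} (hA0 : 0 ≤ A) (hA1 : A ≤ 1) (hk0 : 0 ≤ k) (hk : k ≤ K) :
    (A * a - k * c) ^ 2 ≤ a ^ 2 + 2 * K * (|a| * |c|) + K ^ 2 * c ^ 2 := by
  have h1 : (A * a) ^ 2 ≤ a ^ 2 := by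
    rw [mul_pow]; exact mul_le_of_le_one_left (sq_nonneg a) (pow_le_one₀ hA0 hA1)
  have h2 : k ^ 2 ≤ K ^ 2 := pow_le_pow_left₀ hk0 hk 2
  have h3 : -(A * a * (k * c)) ≤ K * (|a| * |c|) := by
    refine (neg_le_abs _).trans ?_
    rw [abs_mul, abs_mul, abs_mul, abs_of_nonneg hA0, abs_of_nonneg hk0]
    have h4 : A * k ≤ K := by nlinarith
    have h5 : 0 ≤ |a| * |c| := by positivity
    nlinarith
  nlinarith [sq_nonneg c]

theorem dens_cmpU_le_aux (hs : 0 < s) (hΘ : IsTrunc s 1 Θ) (hΨ : IsTrunc s 0 Ψ) (hχ : Smooth χ)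
    (hq : Smooth q) (hu : Smooth u) (hv : Smooth v) {y : Eu n} (hu0 : 0 < u y) (hv0 : 0 < v y)
    (hvs : v y ≤ s) (hχ0 : 0 ≤ χ y) (hχ1 : χ y ≤ 1)
    (hcase : (χ y = 1 ∧ ∀ i, pd i χ y = 0) ∨ (q y = 0 ∧ ∀ i, pd i q y = 0)) :
    dens (cmpU Θ Ψ χ q u v τ) (cmpU Θ Ψ χ q v u (-τ)) y - dens u v y
      ≤ cmpErr Θ χ q u v s τ y := by
  obtain ⟨hΘv, hΘv'⟩ := hΘ.zero (v y) (by linarith)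
  have hpu := fun i => pd_cmpU (τ := τ) hΘ hΨ hχ hq hu hv i y
  have hpv := fun i => pd_cmpU (τ := -τ) hΘ hΨ hχ hq hv hu i y
  have hW := fun i => pd_trunc_sub hΘ hu hv i y
  obtain ⟨ht0, ht1⟩ := hΘ.deriv_mem (u y)
  rw [dens_eq_sum, dens_eq_sum]
  unfold cmpErr
  set Z := Θ (u y) - Θ (v y) + τ * q y with hZ
  have hZ' : Θ (v y) - Θ (u y) + -τ * q y = -Z := by rw [hZ]; ring
  simp only [hΘv', hZ'] at hpu hpv hW
  have hUy : cmpU Θ Ψ χ q u v τ y = u y + χ y * (Ψ Z - u y) := rfl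
  have hVy : cmpU Θ Ψ χ q v u (-τ) y = v y + χ y * (Ψ (-Z) - v y) := by
    rw [← hZ']; rfl
  suffices hmain : (∀ i, pd i (cmpU Θ Ψ χ q u v τ) y ^ 2 + pd i (cmpU Θ Ψ χ q v u (-τ)) y ^ 2
      ≤ pd i u y ^ 2 + pd i v y ^ 2 +
      (2 * τ * (pd i (fun y => Θ (u y) - Θ (v y)) y * pd i q y) + τ ^ 2 * pd i q y ^ 2
    + 6 * s * ((|pd i u y| + |pd i v y|) * |pd i χ y|) + 18 * s ^ 2 * pd i χ y ^ 2)) ∧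
      cmpU Θ Ψ χ q u v τ y ^ 2 * cmpU Θ Ψ χ q v u (-τ) y ^ 2 ≤ u y ^ 2 * v y ^ 2 by
    have := Finset.sum_le_sum (s := Finset.univ) fun i _ => hmain.1 i
    rw [Finset.sum_add_distrib (f := fun i => pd i u y ^ 2 + pd i v y ^ 2)] at this
    linarith [hmain.2]
  rcases hcase with ⟨h1, h2⟩ | ⟨h1, h2⟩
  · have hαβ : deriv Ψ Z ^ 2 + deriv Ψ (-Z) ^ 2 ≤ 1 ∧ Ψ Z * Ψ (-Z) = 0 := by
      obtain ⟨a0, a1⟩ := hΨ.deriv_mem Z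
      obtain ⟨b0, b1⟩ := hΨ.deriv_mem (-Z)
      rcases le_total Z 0 with hz | hz
      · obtain ⟨c0, c1⟩ := hΨ.zero Z (by linarith)
        rw [c0, c1]; constructor <;> nlinarith
      · obtain ⟨c0, c1⟩ := hΨ.zero (-Z) (by linarith)
        rw [c0, c1]; constructor <;> nlinarith
    refine ⟨fun i => ?_, ?_⟩
    · rw [hpu, hpv, hW, h1, h2]
      set a := pd i u y; set b := pd i v y; set d := pd i q y
      set α := deriv Ψ Z; set β := deriv Ψ (-Z); set t := deriv Θ (u y)
      have e1 : (a + 1 * (α * (t * a - 0 * b + τ * d) - a) + (Ψ Z - u y) * 0) ^ 2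
          + (b + 1 * (β * (0 * b - t * a + -τ * d) - b) + (Ψ (-Z) - v y) * 0) ^ 2
          = (α ^ 2 + β ^ 2) * (t * a + τ * d) ^ 2 := by ring
      rw [e1]
      have e2 : (α ^ 2 + β ^ 2) * (t * a + τ * d) ^ 2 ≤ 1 * (t * a + τ * d) ^ 2 :=
        mul_le_mul_of_nonneg_right hαβ.1 (sq_nonneg _)
      have e3 : (t * a) ^ 2 ≤ a ^ 2 := by
        rw [mul_pow]; exact mul_le_of_le_one_left (sq_nonneg a) (pow_le_one₀ ht0 ht1)
      simp only [abs_zero, mul_zero]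
      nlinarith [sq_nonneg b]
    · rw [hUy, hVy, h1, ← mul_pow]
      rw [show (u y + 1 * (Ψ Z - u y)) * (v y + 1 * (Ψ (-Z) - v y)) = Ψ Z * Ψ (-Z) by ring, hαβ.2]
      rw [zero_pow two_ne_zero]; positivity
  · have hZu : Z = Θ (u y) := by rw [hZ, hΘv, h1]; ring
    obtain ⟨c0, c1⟩ := hΨ.zero (-Z) (by rw [hZu]; have := hΘ.nonneg (u y); linarith)
    obtain ⟨a0, a1⟩ := hΨ.deriv_mem Z
    have hk0 : 0 ≤ u y - Ψ Z := by
      have := hΨ.le_self Z (hZu ▸ hΘ.nonneg (u y))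
      have := hΘ.le_self (u y) hu0.le
      linarith
    have hk1 : u y - Ψ Z ≤ 3 * s := by
      have := hΨ.self_le Z
      have := hΘ.self_le (u y)
      linarith
    refine ⟨fun i => ?_, ?_⟩
    · rw [hpu, hpv, hW, h2, c0, c1]
      set a := pd i u y; set b := pd i v y; set c := pd i χ y
      set α := deriv Ψ Z; set t := deriv Θ (u y)
      have e1 := sq_sub_le (A := 1 - χ y + χ y * (α * t)) (a := a) (c := c) (by
          have : 0 ≤ χ y * (α * t) := by positivity
          linarith) (by nlinarith [mul_le_mul a1 ht1 ht0 zero_le_one]) hk0 hk1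
      have e2 := sq_sub_le (A := 1 - χ y) (a := b) (c := c) (k := v y) (K := 3 * s) (by linarith)
        (by linarith) hv0.le (by linarith)
      have e3 : a + χ y * (α * (t * a - 0 * b + τ * 0) - a) + (Ψ Z - u y) * c
          = (1 - χ y + χ y * (α * t)) * a - (u y - Ψ Z) * c := by ring
      have e4 : b + χ y * (0 * (0 * b - t * a + -τ * 0) - b) + (0 - v y) * c
          = (1 - χ y) * b - v y * c := by ring
      rw [e3, e4]
      linarith
    · rw [hUy, hVy, c0]
      refine mul_le_mul ?_ ?_ (sq_nonneg _) (sq_nonneg _)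
      · refine pow_le_pow_left₀ ?_ ?_ 2
        · have := hΨ.nonneg Z; nlinarith
        · nlinarith
      · refine pow_le_pow_left₀ ?_ ?_ 2 <;> nlinarith

theorem cmpErr_swap (hΘ : IsTrunc s 1 Θ) (hu : Smooth u) (hv : Smooth v) (y : Eu n) :
    cmpErr Θ χ q v u s (-τ) y = cmpErr Θ χ q u v s τ y := by
  unfold cmpErr
  refine Finset.sum_congr rfl fun i _ => ?_
  rw [pd_trunc_sub hΘ hu hv, pd_trunc_sub hΘ hv hu]; ring

theorem dens_cmpU_le (hs : 0 < s) (hΘ : IsTrunc s 1 Θ) (hΨ : IsTrunc s 0 Ψ) (hχ : Smooth χ)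
    (hq : Smooth q) (hu : Smooth u) (hv : Smooth v) {y : Eu n} (hu0 : 0 < u y) (hv0 : 0 < v y)
    (hmin : min (u y) (v y) ≤ s) (hχ0 : 0 ≤ χ y) (hχ1 : χ y ≤ 1)
    (hcase : (χ y = 1 ∧ ∀ i, pd i χ y = 0) ∨ (q y = 0 ∧ ∀ i, pd i q y = 0)) :
    dens (cmpU Θ Ψ χ q u v τ) (cmpU Θ Ψ χ q v u (-τ)) y - dens u v y
      ≤ cmpErr Θ χ q u v s τ y := by
  rcases min_le_iff.1 hmin with h | h
  · have := dens_cmpU_le_aux (τ := -τ) hs hΘ hΨ hχ hq hv hu hv0 hu0 h hχ0 hχ1 hcase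
    rw [neg_neg, cmpErr_swap hΘ hu hv] at this
    rwa [dens_comm _ _ y, dens_comm u v]
  · exact dens_cmpU_le_aux hs hΘ hΨ hχ hq hu hv hu0 hv0 h hχ0 hχ1 hcase

theorem hasCompactSupport_cmpU (hχ : HasCompactSupport χ) :
    HasCompactSupport fun y => cmpU Θ Ψ χ q u v τ y - u y := by
  have : (fun y => cmpU Θ Ψ χ q u v τ y - u y)
      = χ * fun y => (Ψ (Θ (u y) - Θ (v y) + τ * q y) - u y) := by
    ext y; simp only [cmpU, Pi.mul_apply]; ring
  rw [this]; exact hχ.mul_right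

/-- Near segregation the difference of the components is almost harmonic. -/
theorem exists_test_bound (hq : Smooth q) (hq1 : ∀ y, 1 ≤ ‖y‖ → q y = 0) :
    ∃ C > 0, ∀ u v : Eu n → ℝ, Sol u v → ∀ s > 0, (∀ z, ‖z‖ ≤ 3 → min (u z) (v z) ≤ s) →
      |∫ y, (u y - v y) * lap q y| ≤ C * √(s * √(hgt u v 0 1) + s ^ 2) := by
  let χ : ContDiffBump (0 : Eu n) := ⟨3 / 2, 2, by norm_num, by norm_num⟩
  have hχ : Smooth (χ : Eu n → ℝ) := χ.contDiff
  have hχs : HasCompactSupport (χ : Eu n → ℝ) := χ.hasCompactSupport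
  have hqs : HasCompactSupport q := hasCompactSupport_of_unit hq1
  have hχ1 : ∀ y : Eu n, ‖y‖ ≤ 5 / 4 → χ y = 1 ∧ ∀ i, pd i χ y = 0 := fun y hy => by
    have he : (χ : Eu n → ℝ) =ᶠ[nhds y] fun _ => 1 :=
      χ.eventuallyEq_one_of_mem_ball (by
        rw [mem_ball_zero_iff]; exact lt_of_le_of_lt hy (by norm_num [χ]))
    refine ⟨he.self_of_nhds, fun i => ?_⟩
    unfold pd; rw [he.fderiv_eq]; simp
  have hχ0 : ∀ y : Eu n, 2 < ‖y‖ → χ y = 0 ∧ ∀ i, pd i χ y = 0 := fun y hy => by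
    have he : (χ : Eu n → ℝ) =ᶠ[nhds y] 0 := notMem_tsupport_iff_eventuallyEq.1 (by
      rw [χ.tsupport_eq, mem_closedBall_zero_iff]; exact not_le.2 hy)
    refine ⟨he.self_of_nhds, fun i => ?_⟩
    unfold pd; rw [he.fderiv_eq]; simp
  have hq0 : ∀ y : Eu n, 5 / 4 < ‖y‖ → q y = 0 ∧ ∀ i, pd i q y = 0 := fun y hy => by
    have he : q =ᶠ[nhds y] 0 := by
      filter_upwards [(isOpen_lt continuous_const continuous_norm).mem_nhds hy] with z hz
      exact hq1 z (by linarith [show 5 / 4 < ‖z‖ from hz])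
    refine ⟨he.self_of_nhds, fun i => ?_⟩
    unfold pd; rw [he.fderiv_eq]; simp
  set b : Eu n → ℝ := fun y => ∑ i, |pd i χ y| with hb
  have hbc : Continuous b := continuous_finsetSum _ fun i _ => (hχ.pd i).continuous.abs
  have hb0 : ∀ y, 0 ≤ b y := fun y => Finset.sum_nonneg fun i _ => abs_nonneg _
  have hbz : ∀ y, 2 < ‖y‖ → b y = 0 := fun y hy =>
    Finset.sum_eq_zero fun i _ => by rw [(hχ0 y hy).2 i, abs_zero]
  have hbs : HasCompactSupport b := HasCompactSupport.intro (isCompact_closedBall (0 : Eu n) 2)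
    fun y hy => hbz y (by rwa [mem_closedBall_zero_iff, not_le] at hy)
  obtain ⟨K, hK, hKb⟩ := exists_bound_of_compact hbc hbs
  obtain ⟨c, hc, hcl⟩ := exists_kQ_lower (n := n)
  set X : Eu n → ℝ := fun y => ∑ i, pd i χ y ^ 2
  set Q : Eu n → ℝ := fun y => ∑ i, pd i q y ^ 2
  have hXi : Integrable X := integrable_finsetSum _ fun i _ =>
    ((hχ.pd i).pow 2).continuous.integrable_of_hasCompactSupport
      ((hasCompactSupport_pd hχs).comp_left (g := fun t => t ^ 2) (by simp))
  have hQi : Integrable Q := integrable_finsetSum _ fun i _ =>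
    ((hq.pd i).pow 2).continuous.integrable_of_hasCompactSupport
      ((hasCompactSupport_pd hqs).comp_left (g := fun t => t ^ 2) (by simp))
  have hbi : Integrable b := hbc.integrable_of_hasCompactSupport hbs
  have hLs : HasCompactSupport (lap q) := by
    have : lap q = fun y => ∑ i, pd i (pd i q) y := funext (lap_eq hq)
    refine HasCompactSupport.intro (isCompact_closedBall (0 : Eu n) 2) fun y hy => ?_
    rw [mem_closedBall_zero_iff, not_le] at hy
    have he : q =ᶠ[nhds y] 0 := by
      filter_upwards [(isOpen_lt continuous_const continuous_norm).mem_nhds hy] with z hz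
      exact hq1 z (by linarith [show 2 < ‖z‖ from hz])
    rw [this]
    refine Finset.sum_eq_zero fun i _ => ?_
    have h2 : pd i q =ᶠ[nhds y] 0 := by
      filter_upwards [(isOpen_lt continuous_const continuous_norm).mem_nhds hy] with z hz
      exact (hq0 z (by linarith [show 2 < ‖z‖ from hz])).2 i
    show pd i (pd i q) y = 0
    unfold pd; rw [show (fun x => fderiv ℝ q x (EuclideanSpace.single i 1)) = pd i q from rfl,
      h2.fderiv_eq]; simp
  have hLi : Integrable fun y => |lap q y| :=
    (hq.lap.continuous.integrable_of_hasCompactSupport hLs).abs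
  have hX0 : 0 ≤ ∫ y, X y := integral_nonneg fun y => Finset.sum_nonneg fun i _ => sq_nonneg _
  have hQ0 : 0 ≤ ∫ y, Q y := integral_nonneg fun y => Finset.sum_nonneg fun i _ => sq_nonneg _
  have hB0 : 0 ≤ ∫ y, b y := integral_nonneg hb0
  have hL0 : 0 ≤ ∫ y, |lap q y| := integral_nonneg fun y => abs_nonneg _
  set T := 3 * (K / c) * 4 ^ n * Real.exp 1
  set E := T + 6 * (∫ y, b y) + 18 * ∫ y, X y
  have hT0 : 0 < T := by positivity
  have hE0 : 0 < E := by positivity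
  refine ⟨((∫ y, Q y) + E) / 2 + 2 * ∫ y, |lap q y|, by positivity,
    fun u v h s hs hmin => ?_⟩
  set H := hgt u v 0 1 with hH
  have hHpos : 0 < H := h.hgt_pos zero_le_one
  set k := √H with hk
  have hkpos : 0 < k := Real.sqrt_pos.2 hHpos
  have hkk : k ^ 2 = H := Real.sq_sqrt hHpos.le
  set m := √(s * k + s ^ 2)
  have hmpos : 0 < m := Real.sqrt_pos.2 (by positivity)
  have hmm : m ^ 2 = s * k + s ^ 2 := Real.sq_sqrt (by positivity)
  have hsm : s ≤ m := Real.le_sqrt_of_sq_le (by nlinarith)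
  obtain ⟨Θ, hΘ⟩ := exists_trunc hs zero_le_one
  obtain ⟨Ψ, hΨ⟩ := exists_trunc hs le_rfl
  have hW : Smooth fun y => Θ (u y) - Θ (v y) := (hΘ.smooth.comp h.su).sub (hΘ.smooth.comp h.sv)
  set W : Eu n → ℝ := fun y => Θ (u y) - Θ (v y) with hWdef
  set I := ∫ y, ∑ i, pd i W y * pd i q y with hI
  have hIi : Integrable fun y => ∑ i, pd i W y * pd i q y := integrable_finsetSum _ fun i _ =>
    integrable_mul_of_compact (hW.pd i).continuous (hq.pd i).continuous (hasCompactSupport_pd hqs)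
  have hd : Smooth (dens u v) := h.su.dens h.sv
  set Y : Eu n → ℝ := fun y => dens u v y * kQ ((4 : ℝ)⁻¹ • y) with hY
  have hkQ4 : HasCompactSupport fun y : Eu n => kQ ((4 : ℝ)⁻¹ • y) :=
    HasCompactSupport.intro (isCompact_closedBall (0 : Eu n) 4) fun y hy => kQ_eq_zero (by
      rw [mem_closedBall_zero_iff, not_le] at hy
      rw [norm_smul, Real.norm_of_nonneg (by norm_num)]; linarith)
  have hYi : Integrable Y := integrable_mul_of_compact hd.continuous
    (kQ_smooth.continuous.comp (continuous_const_smul _)) hkQ4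
  have hYle : ∫ y, Y y ≤ 4 ^ n * (Real.exp 1 * H) := by
    have h1 := integral_affine Y 0 (s := 4) (by norm_num)
    have h2 : ∫ y, Y (0 + (4 : ℝ) • y) = avk kQ (dens u v) 0 4 := by
      unfold avk; congr 1; ext y
      simp only [hY, zero_add, smul_smul]; norm_num
    have h3 : avk kQ (dens u v) 0 4 ≤ Real.exp 1 * H := by
      have h4 := h.eng_le_hgt (x := 0) (r := 4) (by norm_num)
      have h5 := h.hgt_doubling (x := 0) (r := 1) (R := 4) one_pos (by norm_num)
      unfold eng at h4
      rw [← hH] at h5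
      nlinarith
    have h4 : ∫ y, Y y = 4 ^ n * avk kQ (dens u v) 0 4 := by
      rw [← h2, h1]; field_simp
    rw [h4]; gcongr
  have hdiff : ∀ τ y, dens (cmpU Θ Ψ χ q u v τ) (cmpU Θ Ψ χ q v u (-τ)) y - dens u v y
      ≤ 2 * τ * (∑ i, pd i W y * pd i q y) + τ ^ 2 * Q y
        + 1 * (3 * s / k * (K / c) * Y y + 6 * s * k * b y + 18 * s ^ 2 * X y) := fun τ y => by
    rcases lt_or_ge 2 ‖y‖ with hy | hy
    · have h1 : ∀ (u v : Eu n → ℝ) τ, Smooth u → Smooth v → cmpU Θ Ψ χ q u v τ y = u y ∧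
          ∀ i, pd i (cmpU Θ Ψ χ q u v τ) y = pd i u y := fun u v τ hu hv =>
        ⟨by simp [cmpU, (hχ0 y hy).1], fun i => by
          rw [pd_cmpU hΘ hΨ hχ hq hu hv, (hχ0 y hy).1, (hχ0 y hy).2]; ring⟩
      have h2 := h1 u v τ h.su h.sv
      have h3 := h1 v u (-τ) h.sv h.su
      have h4 : dens (cmpU Θ Ψ χ q u v τ) (cmpU Θ Ψ χ q v u (-τ)) y = dens u v y := by
        simp only [dens, gsq, h2.1, h3.1, h2.2, h3.2]
      have h5 := (hq0 y (by linarith)).2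
      have h6 : 0 ≤ Y y := mul_nonneg (dens_nonneg u v y) (kQ_nonneg _)
      have h7 : 0 ≤ X y := Finset.sum_nonneg fun i _ => sq_nonneg _
      have h8 : 0 ≤ Q y := Finset.sum_nonneg fun i _ => sq_nonneg _
      have h9 := hb0 y
      simp only [h4, h5, mul_zero, Finset.sum_const_zero]
      rw [sub_self]
      positivity
    · have h1 := dens_cmpU_le (τ := τ) hs hΘ hΨ hχ hq h.su h.sv (h.pu y) (h.pv y)
        (hmin y (by linarith)) χ.nonneg χ.le_one (by
          rcases le_or_gt ‖y‖ (5 / 4) with h1 | h1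
          · exact Or.inl (hχ1 y h1)
          · exact Or.inr (hq0 y h1))
      refine h1.trans ?_
      unfold cmpErr
      simp only [Finset.sum_add_distrib, ← Finset.mul_sum]
      have h2 : ∑ i, (|pd i u y| + |pd i v y|) * |pd i χ y| ≤ b y * (dens u v y / (2 * k) + k) := by
        have h3 : ∀ i, |pd i χ y| ≤ b y := fun i =>
          Finset.single_le_sum (fun i _ => abs_nonneg (pd i χ y)) (Finset.mem_univ i)
        have h4 : ∀ a : ℝ, |a| ≤ a ^ 2 / (2 * k) + k / 2 := fun a => by
          rw [← sq_abs a, ← sub_nonneg]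
          have : |a| ^ 2 / (2 * k) + k / 2 - |a| = (|a| - k) ^ 2 / (2 * k) := by field_simp; ring
          rw [this]; positivity
        calc _ ≤ ∑ i, ((pd i u y ^ 2 + pd i v y ^ 2) / (2 * k) * b y + k * |pd i χ y|) := by
              refine Finset.sum_le_sum fun i _ => ?_
              have h5 := h4 (pd i u y); have h6 := h4 (pd i v y)
              have h7 : |pd i u y| + |pd i v y|
                  ≤ (pd i u y ^ 2 + pd i v y ^ 2) / (2 * k) + k := by rw [add_div]; linarith
              have h8 := mul_le_mul_of_nonneg_right h7 (abs_nonneg (pd i χ y))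
              have h9 : (pd i u y ^ 2 + pd i v y ^ 2) / (2 * k) * |pd i χ y|
                  ≤ (pd i u y ^ 2 + pd i v y ^ 2) / (2 * k) * b y :=
                mul_le_mul_of_nonneg_left (h3 i) (by positivity)
              linarith
          _ = (∑ i, (pd i u y ^ 2 + pd i v y ^ 2)) / (2 * k) * b y + k * b y := by
              rw [Finset.sum_add_distrib, ← Finset.mul_sum, ← Finset.sum_mul, ← Finset.sum_div]
          _ ≤ dens u v y / (2 * k) * b y + k * b y := by
              have h5 : ∑ i, (pd i u y ^ 2 + pd i v y ^ 2) ≤ dens u v y := by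
                rw [dens_eq_sum]; have : 0 ≤ u y ^ 2 * v y ^ 2 := by positivity
                linarith
              have := hb0 y
              gcongr
          _ = _ := by ring
      have h3 : b y * dens u v y ≤ K / c * Y y := by
        have h4 := hcl ((4 : ℝ)⁻¹ • y) (by
          rw [norm_smul, Real.norm_of_nonneg (by norm_num)]; linarith)
        have h5 := (le_abs_self _).trans (hKb y)
        have h6 := dens_nonneg u v y
        calc b y * dens u v y ≤ K * dens u v y := by gcongr
          _ = K / c * (dens u v y * c) := by field_simp
          _ ≤ K / c * Y y := by simp only [hY]; gcongr
      have h4 : b y * (dens u v y / (2 * k) + k)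
          ≤ (K / c * Y y) / (2 * k) + k * b y := by
        have : b y * (dens u v y / (2 * k) + k) = b y * dens u v y / (2 * k) + k * b y := by ring
        rw [this]; gcongr
      have h5 := mul_le_mul_of_nonneg_left (h2.trans h4) (by positivity : 0 ≤ 6 * s)
      have h6 : 6 * s * ((K / c * Y y) / (2 * k) + k * b y)
          = 3 * s / k * (K / c) * Y y + 6 * s * k * b y := by field_simp; ring
      rw [h6] at h5
      linarith
  have hmain : ∀ τ : ℝ, 0 ≤ 2 * τ * I + τ ^ 2 * (∫ y, Q y) + E * m ^ 2 := fun τ => by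
    have s1 := smooth_cmpU (τ := τ) hΘ hΨ hχ hq h.su h.sv
    have s2 := smooth_cmpU (τ := -τ) hΘ hΨ hχ hq h.sv h.su
    have c1 := hasCompactSupport_cmpU (Θ := Θ) (Ψ := Ψ) (q := q) (u := u) (v := v) (τ := τ) hχs
    have c2 := hasCompactSupport_cmpU (Θ := Θ) (Ψ := Ψ) (q := q) (u := v) (v := u) (τ := -τ) hχs
    have h1 := h.min _ _ s1 s2 c1 c2
    have hZi : Integrable fun y =>
        3 * s / k * (K / c) * Y y + 6 * s * k * b y + 18 * s ^ 2 * X y :=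
      ((hYi.const_mul _).add (hbi.const_mul _)).add (hXi.const_mul _)
    have hFi : Integrable fun y => 2 * τ * (∑ i, pd i W y * pd i q y) + τ ^ 2 * Q y
        + 1 * (3 * s / k * (K / c) * Y y + 6 * s * k * b y + 18 * s ^ 2 * X y) :=
      ((hIi.const_mul _).add (hQi.const_mul _)).add (hZi.const_mul 1)
    have hDi : Integrable fun y =>
        dens (cmpU Θ Ψ χ q u v τ) (cmpU Θ Ψ χ q v u (-τ)) y - dens u v y := by
      refine ((s1.dens s2).sub hd).continuous.integrable_of_hasCompactSupport ?_
      refine HasCompactSupport.intro (c1.isCompact.union c2.isCompact) fun y hy => ?_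
      have e1 := gsq_congr_of_notMem s1 h.su (fun h => hy (Or.inl h))
      have e2 := gsq_congr_of_notMem s2 h.sv (fun h => hy (Or.inr h))
      unfold dens
      rw [e1.1, e1.2, e2.1, e2.2]; ring
    have h2 := h1.trans (integral_mono hDi hFi (hdiff τ))
    rw [integral_linear_combination₃ hIi hQi hZi, integral_linear_combination₃ hYi hbi hXi] at h2
    have h3 : 3 * s / k * (K / c) * ∫ y, Y y ≤ T * (s * k) := by
      calc 3 * s / k * (K / c) * ∫ y, Y y
          ≤ 3 * s / k * (K / c) * (4 ^ n * (Real.exp 1 * k ^ 2)) := by rw [hkk]; gcongr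
        _ = T * (s * k) := by simp only [T]; field_simp
    have h4 : T * (s * k) + 6 * s * k * (∫ y, b y) + 18 * s ^ 2 * (∫ y, X y) ≤ E * m ^ 2 := by
      rw [hmm]
      have : E * (s * k + s ^ 2) = T * (s * k) + 6 * s * k * (∫ y, b y) + 18 * s ^ 2 * (∫ y, X y)
        + (T * s ^ 2 + 6 * s ^ 2 * (∫ y, b y) + 18 * (s * k) * (∫ y, X y)) := by
        simp only [E]; ring
      rw [this]
      have : 0 ≤ T * s ^ 2 + 6 * s ^ 2 * (∫ y, b y) + 18 * (s * k) * (∫ y, X y) := by positivity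
      linarith
    linarith
  have hIb : |I| ≤ ((∫ y, Q y) + E) / 2 * m := by
    have h1 := hmain m
    have h2 := hmain (-m)
    rw [abs_le]
    constructor <;> nlinarith
  have hIW : I = - ∫ y, W y * lap q y := integral_sum_pd_mul_pd hW hq hqs
  have hWi : Integrable fun y => W y * lap q y :=
    integrable_mul_of_compact hW.continuous hq.lap.continuous hLs
  have hwi : Integrable fun y => (u y - v y - W y) * lap q y :=
    integrable_mul_of_compact ((h.su.sub h.sv).sub hW).continuous hq.lap.continuous hLs
  have hsplit : ∫ y, (u y - v y) * lap q y
      = (∫ y, W y * lap q y) + ∫ y, (u y - v y - W y) * lap q y := by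
    rw [← integral_add hWi hwi]; congr 1; ext y; ring
  have hrest : |∫ y, (u y - v y - W y) * lap q y| ≤ 2 * s * ∫ y, |lap q y| := by
    rw [← integral_const_mul]
    refine abs_integral_le_integral_abs.trans (integral_mono hwi.abs (hLi.const_mul _) fun y => ?_)
    simp only [abs_mul]
    refine mul_le_mul_of_nonneg_right ?_ (abs_nonneg _)
    have a1 := hΘ.self_le (u y); have a2 := hΘ.self_le (v y)
    have a3 := hΘ.le_self (u y) (h.pu y).le; have a4 := hΘ.le_self (v y) (h.pv y).le
    rw [abs_le]; simp only [hWdef]; constructor <;> linarith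
  rw [hsplit]
  refine (abs_add_le _ _).trans ?_
  have h1 : |∫ y, W y * lap q y| = |I| := by rw [hIW, abs_neg]
  rw [h1]
  have h2 : 2 * s * (∫ y, |lap q y|) ≤ 2 * m * ∫ y, |lap q y| := by gcongr
  linarith

end Competitor

section Differences
variable {n : ℕ} {u v f : Eu n → ℝ} {x : Eu n} {r : ℝ}

/-- Subcritical bound for averages of the difference against Laplacians of test functions. -/
theorem exists_lap_test_bound (n : ℕ) : ∃ μ : ℝ, 5 / 12 ≤ μ ∧ μ < 1 / 2 ∧ ∃ C₀ ≥ 1,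
    ∀ q : Eu n → ℝ, Smooth q → (∀ y, 1 ≤ ‖y‖ → q y = 0) → ∃ C > 0, ∀ u v : Eu n → ℝ, Sol u v →
      C₀ ≤ hgt u v 0 1 → ∀ x ρ, ‖x‖ ≤ 1 → 0 < ρ → ρ ≤ 1 →
        |avk (lap q) (fun y => u y - v y) x ρ| ≤ C * hgt u v 0 1 ^ μ := by
  obtain ⟨γ, hγ1, hγ2, C1, hC1, hmin⟩ := exists_min_bound n
  obtain ⟨C2, hC2, hcmp⟩ := exists_hgt_compare n (Λ := 1) (by norm_num)
  refine ⟨(γ + 1 / 2) / 2, by linarith, by linarith, C1, hC1, fun q hq hq1 => ?_⟩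
  obtain ⟨C, hC, htest⟩ := exists_test_bound hq hq1
  refine ⟨C * (C1 + C2), by positivity, fun u v h hH x ρ hx hρ hρ1 => ?_⟩
  have hm := hmin u v h hH
  have hc := hcmp u v h 0 x 1 one_pos (by simpa using hx)
  set H := hgt u v 0 1
  have hH1 : 1 ≤ H := hC1.trans hH
  have hH0 : 0 < H := by linarith
  set μ := (γ + 1 / 2) / 2
  have hsc := h.rescale x hρ
  have hγp : 0 < H ^ γ := Real.rpow_pos_of_pos hH0 _
  set s := ρ * (C1 * H ^ γ)
  have hs : 0 < s := by positivity
  have h1 := htest _ _ hsc s hs fun z hz => by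
    have h2 := hm (x + ρ • z) (by
      refine (norm_add_le _ _).trans ?_
      rw [norm_smul, Real.norm_of_nonneg hρ.le]
      nlinarith [norm_nonneg z])
    rw [← mul_min_of_nonneg _ _ hρ.le]
    exact mul_le_mul_of_nonneg_left h2 hρ.le
  rw [hgt_affine, smul_zero, add_zero, mul_one] at h1
  have h2 : ∫ y, (ρ * u (x + ρ • y) - ρ * v (x + ρ • y)) * lap q y
      = ρ * avk (lap q) (fun y => u y - v y) x ρ := by
    unfold avk; rw [← integral_const_mul]; congr 1; ext y; ring
  rw [h2, abs_mul, abs_of_pos hρ] at h1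
  have h3 : √(ρ ^ 2 * hgt u v x ρ) ≤ ρ * (C2 * √H) := by
    refine Real.sqrt_le_iff.2 ⟨by positivity, ?_⟩
    have h4 := h.hgt_mono x (Set.mem_Ici.2 hρ.le) (Set.mem_Ici.2 zero_le_one) hρ1
    calc ρ ^ 2 * hgt u v x ρ ≤ ρ ^ 2 * (C2 * H) := by gcongr; exact h4.trans hc
      _ ≤ ρ ^ 2 * (C2 ^ 2 * H) := by gcongr; nlinarith
      _ = (ρ * (C2 * √H)) ^ 2 := by rw [mul_pow, mul_pow, Real.sq_sqrt hH0.le]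
  have e1 : H ^ γ * √H = H ^ μ ^ 1 * H ^ μ := by
    rw [pow_one, Real.sqrt_eq_rpow, ← Real.rpow_add hH0, ← Real.rpow_add hH0]; congr 1; ring
  have e2 : (H ^ γ) ^ 2 ≤ H ^ μ * H ^ μ := by
    rw [sq, ← Real.rpow_add hH0, ← Real.rpow_add hH0]
    exact Real.rpow_le_rpow_of_exponent_le hH1 (by simp only [μ]; linarith)
  rw [pow_one] at e1
  have hμp : 0 < H ^ μ := Real.rpow_pos_of_pos hH0 _
  have h5 : √(s * √(ρ ^ 2 * hgt u v x ρ) + s ^ 2) ≤ ρ * ((C1 + C2) * H ^ μ) := by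
    refine Real.sqrt_le_iff.2 ⟨by positivity, ?_⟩
    calc s * √(ρ ^ 2 * hgt u v x ρ) + s ^ 2 ≤ s * (ρ * (C2 * √H)) + s ^ 2 := by gcongr
      _ = ρ ^ 2 * (C1 * C2 * (H ^ γ * √H) + C1 ^ 2 * (H ^ γ) ^ 2) := by ring
      _ ≤ ρ ^ 2 * (C1 * C2 * (H ^ μ * H ^ μ) + C1 ^ 2 * (H ^ μ * H ^ μ)) := by
          rw [e1]; gcongr
      _ = ρ ^ 2 * (C1 * C2 + C1 ^ 2) * (H ^ μ) ^ 2 := by ring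
      _ ≤ ρ ^ 2 * (C1 + C2) ^ 2 * (H ^ μ) ^ 2 := by gcongr; nlinarith
      _ = _ := by ring
  have h6 := h1.trans (mul_le_mul_of_nonneg_left h5 hC.le)
  refine le_of_mul_le_mul_left (h6.trans (le_of_eq ?_)) hρ
  ring

/-- Bounding increments by the increments of a majorant. -/
theorem abs_sub_le_of_deriv {φ B φ' B' : ℝ → ℝ} {a b : ℝ} (hab : a ≤ b)
    (hφ : ∀ t, a ≤ t → HasDerivAt φ (φ' t) t) (hB : ∀ t, a ≤ t → HasDerivAt B (B' t) t)
    (h : ∀ t, a < t → t < b → |φ' t| ≤ B' t) : |φ b - φ a| ≤ B b - B a := by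
  have key : ∀ σ : ℝ, |σ| ≤ 1 → σ * (φ b - φ a) ≤ B b - B a := fun σ hσ => by
    have hm : MonotoneOn (fun t => B t - σ * φ t) (Set.Icc a b) := by
      have hd : ∀ t, a ≤ t → HasDerivAt (fun t => B t - σ * φ t) (B' t - σ * φ' t) t :=
        fun t ht => (hB t ht).sub ((hφ t ht).const_mul σ)
      refine monotoneOn_of_deriv_nonneg (convex_Icc a b)
        (fun t ht => (hd t ht.1).continuousAt.continuousWithinAt)
        (fun t ht => ?_) fun t ht => ?_
      · rw [interior_Icc] at ht
        exact (hd t ht.1.le).differentiableAt.differentiableWithinAt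
      · rw [interior_Icc] at ht
        rw [(hd t ht.1.le).deriv]
        have h1 := h t ht.1 ht.2
        have h2 : σ * φ' t ≤ |φ' t| := by
          refine (le_abs_self _).trans ?_
          rw [abs_mul]; exact mul_le_of_le_one_left (abs_nonneg _) hσ
        linarith
    have := hm (Set.left_mem_Icc.2 hab) (Set.right_mem_Icc.2 hab) hab
    simp only at this
    linarith
  rw [abs_le]
  have h1 := key 1 (by simp)
  have h2 := key (-1) (by simp)
  constructor <;> linarith

theorem Sol.smooth_sub (h : Sol u v) : Smooth fun y => u y - v y := h.su.sub h.sv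

theorem Sol.lap_sub_eq (h : Sol u v) (x : Eu n) :
    lap (fun y => u y - v y) x = -(u x * v x * (u x - v x)) := by
  rw [lap_sub h.su h.sv, h.lu, h.lv]; ring

/-- Mean gradient of the difference. -/
def grd {n : ℕ} (u v : Eu n → ℝ) (i : Fin n) (x : Eu n) (r : ℝ) : ℝ :=
  avk kG (pd i fun y => u y - v y) x r

theorem avk_kernel_affine (K w : Eu n → ℝ) (x : Eu n) (r : ℝ) :
    avk K (fun y => r * w (x + r • y)) 0 1 = r * avk K w x r := by
  rw [avk_const_mul, avk_affine, smul_zero, add_zero, mul_one]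

theorem exists_lap_test_bound_scaled (n : ℕ) : ∃ μ : ℝ, 5 / 12 ≤ μ ∧ μ < 1 / 2 ∧ ∃ C₀ ≥ 1,
    ∀ q : Eu n → ℝ, Smooth q → (∀ y, 1 ≤ ‖y‖ → q y = 0) → ∃ C > 0, ∀ u v : Eu n → ℝ, Sol u v →
      ∀ x r, 0 < r → C₀ ≤ r ^ 2 * hgt u v x r →
        r * |avk (lap q) (fun y => u y - v y) x r| ≤ C * (r ^ 2 * hgt u v x r) ^ μ := by
  obtain ⟨μ, h1, h2, C0, hC0, h⟩ := exists_lap_test_bound n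
  refine ⟨μ, h1, h2, C0, hC0, fun q hq hq1 => ?_⟩
  obtain ⟨C, hC, hb⟩ := h q hq hq1
  refine ⟨C, hC, fun u v hs x r hr hH => ?_⟩
  have e1 : hgt (fun y => r * u (x + r • y)) (fun y => r * v (x + r • y)) 0 1
      = r ^ 2 * hgt u v x r := by rw [hgt_affine, smul_zero, add_zero, mul_one]
  have h3 := hb _ _ (hs.rescale x hr) (by rw [e1]; exact hH) 0 1 (by simp) one_pos le_rfl
  rw [e1] at h3
  have e2 : avk (lap q) (fun y => r * u (x + r • y) - r * v (x + r • y)) 0 1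
      = r * avk (lap q) (fun y => u y - v y) x r := by
    rw [← avk_kernel_affine]; congr 1; ext y; ring
  rwa [e2, abs_mul, abs_of_pos hr] at h3

end Differences

section MeanGradient
variable {n : ℕ} {u v f : Eu n → ℝ} {x : Eu n} {r : ℝ}

/-- Oscillation of the mean gradient across scales. -/
theorem exists_grd_increment (n : ℕ) : ∃ μ : ℝ, 5 / 12 ≤ μ ∧ μ < 1 / 2 ∧ ∃ C₀ ≥ 1, ∃ C > 0,
    ∀ u v : Eu n → ℝ, Sol u v → ∀ i x r R, 0 < r → r ≤ R → C₀ ≤ r ^ 2 * hgt u v x r →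
      |grd u v i x R - grd u v i x r| ≤ C * (r ^ 2 * hgt u v x r) ^ μ / r ^ 2 := by
  obtain ⟨μ, hμ1, hμ2, C0, hC0, hT⟩ := exists_lap_test_bound_scaled n
  choose D hD hb using fun i : Fin n => hT (pd i kQ) (kQ_smooth.pd i) fun y => pd_kQ_eq_zero i
  have hS : 0 ≤ ∑ i, D i := Finset.sum_nonneg fun i _ => (hD i).le
  set S := 1 + ∑ i, D i
  have hDS : ∀ i, D i ≤ S := fun i => by
    have := Finset.single_le_sum (fun i _ => (hD i).le) (Finset.mem_univ i)
    simp only [S]; linarith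
  have hS0 : 0 < S := by simp only [S]; linarith
  refine ⟨μ, hμ1, hμ2, C0, hC0, S * Real.exp 1 / (2 - 4 * μ),
    div_pos (by positivity) (by linarith), fun u v h i x r R hr hR hH => ?_⟩
  set G := r ^ 2 * hgt u v x r
  have hG : 0 < G := by linarith
  set A := S * Real.exp 1 * G ^ μ * r ^ (-(4 * μ))
  have hA : 0 < A := by positivity
  have h1 := abs_sub_le_of_deriv (φ := grd u v i x) (B := fun t => -(A / (2 - 4 * μ)) * t ^ (4 * μ - 2))
    (B' := fun t => A * t ^ (4 * μ - 3)) hR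
    (fun t _ => hasDerivAt_avk_pd h.smooth_sub i x t)
    (fun t ht => by
      refine ((Real.hasDerivAt_rpow_const (Or.inl (hr.trans_le ht).ne')).const_mul _).congr_deriv ?_
      have : 2 - 4 * μ ≠ 0 := by linarith
      rw [show 4 * μ - 2 - 1 = 4 * μ - 3 by ring]
      field_simp; ring)
    (fun t ht _ => by
      have ht0 : 0 < t := hr.trans ht
      have hm := h.hgt_mono x (Set.mem_Ici.2 hr.le) (Set.mem_Ici.2 ht0.le) ht.le
      have hp := h.hgt_pos (x := x) hr.le
      have h2 := hb i u v h x t ht0 (hH.trans (by simp only [G]; gcongr))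
      rw [← integral_affine_lap_mul h.smooth_sub (kQ_smooth.pd i) (hasCompactSupport_pd kQ_supp),
        abs_mul, abs_of_nonneg (sq_nonneg t)] at h2
      have hd := h.hgt_doubling (x := x) hr ht.le
      have h3 : t ^ 2 * hgt u v x t ≤ Real.exp 1 * (t / r) ^ (4 : ℝ) * G := by
        calc t ^ 2 * hgt u v x t ≤ t ^ 2 * (Real.exp 1 * (t / r) ^ 2 * hgt u v x r) := by gcongr
          _ = _ := by
            rw [show (4 : ℝ) = ((4 : ℕ) : ℝ) by norm_num, Real.rpow_natCast]
            simp only [G]; field_simp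
      have h4 : (t ^ 2 * hgt u v x t) ^ μ ≤ Real.exp 1 * (t ^ (4 * μ) * r ^ (-(4 * μ))) * G ^ μ := by
        have ht2 : 0 ≤ t ^ 2 * hgt u v x t := mul_nonneg (sq_nonneg _) (h.hgt_pos ht0.le).le
        refine (Real.rpow_le_rpow ht2 h3 (by linarith)).trans ?_
        rw [Real.mul_rpow (by positivity) hG.le, Real.mul_rpow (Real.exp_pos _).le (by positivity),
          ← Real.rpow_mul (by positivity), Real.div_rpow ht0.le hr.le, Real.rpow_neg hr.le,
          div_eq_mul_inv]
        gcongr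
        rw [← Real.exp_mul]
        exact Real.exp_le_exp.2 (by linarith)
      rw [abs_neg]
      have e1 : t ^ (4 * μ) = t ^ (4 * μ - 3) * t ^ 3 := by
        rw [← Real.rpow_natCast, ← Real.rpow_add ht0]; congr 1; norm_num
      have h5 : t ^ 3 * |avk (pd i kQ) (lap fun y => u y - v y) x t|
          ≤ t ^ 3 * (A * t ^ (4 * μ - 3)) := by
        calc _ = t * (t ^ 2 * |avk (pd i kQ) (lap fun y => u y - v y) x t|) := by ring
          _ ≤ D i * (t ^ 2 * hgt u v x t) ^ μ := h2
          _ ≤ S * (Real.exp 1 * (t ^ (4 * μ) * r ^ (-(4 * μ))) * G ^ μ) := by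
              have := h.hgt_pos (x := x) ht0.le
              exact mul_le_mul (hDS i) h4 (by positivity) hS0.le
          _ = _ := by simp only [A]; rw [e1]; ring
      exact le_of_mul_le_mul_left h5 (by positivity))
  refine h1.trans ?_
  have e2 : A * r ^ (4 * μ - 2) = S * Real.exp 1 * G ^ μ / r ^ 2 := by
    have : r ^ (-(4 * μ)) * r ^ (4 * μ - 2) = (r ^ 2)⁻¹ := by
      rw [← Real.rpow_add hr, ← Real.rpow_natCast, ← Real.rpow_neg hr.le]; congr 1; push_cast; ring
    simp only [A]; rw [mul_assoc, this]; rfl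
  have hk : 0 < 2 - 4 * μ := by linarith
  have h6 : 0 ≤ A / (2 - 4 * μ) * R ^ (4 * μ - 2) := by
    have : 0 < R := hr.trans_le hR
    positivity
  calc _ ≤ A / (2 - 4 * μ) * r ^ (4 * μ - 2) := by linarith
    _ = A * r ^ (4 * μ - 2) / (2 - 4 * μ) := by ring
    _ = _ := by rw [e2]; ring

theorem Sol.exists_hgt_growth (h : Sol u v) : ∃ C > 0, ∀ x r, 0 ≤ r →
    hgt u v x r ≤ C * (1 + ‖x‖ + r) ^ 2 := by
  obtain ⟨C, hC, hg⟩ := h.growth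
  refine ⟨C ^ 2, by positivity, fun x r hr => avk_le h.smooth_sq.continuous hr fun z hz => ?_⟩
  have h1 := hg z
  have h2 := norm_le_of_mem hz
  have h3 := h.pu z
  have h4 := h.pv z
  calc u z ^ 2 + v z ^ 2 ≤ (u z + v z) ^ 2 := by nlinarith [mul_pos h3 h4]
    _ ≤ (C * (1 + ‖x‖ + r)) ^ 2 := by
        gcongr; exact h1.trans (mul_le_mul_of_nonneg_left (by linarith) hC.le)
    _ = _ := by ring

theorem Sol.tendsto_scaled_hgt (h : Sol u v) (x : Eu n) :
    Filter.Tendsto (fun r => r ^ 2 * hgt u v x r) Filter.atTop Filter.atTop := by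
  have h0 := h.hgt_pos (x := x) le_rfl
  refine Filter.tendsto_atTop_mono' _ ?_
    ((Filter.tendsto_pow_atTop two_ne_zero).atTop_mul_const h0)
  filter_upwards [Filter.eventually_ge_atTop 0] with r hr
  exact mul_le_mul_of_nonneg_left (h.hgt_mono x (Set.mem_Ici.2 le_rfl) (Set.mem_Ici.2 hr) hr)
    (sq_nonneg r)

theorem exists_grd_center (n : ℕ) : ∃ C > 0, ∀ (f : Eu n → ℝ) (i : Fin n) (x d : Eu n) (r M : ℝ),
    Smooth f → 0 < r → 0 ≤ M → (∀ s ∈ Set.Icc (0 : ℝ) 1, ∀ z ∈ closedBall (x + s • d) r, |f z| ≤ M) →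
    r ^ 2 * |avk kG (pd i f) (x + d) r - avk kG (pd i f) x r| ≤ C * ‖d‖ * M := by
  choose D hD hb using fun (k : Fin n × Fin n) => exists_avk_bound
    ((kG_smooth.pd k.1).pd k.2).continuous (fun y hy => by
      have hs : ∀ {g : Eu n → ℝ}, Smooth g → (∀ y, 1 ≤ ‖y‖ → g y = 0) → ∀ j y, 1 ≤ ‖y‖ →
          pd j g y = 0 := by
        intro g hg h0 j y hy
        have hc : Continuous fun t : ℝ => pd j g (t • y) := by
          have := (hg.pd j).continuous; fun_prop
        have ht : Filter.Tendsto (fun t : ℝ => pd j g (t • y)) (nhdsWithin 1 (Set.Ioi 1))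
            (nhds (pd j g ((1 : ℝ) • y))) := (hc.tendsto 1).mono_left nhdsWithin_le_nhds
        have h1 : Filter.Tendsto (fun t : ℝ => pd j g (t • y)) (nhdsWithin 1 (Set.Ioi 1))
            (nhds 0) := by
          refine tendsto_const_nhds.congr' ?_
          filter_upwards [self_mem_nhdsWithin] with t ht
          have ht' : 1 < t := ht
          have hz : 1 < ‖t • y‖ := by
            rw [norm_smul, Real.norm_of_nonneg (by linarith)]; nlinarith
          have he : g =ᶠ[nhds (t • y)] 0 := by
            filter_upwards [(isOpen_lt continuous_const continuous_norm).mem_nhds hz] with w hw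
            exact h0 w (le_of_lt hw)
          unfold pd; rw [he.fderiv_eq]; simp
        have := tendsto_nhds_unique ht h1
        rwa [one_smul] at this
      exact hs (kG_smooth.pd k.1) (hs kG_smooth (fun _ => kG_eq_zero) k.1) k.2 y hy)
  have hS : 0 ≤ ∑ k, D k := Finset.sum_nonneg fun i _ => (hD i).le
  refine ⟨1 + n * ∑ k, D k, by positivity, fun f i x d r M hf hr hM h => ?_⟩
  have h1 := norm_image_sub_le_of_norm_deriv_le_segment' (f := fun s : ℝ => avk kG (pd i f) (x + s • d) r)
    (a := 0) (b := 1) (C := (r ^ 2)⁻¹ * ((1 + n * ∑ k, D k) * ‖d‖ * M))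
    (fun t _ => (hasDerivAt_avk_center (hf.pd i) kG_smooth.continuous kG_supp x d r t).hasDerivWithinAt)
    (fun t ht => by
      have hk : ∀ j, r ^ 2 * avk kG (pd j (pd i f)) (x + t • d) r
          = avk (pd i (pd j kG)) f (x + t • d) r := fun j => by
        rw [sq, mul_assoc, integral_affine_pd_mul (hf.pd i) kG_smooth kG_supp, mul_neg,
          integral_affine_pd_mul hf (kG_smooth.pd j) (hasCompactSupport_pd kG_supp), neg_neg]
      rw [← div_eq_inv_mul, le_div_iff₀ (by positivity), Real.norm_eq_abs,
        ← abs_of_nonneg (sq_nonneg r), ← abs_mul, Finset.sum_mul]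
      refine (Finset.abs_sum_le_sum_abs _ _).trans ?_
      have hterm : ∀ j, |d j * avk kG (pd j (pd i f)) (x + t • d) r * r ^ 2|
          ≤ ‖d‖ * ((∑ k, D k) * M) := fun j => by
        rw [mul_assoc, mul_comm _ (r ^ 2), hk, abs_mul]
        refine mul_le_mul ?_ ?_ (abs_nonneg _) (norm_nonneg _)
        · have := PiLp.norm_apply_le d j; rwa [Real.norm_eq_abs] at this
        · refine (hb (j, i) f _ r M hf.continuous hr.le hM (h t ⟨ht.1, ht.2.le⟩)).trans ?_
          gcongr
          exact Finset.single_le_sum (fun i _ => (hD i).le) (Finset.mem_univ (j, i))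
      refine (Finset.sum_le_sum fun j _ => hterm j).trans ?_
      rw [Finset.sum_const, Finset.card_univ, Fintype.card_fin, nsmul_eq_mul]
      have := mul_nonneg (norm_nonneg d) hM
      nlinarith) 1 (Set.right_mem_Icc.2 zero_le_one)
  simp only [one_smul, zero_smul, add_zero, sub_zero, mul_one, Real.norm_eq_abs] at h1
  rwa [← div_eq_inv_mul, le_div_iff₀ (by positivity), mul_comm] at h1

theorem Sol.exists_grd_tendsto (h : Sol u v) : ∃ e : Eu n, ∀ i x,
    Filter.Tendsto (grd u v i x) Filter.atTop (nhds (e i)) := by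
  obtain ⟨μ, hμ1, hμ2, C0, hC0, C, hC, hinc⟩ := exists_grd_increment n
  obtain ⟨C1, hC1, hg⟩ := h.exists_hgt_growth
  have hlim : ∀ i, ∃ l, Filter.Tendsto (grd u v i 0) Filter.atTop (nhds l) := fun i => by
    refine cauchySeq_tendsto_of_complete (Metric.cauchySeq_iff'.2 fun ε hε => ?_)
    have h1 : Filter.Tendsto (fun r : ℝ => C * (4 * C1) ^ μ * r ^ (-(2 - 4 * μ)))
        Filter.atTop (nhds (C * (4 * C1) ^ μ * 0)) :=
      (tendsto_rpow_neg_atTop (by linarith)).const_mul _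
    rw [mul_zero] at h1
    obtain ⟨r, hr1, hr2, hr3⟩ := ((h1.eventually (gt_mem_nhds hε)).and
      (((h.tendsto_scaled_hgt 0).eventually_ge_atTop C0).and (Filter.eventually_ge_atTop 1))).exists
    refine ⟨r, fun R hR => ?_⟩
    have hr : 0 < r := by linarith
    rw [Real.dist_eq]
    refine (hinc u v h i 0 r R hr hR hr2).trans_lt (lt_of_le_of_lt ?_ hr1)
    have h2 : r ^ 2 * hgt u v 0 r ≤ 4 * C1 * r ^ (4 : ℝ) := by
      have := hg 0 r hr.le
      rw [norm_zero, add_zero] at this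
      rw [show (4 : ℝ) = ((4 : ℕ) : ℝ) by norm_num, Real.rpow_natCast]
      calc r ^ 2 * hgt u v 0 r ≤ r ^ 2 * (C1 * (1 + r) ^ 2) := by gcongr
        _ ≤ r ^ 2 * (C1 * (2 * r) ^ 2) := by gcongr; linarith
        _ = _ := by push_cast; ring
    have h3 := Real.rpow_le_rpow (mul_nonneg (sq_nonneg r) (h.hgt_pos hr.le).le) h2
      (by linarith : 0 ≤ μ)
    rw [Real.mul_rpow (x := 4 * C1) (by positivity) (by positivity), ← Real.rpow_mul hr.le] at h3
    have e1 : r ^ (4 * μ) = r ^ (-(2 - 4 * μ)) * r ^ 2 := by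
      rw [← Real.rpow_natCast, ← Real.rpow_add hr]; congr 1; norm_num
    rw [e1] at h3
    rw [div_le_iff₀ (by positivity)]
    calc C * (r ^ 2 * hgt u v 0 r) ^ μ ≤ C * ((4 * C1) ^ μ * (r ^ (-(2 - 4 * μ)) * r ^ 2)) := by
          gcongr
      _ = _ := by ring
  choose l hl using hlim
  refine ⟨WithLp.toLp 2 l, fun i x => ?_⟩
  obtain ⟨C2, hC2, hcen⟩ := exists_grd_center n
  obtain ⟨C3, hC3, hgr⟩ := h.growth
  have h1 : Filter.Tendsto (fun r => grd u v i x r - grd u v i 0 r) Filter.atTop (nhds 0) := by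
    have h2 : Filter.Tendsto (fun r : ℝ => 2 * C2 * ‖x‖ * C3 * r⁻¹) Filter.atTop
        (nhds (2 * C2 * ‖x‖ * C3 * 0)) := tendsto_inv_atTop_zero.const_mul _
    rw [mul_zero] at h2
    refine squeeze_zero_norm' ?_ h2
    filter_upwards [Filter.eventually_ge_atTop (1 + ‖x‖)] with r hr
    have hr0 : 0 < r := by have := norm_nonneg x; linarith
    have h3 := hcen _ i 0 x r (C3 * (2 * r)) h.smooth_sub hr0 (by positivity)
      (fun s hs z hz => by
        have h4 := norm_le_of_mem hz
        have h5 := hgr z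
        have h6 := h.pu z
        have h7 := h.pv z
        rw [zero_add, norm_smul, Real.norm_of_nonneg hs.1] at h4
        have h8 : s * ‖x‖ ≤ ‖x‖ := mul_le_of_le_one_left (norm_nonneg _) hs.2
        have h9 : C3 * (1 + ‖z‖) ≤ C3 * (2 * r) := mul_le_mul_of_nonneg_left (by linarith) hC3.le
        rw [abs_le]; constructor <;> linarith)
    rw [zero_add] at h3
    rw [Real.norm_eq_abs]
    refine le_of_mul_le_mul_left (h3.trans (le_of_eq ?_)) (by positivity : 0 < r ^ 2)
    field_simp
  simpa using h1.add (hl i)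

/-- Mean gradients approach a common limit at a quantified rate. -/
theorem exists_grd_rate (n : ℕ) : ∃ μ : ℝ, 5 / 12 ≤ μ ∧ μ < 1 / 2 ∧ ∃ C₀ ≥ 1, ∃ C > 0,
    ∀ u v : Eu n → ℝ, ∀ e : Eu n, Sol u v →
      (∀ i x, Filter.Tendsto (grd u v i x) Filter.atTop (nhds (e i))) →
      ∀ i x r, 0 < r → C₀ ≤ r ^ 2 * hgt u v x r →
        |grd u v i x r - e i| ≤ C * (r ^ 2 * hgt u v x r) ^ μ / r ^ 2 := by
  obtain ⟨μ, hμ1, hμ2, C0, hC0, C, hC, hinc⟩ := exists_grd_increment n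
  refine ⟨μ, hμ1, hμ2, C0, hC0, C, hC, fun u v e h he i x r hr hH => ?_⟩
  rw [abs_sub_comm]
  refine le_of_tendsto ((he i x).sub_const _).abs ?_
  filter_upwards [Filter.eventually_ge_atTop r] with R hR
  exact hinc u v h i x r R hr hR hH

end MeanGradient

section AffineApproximation
variable {n : ℕ} {u v f : Eu n → ℝ} {x : Eu n} {r : ℝ}

theorem Sol.abs_sub_le (h : Sol u v) (x : Eu n) : |u x - v x| ≤ √(u x ^ 2 + v x ^ 2) := by
  refine Real.le_sqrt_of_sq_le ?_
  rw [sq_abs]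
  nlinarith [mul_pos (h.pu x) (h.pv x)]

theorem Sol.abs_lap_sub_le (h : Sol u v) {s : ℝ} (hs : u x ^ 2 + v x ^ 2 ≤ s ^ 2) (h0 : 0 ≤ s) :
    |lap (fun y => u y - v y) x| ≤ s ^ 3 := by
  have hu := h.pu x
  have hv := h.pv x
  rw [h.lap_sub_eq, abs_neg, abs_mul, abs_of_pos (mul_pos hu hv)]
  have h1 : |u x - v x| ≤ s := (h.abs_sub_le x).trans (Real.sqrt_le_iff.2 ⟨h0, hs⟩)
  have h2 : u x * v x ≤ s ^ 2 := by nlinarith [sq_nonneg (u x - v x)]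
  calc _ ≤ s ^ 2 * s := by gcongr
    _ = _ := by ring

/-- The difference is close to its averages. -/
theorem exists_mean_bound (n : ℕ) : ∃ ν : ℝ, 5 / 12 ≤ ν ∧ ν < 1 / 2 ∧ ∃ C₀ ≥ 1, ∃ C > 0,
    ∀ u v : Eu n → ℝ, Sol u v → C₀ ≤ hgt u v 0 1 → ∀ x, ‖x‖ ≤ 1 →
      |avk kG (fun y => u y - v y) x 1 - (u x - v x)| ≤ C * hgt u v 0 1 ^ ν := by
  obtain ⟨μ, hμ1, hμ2, C0, hC0, hT⟩ := exists_lap_test_bound n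
  obtain ⟨D, hD, hT⟩ := hT kQ kQ_smooth fun _ => kQ_eq_zero
  obtain ⟨D2, hD2, hK⟩ := exists_avk_bound (n := n) kQ_smooth.continuous (fun _ => kQ_eq_zero)
  obtain ⟨C1, hC1, hsup⟩ := exists_sup_bound n (Λ := 2) (by norm_num)
  set δ := (1 / 2 - μ) / 2
  have hδ : 0 < δ := by simp only [δ]; linarith
  refine ⟨μ + δ, by linarith, by simp only [δ]; linarith, C0, hC0, D2 + D * (C1 / δ), by positivity,
    fun u v h hH x hx => ?_⟩
  set H := hgt u v 0 1
  have hH1 : 1 ≤ H := hC0.trans hH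
  have hH0 : 0 < H := by linarith
  have hCH : 1 ≤ C1 * H := by nlinarith
  set s := √(C1 * H)
  have hs1 : 1 ≤ s := Real.one_le_sqrt.2 hCH
  have hs2 : s ^ 2 = C1 * H := Real.sq_sqrt (by linarith)
  set ρ := (C1 * H)⁻¹
  have hρ : 0 < ρ := by positivity
  have hρ1 : ρ ≤ 1 := inv_le_one_of_one_le₀ hCH
  have hd := fun t => hasDerivAt_avk h.smooth_sub x t
  have h1 := abs_sub_le_of_deriv (B := fun t => D2 * s ^ 3 / 2 * t ^ 2) (B' := fun t => t * (D2 * s ^ 3))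
    hρ.le (fun t _ => hd t) (fun t _ => ((hasDerivAt_pow 2 t).const_mul _).congr_deriv (by
      push_cast; ring)) (fun t ht0 ht1 => by
      rw [abs_mul, abs_of_pos ht0]
      refine mul_le_mul_of_nonneg_left (hK _ x t (s ^ 3) h.smooth_sub.lap.continuous ht0.le
        (by positivity) fun z hz => h.abs_lap_sub_le ?_ (by linarith)) ht0.le
      rw [hs2]
      refine hsup u v h 0 z 1 one_pos ?_
      have := norm_le_of_mem hz
      rw [sub_zero]; linarith)
  have h2 := abs_sub_le_of_deriv (B := fun t => D * H ^ μ * Real.log t) (B' := fun t => D * H ^ μ * t⁻¹)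
    hρ1 (fun t _ => hd t)
    (fun t ht => (Real.hasDerivAt_log (hρ.trans_le ht).ne').const_mul _) (fun t ht0 ht1 => by
      have ht : 0 < t := hρ.trans ht0
      have h3 := hT u v h hH x t hx ht ht1.le
      rw [← integral_affine_lap_mul h.smooth_sub kQ_smooth kQ_supp, abs_mul,
        abs_of_nonneg (sq_nonneg t)] at h3
      rw [abs_mul, abs_of_pos ht, ← div_eq_mul_inv, le_div_iff₀ ht]
      linarith)
  rw [avk_zero] at h1
  have hsp : 0 < s := by linarith
  have h4 : D2 * s ^ 3 / 2 * ρ ^ 2 ≤ D2 := by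
    have : ρ = (s ^ 2)⁻¹ := by rw [hs2]
    rw [this]
    have e : D2 * s ^ 3 / 2 * (s ^ 2)⁻¹ ^ 2 = D2 / (2 * s) := by field_simp
    rw [e, div_le_iff₀ (by linarith)]
    nlinarith
  have h5 : Real.log (C1 * H) ≤ C1 / δ * H ^ δ := by
    refine (Real.log_le_rpow_div (by linarith) hδ).trans ?_
    rw [Real.mul_rpow (by linarith) hH0.le, div_mul_eq_mul_div]
    gcongr
    calc C1 ^ δ ≤ C1 ^ (1 : ℝ) := Real.rpow_le_rpow_of_exponent_le hC1 (by simp only [δ]; linarith)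
      _ = C1 := Real.rpow_one _
  simp only [Real.log_one, mul_zero, ρ, Real.log_inv] at h2
  have h6 : D * H ^ μ * Real.log (C1 * H) ≤ D * H ^ μ * (C1 / δ * H ^ δ) := by gcongr
  have h7 : (1 : ℝ) ≤ H ^ (μ + δ) := Real.one_le_rpow hH1 (by linarith)
  rw [Real.rpow_add hH0] at h7 ⊢
  have h8 := abs_sub_le (avk kG (fun y => u y - v y) x 1) (avk kG (fun y => u y - v y) x ρ) (u x - v x)
  have h9 : (0 : ℝ) ^ 2 = 0 := by norm_num
  simp only [h9, mul_zero, sub_zero] at h1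
  have h10 : D2 * 1 ≤ D2 * (H ^ μ * H ^ δ) := by gcongr
  calc _ ≤ D * H ^ μ * (C1 / δ * H ^ δ) + D2 := by linarith
    _ ≤ _ := by nlinarith

theorem exists_affine_bound_unit (n : ℕ) : ∃ ν : ℝ, 5 / 12 ≤ ν ∧ ν < 1 / 2 ∧ ∃ C₀ ≥ 1, ∃ C > 0,
    ∀ u v : Eu n → ℝ, ∀ e : Eu n, Sol u v →
      (∀ i x, Filter.Tendsto (grd u v i x) Filter.atTop (nhds (e i))) →
      C₀ ≤ hgt u v 0 1 → ∀ y, ‖y‖ ≤ 1 →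
        |u y - v y - (u 0 - v 0) - ⟪e, y⟫| ≤ C * hgt u v 0 1 ^ ν := by
  obtain ⟨ν, hν1, hν2, C0, hC0, C, hC, hmean⟩ := exists_mean_bound n
  obtain ⟨μ, hμ1, hμ2, C0', hC0', C', hC', hgrd⟩ := exists_grd_rate n
  obtain ⟨C2, hC2, hcmp⟩ := exists_hgt_compare n (Λ := 1) (by norm_num)
  refine ⟨max ν μ, hν1.trans (le_max_left _ _), max_lt hν2 hμ2, max C0 (C2 * C0'),
    hC0.trans (le_max_left _ _), 2 * C + n * (C' * C2), by positivity,
    fun u v e h he hH y hy => ?_⟩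
  have hHa := (le_max_left _ _).trans hH
  have hHb := (le_max_right _ _).trans hH
  have hm1 := hmean u v h hHa y hy
  have hm2 := hmean u v h hHa 0 (by simp)
  set H := hgt u v 0 1
  have hH1 : 1 ≤ H := hC0.trans hHa
  have hH0 : 0 < H := by linarith
  have hm3 := norm_image_sub_le_of_norm_deriv_le_segment'
    (f := fun s : ℝ => avk kG (fun y => u y - v y) (0 + s • y) 1 - s * ⟪e, y⟫)
    (a := 0) (b := 1) (C := n * (C' * (C2 * H) ^ μ))
    (fun t _ => ((hasDerivAt_avk_center h.smooth_sub kG_smooth.continuous kG_supp 0 y 1 t).sub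
      ((hasDerivAt_id t).mul_const ⟪e, y⟫)).hasDerivWithinAt)
    (fun t ht => by
      have e1 : (⟪e, y⟫ : ℝ) = ∑ j, y j * e j := by
        rw [PiLp.inner_apply]; rfl
      rw [one_mul, e1, ← Finset.sum_sub_distrib, Real.norm_eq_abs]
      have hty : ‖t • y‖ ≤ 1 := by
        rw [norm_smul, Real.norm_of_nonneg ht.1]
        nlinarith [ht.2, norm_nonneg y, ht.1]
      have hz1 := hcmp u v h 0 (0 + t • y) 1 one_pos (by simpa using hty)
      have hz2 := hcmp u v h (0 + t • y) 0 1 one_pos (by simpa using hty)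
      have hz0 := h.hgt_pos (x := 0 + t • y) zero_le_one
      refine (Finset.abs_sum_le_sum_abs _ _).trans ?_
      have hterm : ∀ j, |y j * avk kG (pd j fun y => u y - v y) (0 + t • y) 1 - y j * e j|
          ≤ C' * (C2 * H) ^ μ := fun j => by
        have h1 := hgrd u v e h he j (0 + t • y) 1 one_pos (by
          rw [one_pow, one_mul]
          exact le_of_mul_le_mul_left (hHb.trans hz2) (by linarith))
        rw [one_pow, one_mul, div_one] at h1
        rw [← mul_sub, abs_mul]
        have h2 : |y j| ≤ 1 := by
          have := PiLp.norm_apply_le y j; rw [Real.norm_eq_abs] at this; linarith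
        calc _ ≤ 1 * (C' * hgt u v (0 + t • y) 1 ^ μ) :=
              mul_le_mul h2 h1 (abs_nonneg _) zero_le_one
          _ ≤ _ := by rw [one_mul]; gcongr
      refine (Finset.sum_le_sum fun j _ => hterm j).trans (le_of_eq ?_)
      rw [Finset.sum_const, Finset.card_univ, Fintype.card_fin, nsmul_eq_mul]) 1
    (Set.right_mem_Icc.2 zero_le_one)
  simp only [one_smul, zero_smul, zero_add, sub_zero, mul_one, one_mul, zero_mul,
    Real.norm_eq_abs] at hm3
  have k1 : H ^ ν ≤ H ^ max ν μ := Real.rpow_le_rpow_of_exponent_le hH1 (le_max_left _ _)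
  have k2 : (C2 * H) ^ μ ≤ C2 * H ^ max ν μ := by
    rw [Real.mul_rpow (by linarith) hH0.le]
    have a1 : C2 ^ μ ≤ C2 := by
      calc C2 ^ μ ≤ C2 ^ (1 : ℝ) := Real.rpow_le_rpow_of_exponent_le hC2 (by linarith)
        _ = C2 := Real.rpow_one _
    have a2 : H ^ μ ≤ H ^ max ν μ := Real.rpow_le_rpow_of_exponent_le hH1 (le_max_right _ _)
    gcongr
  have k3 : C * H ^ ν ≤ C * H ^ max ν μ := by gcongr
  have k4 : n * (C' * (C2 * H) ^ μ) ≤ n * (C' * (C2 * H ^ max ν μ)) := by gcongr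
  rw [abs_le] at hm1 hm2 hm3 ⊢
  constructor <;> linarith [hm1.1, hm1.2, hm2.1, hm2.2, hm3.1, hm3.2]

theorem grd_affine (hu : Smooth u) (hv : Smooth v) (p : Eu n) (i : Fin n) (y : Eu n) (r s : ℝ) :
    grd (fun y => r * u (p + r • y)) (fun y => r * v (p + r • y)) i y s
      = r ^ 2 * grd u v i (p + r • y) (r * s) := by
  have hw : Smooth fun y => u y - v y := hu.sub hv
  have e1 : pd i (fun y => r * u (p + r • y) - r * v (p + r • y))
      = fun y => r ^ 2 * (pd i fun y => u y - v y) (p + r • y) := by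
    ext z
    have : (fun y => r * u (p + r • y) - r * v (p + r • y))
        = fun y => r * (fun y => u y - v y) (p + r • y) := by ext y; ring
    rw [this, pd_const_mul r (hw.affine p r), pd_affine hw]; ring
  unfold grd
  rw [e1, avk_const_mul, avk_affine]

/-- Affine approximation of the difference at every scale. -/
theorem exists_affine_bound (n : ℕ) : ∃ ν : ℝ, 5 / 12 ≤ ν ∧ ν < 1 / 2 ∧ ∃ C₀ ≥ 1, ∃ C > 0,
    ∀ u v : Eu n → ℝ, ∀ e : Eu n, Sol u v →
      (∀ i x, Filter.Tendsto (grd u v i x) Filter.atTop (nhds (e i))) →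
      ∀ p r, 0 < r → C₀ ≤ r ^ 2 * hgt u v p r → ∀ x, ‖x - p‖ ≤ r →
        r * |u x - v x - (u p - v p) - ⟪e, x - p⟫| ≤ C * (r ^ 2 * hgt u v p r) ^ ν := by
  obtain ⟨ν, hν1, hν2, C0, hC0, C, hC, hb⟩ := exists_affine_bound_unit n
  refine ⟨ν, hν1, hν2, C0, hC0, C, hC, fun u v e h he p r hr hH x hx => ?_⟩
  have e1 : hgt (fun y => r * u (p + r • y)) (fun y => r * v (p + r • y)) 0 1
      = r ^ 2 * hgt u v p r := by rw [hgt_affine, smul_zero, add_zero, mul_one]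
  have h1 := hb _ _ (r ^ 2 • e) (h.rescale p hr) (fun i y => by
    simp only [PiLp.smul_apply, smul_eq_mul]
    refine Filter.Tendsto.congr (fun s => (grd_affine h.su h.sv p i y r s).symm) ?_
    exact ((he i _).comp (Filter.tendsto_id.const_mul_atTop hr)).const_mul _)
    (by rw [e1]; exact hH) (r⁻¹ • (x - p)) (by
      rw [norm_smul, norm_inv, Real.norm_of_nonneg hr.le, inv_mul_le_iff₀ hr]; linarith)
  rw [e1, smul_smul, mul_inv_cancel₀ hr.ne', one_smul, add_sub_cancel, smul_zero, add_zero,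
    inner_smul_left, inner_smul_right] at h1
  refine le_trans (le_of_eq ?_) h1
  nth_rewrite 1 [← abs_of_pos hr]
  rw [← abs_mul]; congr 1
  simp only [conj_trivial]
  field_simp

/-- Height bound at points of the interface. -/
theorem exists_hgt_bound_zero (n : ℕ) : ∃ C > 0, ∀ u v : Eu n → ℝ, ∀ e : Eu n, Sol u v →
    (∀ i x, Filter.Tendsto (grd u v i x) Filter.atTop (nhds (e i))) →
    ∀ p r, 0 < r → u p = v p → r ^ 2 * hgt u v p r ≤ 4 * r ^ 4 * ‖e‖ ^ 2 + C := by
  obtain ⟨ν, hν1, hν2, C0, hC0, C, hC, hb⟩ := exists_affine_bound_unit n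
  obtain ⟨γ, hγ1, hγ2, C', hC', hmin⟩ := exists_min_bound n
  set κ := max ν γ
  have hκ : 0 < 1 - 2 * κ := by have : κ < 1 / 2 := max_lt hν2 hγ2; linarith
  set K := C + C'
  have hK : 0 < K := by simp only [K]; linarith
  set T := C0 + C' + (6 * K ^ 2) ^ (1 / (1 - 2 * κ))
  have hT6 : 0 ≤ (6 * K ^ 2) ^ (1 / (1 - 2 * κ)) := by positivity
  have hT : 0 < T := by simp only [T]; linarith
  have hunit : ∀ u v : Eu n → ℝ, ∀ e : Eu n, Sol u v →
      (∀ i x, Filter.Tendsto (grd u v i x) Filter.atTop (nhds (e i))) → u 0 = v 0 →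
      hgt u v 0 1 ≤ 4 * ‖e‖ ^ 2 + T := by
    intro u v e h he h0
    rcases le_or_gt (hgt u v 0 1) T with hle | hgt'
    · have := sq_nonneg ‖e‖; linarith
    have ha := hb u v e h he (by simp only [T] at hgt'; linarith)
    have hm := hmin u v h (by simp only [T] at hgt'; linarith)
    have hle2 : hgt u v 0 1 ≤ 2 * ‖e‖ ^ 2 + 3 * (K * hgt u v 0 1 ^ κ) ^ 2 := by
      refine avk_le h.smooth_sq.continuous zero_le_one fun z hz => ?_
      have hz1 : ‖z‖ ≤ 1 := by have := norm_le_of_mem hz; simpa using this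
      have h1 := ha z hz1
      have h2 := hm z (by linarith)
      rw [h0, sub_self, sub_zero] at h1
      have h3 : |⟪e, z⟫| ≤ ‖e‖ := (abs_real_inner_le_norm e z).trans
        (mul_le_of_le_one_right (norm_nonneg _) hz1)
      set H := hgt u v 0 1
      have hH1 : 1 ≤ H := by simp only [T] at hgt'; linarith
      have k1 : H ^ ν ≤ H ^ κ := Real.rpow_le_rpow_of_exponent_le hH1 (le_max_left _ _)
      have k2 : H ^ γ ≤ H ^ κ := Real.rpow_le_rpow_of_exponent_le hH1 (le_max_right _ _)
      have k3 : C * H ^ ν ≤ C * H ^ κ := by gcongr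
      have k4 : C' * H ^ γ ≤ C' * H ^ κ := by gcongr
      have hu := h.pu z
      have hv := h.pv z
      have hκ0 : 0 < H ^ κ := Real.rpow_pos_of_pos (by linarith) _
      set b := K * H ^ κ
      have hb0 : b = C * H ^ κ + C' * H ^ κ := by simp only [b, K]; ring
      have hCk : 0 < C * H ^ κ := by positivity
      have hw : |u z - v z| ≤ ‖e‖ + C * H ^ κ := by
        rw [abs_le] at h1 h3 ⊢; constructor <;> linarith [h1.1, h1.2, h3.1, h3.2]
      have hmn : min (u z) (v z) ≤ C' * H ^ κ := h2.trans k4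
      have key : ∀ a c : ℝ, 0 < a → 0 < c → c ≤ a → |a - c| ≤ ‖e‖ + C * H ^ κ → c ≤ C' * H ^ κ →
          a ^ 2 + c ^ 2 ≤ 2 * ‖e‖ ^ 2 + 3 * b ^ 2 := fun a c ha hc hca hac hcm => by
        have q1 := le_abs_self (a - c)
        have q2 : a ≤ ‖e‖ + b := by linarith
        have q3 : c ≤ b := by linarith
        have q4 : a ^ 2 ≤ (‖e‖ + b) ^ 2 := by gcongr
        have q5 : c ^ 2 ≤ b ^ 2 := by gcongr
        nlinarith [sq_nonneg (‖e‖ - b)]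
      rcases le_total (v z) (u z) with hc | hc
      · exact key _ _ hu hv hc hw (by rwa [min_eq_right hc] at hmn)
      · rw [add_comm]
        exact key _ _ hv hu hc (by rwa [abs_sub_comm]) (by rwa [min_eq_left hc] at hmn)
    set H := hgt u v 0 1
    have hH6 : (6 * K ^ 2) ^ (1 / (1 - 2 * κ)) ≤ H := by simp only [T] at hgt'; linarith
    have hH0 : 0 < H := by linarith
    have h1 : 6 * K ^ 2 ≤ H ^ (1 - 2 * κ) := by
      have := Real.rpow_le_rpow hT6 hH6 hκ.le
      rwa [← Real.rpow_mul (by positivity), one_div_mul_cancel hκ.ne', Real.rpow_one] at this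
    have h2 : H ^ (1 - 2 * κ) * (H ^ κ) ^ 2 = H := by
      rw [← Real.rpow_natCast, ← Real.rpow_mul hH0.le, ← Real.rpow_add hH0]
      norm_num [mul_comm]
    have h3 : 6 * K ^ 2 * (H ^ κ) ^ 2 ≤ H := by
      calc _ ≤ H ^ (1 - 2 * κ) * (H ^ κ) ^ 2 := by gcongr
        _ = H := h2
    nlinarith
  refine ⟨T, hT, fun u v e h he p r hr hp => ?_⟩
  have h1 := hunit _ _ (r ^ 2 • e) (h.rescale p hr) (fun i y => by
    simp only [PiLp.smul_apply, smul_eq_mul]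
    refine Filter.Tendsto.congr (fun s => (grd_affine h.su h.sv p i y r s).symm) ?_
    exact ((he i _).comp (Filter.tendsto_id.const_mul_atTop hr)).const_mul _)
    (by simp [hp])
  rw [hgt_affine, smul_zero, add_zero, mul_one, norm_smul, Real.norm_of_nonneg (sq_nonneg r)] at h1
  linarith

theorem Sol.exists_le (h : Sol u v) : ∃ p, u p ≤ v p := by
  by_contra! hlt
  obtain ⟨C, hC, hg⟩ := h.growth
  have hv0 := h.pv 0
  set R := 1 + 4 * n * C / v 0 ^ 3
  have hR : 1 ≤ R := le_add_of_nonneg_right (by positivity)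
  have hR0 : 0 < R := by linarith
  obtain ⟨y, -, -, hy1, hy2⟩ := exists_quadratic_max h.sv isClosed_univ (Set.mem_univ (0 : Eu n))
    (R := R) (a := 2 * C / R) (M := C * (1 + R)) hR0.le (by positivity)
    (fun x _ hx => by
      rw [sub_zero] at hx
      have := hg x
      have := h.pu x
      have : C * (1 + ‖x‖) ≤ C * (1 + R) := by gcongr
      linarith)
    (by
      have : 2 * C / R * R ^ 2 = 2 * C * R := by field_simp
      rw [this]; nlinarith)
  have h1 := hy2 (by simp)
  rw [h.lv] at h1
  have h2 : v 0 ^ 3 ≤ v y * u y ^ 2 := by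
    have := hlt y
    have hvy := h.pv y
    calc v 0 ^ 3 = v 0 * v 0 ^ 2 := by ring
      _ ≤ v y * u y ^ 2 := by gcongr; linarith
  have h3 : 2 * n * (2 * C / R) < v 0 ^ 3 := by
    rw [mul_div_assoc', div_lt_iff₀ hR0]
    have : v 0 ^ 3 * R = v 0 ^ 3 + 4 * n * C := by simp only [R]; field_simp
    rw [this]
    have : 0 < v 0 ^ 3 := by positivity
    linarith
  linarith

theorem Sol.exists_zero (h : Sol u v) : ∃ p, u p = v p := by
  obtain ⟨p, hp⟩ := h.exists_le
  obtain ⟨q, hq⟩ := h.swap.exists_le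
  obtain ⟨z, -, hz⟩ := isPreconnected_univ.intermediate_value₂ (Set.mem_univ p) (Set.mem_univ q)
    h.su.continuous.continuousOn h.sv.continuous.continuousOn hp hq
  exact ⟨z, hz⟩

theorem Sol.ne_zero_of_tendsto (h : Sol u v) {e : Eu n}
    (he : ∀ i x, Filter.Tendsto (grd u v i x) Filter.atTop (nhds (e i))) : e ≠ 0 := by
  rintro rfl
  obtain ⟨p, hp⟩ := h.exists_zero
  obtain ⟨C, hC, hb⟩ := exists_hgt_bound_zero n
  obtain ⟨r, hr1, hr2⟩ := (((h.tendsto_scaled_hgt p).eventually_gt_atTop C).and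
    (Filter.eventually_gt_atTop 0)).exists
  have := hb u v 0 h he p r hr2 hp
  simp at this
  linarith

end AffineApproximation

section Phases
variable {n : ℕ} {u v f : Eu n → ℝ} {x e : Eu n} {r : ℝ}

/-- Solutions together with the limit of the mean gradients of their difference. -/
structure Flat {n : ℕ} (u v : Eu n → ℝ) (e : Eu n) : Prop extends Sol u v where
  lim : ∀ i x, Filter.Tendsto (grd u v i x) Filter.atTop (nhds (e i))

/-- The interface. -/
def zs {n : ℕ} (u v : Eu n → ℝ) : Set (Eu n) := {x | u x = v x}

theorem zs_comm (u v : Eu n → ℝ) : zs v u = zs u v := Set.ext fun _ => eq_comm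

theorem pd_sub_comm (hu : Smooth u) (hv : Smooth v) (i : Fin n) (x : Eu n) :
    pd i (fun y => v y - u y) x = -pd i (fun y => u y - v y) x := by
  rw [pd_sub hu hv, pd_sub hv hu]; ring

theorem pd_kG_eq_zero (i : Fin n) {y : Eu n} (hy : 1 ≤ ‖y‖) : pd i kG y = 0 := by
  have h1 : ∀ z : Eu n, 1 < ‖z‖ → pd i kG z = 0 := fun z hz => by
    have he : (kG : Eu n → ℝ) =ᶠ[nhds z] 0 := by
      filter_upwards [(isOpen_lt continuous_const continuous_norm).mem_nhds hz] with w hw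
      exact kG_eq_zero (le_of_lt hw)
    unfold pd; rw [he.fderiv_eq]; simp
  have hc : Continuous fun t : ℝ => pd i (kG : Eu n → ℝ) (t • y) := by
    have := (kG_smooth (n := n).pd i).continuous; fun_prop
  have ht : Filter.Tendsto (fun t : ℝ => pd i (kG : Eu n → ℝ) (t • y)) (nhdsWithin 1 (Set.Ioi 1))
      (nhds (pd i kG ((1 : ℝ) • y))) := (hc.tendsto 1).mono_left nhdsWithin_le_nhds
  rw [one_smul] at ht
  refine tendsto_nhds_unique ht (tendsto_const_nhds.congr' ?_)
  filter_upwards [self_mem_nhdsWithin] with t ht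
  have ht' : 1 < t := ht
  refine (h1 _ ?_).symm
  rw [norm_smul, Real.norm_of_nonneg (by linarith)]; nlinarith

namespace Flat

theorem swap (h : Flat u v e) : Flat v u (-e) where
  toSol := h.toSol.swap
  lim i x := by
    have : grd v u i x = fun r => -grd u v i x r := by
      ext r; unfold grd avk; rw [← integral_neg]; congr 1; ext y
      rw [pd_sub_comm h.su h.sv]; ring
    rw [this]; exact (h.lim i x).neg

theorem ne_zero (h : Flat u v e) : e ≠ 0 := h.toSol.ne_zero_of_tendsto h.lim

theorem isClosed_zs (h : Flat u v e) : IsClosed (zs u v) :=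
  isClosed_eq h.su.continuous h.sv.continuous

theorem exists_nearest (h : Flat u v e) (x : Eu n) : ∃ p, u p = v p ∧ infDist x (zs u v) = ‖x - p‖ := by
  obtain ⟨p, hp, hd⟩ := h.isClosed_zs.exists_infDist_eq_dist (h.toSol.exists_zero) x
  exact ⟨p, hp, by rw [hd, dist_eq_norm]⟩

theorem exists_hgt_lower (h : Flat u v e) (C₀ : ℝ) : ∃ r₀ ≥ 1, ∀ x r, r₀ ≤ r →
    C₀ ≤ r ^ 2 * hgt u v x r := by
  obtain ⟨μ, hμ1, hμ2, C1, hC1, C, hC, hrate⟩ := exists_grd_rate n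
  obtain ⟨i, hi⟩ : ∃ i, e i ≠ 0 := by
    by_contra! h0
    exact h.ne_zero (PiLp.ext h0)
  obtain ⟨D, hD, hK⟩ := exists_avk_bound (n := n) (kG_smooth.pd i).continuous
    fun _ => pd_kG_eq_zero i
  obtain ⟨C2, hC2, hsup⟩ := exists_sup_bound n (Λ := 1) (by norm_num)
  set A := max C₀ C1
  have hA1 : 1 ≤ A := hC1.trans (le_max_right _ _)
  set B := D * √(C2 * A) + C * A ^ μ
  have hB : 0 < B := by positivity
  have hi' : 0 < |e i| := abs_pos.2 hi
  refine ⟨1 + B / |e i|, le_add_of_nonneg_right (by positivity), fun x r hr => ?_⟩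
  by_contra! hlt
  have hr1 : 1 + B / |e i| ≤ r := hr
  have hr0 : 0 < r := lt_of_lt_of_le (by positivity) hr1
  obtain ⟨R, hR, hRA⟩ : ∃ R ∈ Set.Ici r, R ^ 2 * hgt u v x R = A := by
    obtain ⟨T, hT1, hT2⟩ := (((h.toSol.tendsto_scaled_hgt x).eventually_ge_atTop A).and
      (Filter.eventually_ge_atTop r)).exists
    have hc : Continuous fun r => r ^ 2 * hgt u v x r := by
      have : Continuous (hgt u v x) := continuous_iff_continuousAt.2 fun r =>
        (hasDerivAt_avk h.smooth_sq x r).continuousAt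
      fun_prop
    obtain ⟨R, hR, hRA⟩ := intermediate_value_Icc hT2 hc.continuousOn
      (show A ∈ Set.Icc _ _ from ⟨hlt.le.trans (le_max_left _ _), hT1⟩)
    exact ⟨R, hR.1, hRA⟩
  have hR' : r ≤ R := hR
  have hR0 : 0 < R := hr0.trans_le hR
  have h1 := hrate u v e h.toSol h.lim i x R hR0 (by rw [hRA]; exact le_max_right _ _)
  rw [hRA, le_div_iff₀ (by positivity)] at h1
  have h2 := hK _ x R (√(C2 * hgt u v x R)) h.toSol.smooth_sub.continuous hR0.le (by positivity)
    fun z hz => (h.toSol.abs_sub_le z).trans (Real.sqrt_le_sqrt (hsup u v h.toSol x z R hR0 (by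
      rw [mem_closedBall, dist_eq_norm] at hz; linarith)))
  rw [← abs_neg, ← integral_affine_pd_mul h.toSol.smooth_sub kG_smooth kG_supp, abs_mul,
    abs_of_pos hR0] at h2
  have h3 : R * √(C2 * hgt u v x R) = √(C2 * A) := by
    rw [← hRA, ← Real.sqrt_sq hR0.le, ← Real.sqrt_mul (sq_nonneg R), Real.sqrt_sq hR0.le]
    congr 1; ring
  have h4 : R ^ 2 * |grd u v i x R| ≤ D * √(C2 * A) := by
    calc _ = R * (R * |grd u v i x R|) := by ring
      _ ≤ R * (D * √(C2 * hgt u v x R)) := mul_le_mul_of_nonneg_left h2 hR0.le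
      _ = _ := by rw [← h3]; ring
  have h5 : |e i| ≤ |grd u v i x R - e i| + |grd u v i x R| := by
    have := abs_sub_abs_le_abs_sub (e i) (grd u v i x R)
    rw [abs_sub_comm] at this; linarith
  have h6 : |e i| * R ^ 2 ≤ B := by
    have := mul_le_mul_of_nonneg_right h5 (sq_nonneg R)
    simp only [B]; linarith
  have h7 : B < |e i| * R := by
    have : 1 + B / |e i| ≤ R := hr1.trans hR'
    rw [← div_lt_iff₀' hi']; linarith
  have h8 : 1 ≤ R := by have : 0 ≤ B / |e i| := by positivity
                        linarith
  nlinarith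

/-- Quadratic growth of the height around points of the interface. -/
theorem exists_hgt_upper (h : Flat u v e) : ∃ C > 0, ∀ p r, u p = v p → 1 ≤ r →
    hgt u v p r ≤ C * r ^ 2 := by
  obtain ⟨C, hC, hb⟩ := exists_hgt_bound_zero n
  refine ⟨4 * ‖e‖ ^ 2 + C, by positivity, fun p r hp hr => ?_⟩
  have h1 := hb u v e h.toSol h.lim p r (by linarith) hp
  have h2 : 1 ≤ r ^ 4 := one_le_pow₀ hr
  have h3 : r ^ 2 * hgt u v p r ≤ r ^ 2 * ((4 * ‖e‖ ^ 2 + C) * r ^ 2) := by nlinarith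
  exact le_of_mul_le_mul_left h3 (by positivity)

theorem exists_rpow_small {K ν : ℝ} (hν : ν < 1 / 2) {C η : ℝ} (hη : 0 < η) (hK : 0 < K) :
    ∃ r₀ ≥ 1, ∀ r, r₀ ≤ r → C * (K * r ^ 4) ^ ν ≤ η * r ^ 2 := by
  have h1 : Filter.Tendsto (fun r : ℝ => C * K ^ ν * r ^ (-(2 - 4 * ν))) Filter.atTop
      (nhds (C * K ^ ν * 0)) := (tendsto_rpow_neg_atTop (by linarith)).const_mul _
  rw [mul_zero] at h1
  obtain ⟨r0, hr0⟩ := Filter.eventually_atTop.1 (h1.eventually (gt_mem_nhds hη))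
  refine ⟨max r0 1, le_max_right _ _, fun r hr => ?_⟩
  have hr1 : 0 < r := by have := (le_max_right r0 1).trans hr; linarith
  have h2 := (hr0 r ((le_max_left _ _).trans hr)).le
  have h3 : (K * r ^ 4) ^ ν = K ^ ν * (r ^ (-(2 - 4 * ν)) * r ^ 2) := by
    rw [Real.mul_rpow hK.le (by positivity), ← Real.rpow_natCast, ← Real.rpow_mul hr1.le,
      ← Real.rpow_natCast, ← Real.rpow_add hr1]
    congr 2; push_cast; ring
  rw [h3]
  calc _ = C * K ^ ν * r ^ (-(2 - 4 * ν)) * r ^ 2 := by ring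
    _ ≤ _ := by gcongr

theorem exists_affine (h : Flat u v e) {η : ℝ} (hη : 0 < η) : ∃ r₀ ≥ 1, ∀ p r, u p = v p → r₀ ≤ r →
    ∀ x, ‖x - p‖ ≤ r → |u x - v x - ⟪e, x - p⟫| ≤ η * r := by
  obtain ⟨ν, hν1, hν2, C0, hC0, C, hC, hb⟩ := exists_affine_bound n
  obtain ⟨K, hK, hup⟩ := h.exists_hgt_upper
  obtain ⟨r1, hr1, hlow⟩ := h.exists_hgt_lower C0
  obtain ⟨r2, hr2, hsm⟩ := exists_rpow_small hν2 (C := C) hη hK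
  refine ⟨max r1 r2, hr1.trans (le_max_left _ _), fun p r hp hr x hx => ?_⟩
  have hra := (le_max_left _ _).trans hr
  have hrb := (le_max_right _ _).trans hr
  have hr0 : 0 < r := by linarith
  have h1 := hb u v e h.toSol h.lim p r hr0 (hlow p r hra) x hx
  rw [hp, sub_self, sub_zero] at h1
  have hp0 := h.toSol.hgt_pos (x := p) hr0.le
  have h2 : r * |u x - v x - ⟪e, x - p⟫| ≤ r * (η * r) := by
    calc _ ≤ C * (r ^ 2 * hgt u v p r) ^ ν := h1
      _ ≤ C * (K * r ^ 4) ^ ν := by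
          refine mul_le_mul_of_nonneg_left (Real.rpow_le_rpow (by positivity) ?_ (by linarith)) hC.le
          calc r ^ 2 * hgt u v p r ≤ r ^ 2 * (K * r ^ 2) := by
                gcongr; exact hup p r hp (by linarith)
            _ = _ := by ring
      _ ≤ η * r ^ 2 := hsm r hrb
      _ = _ := by ring
  exact le_of_mul_le_mul_left h2 hr0

theorem exists_linear_bound (h : Flat u v e) : ∃ C > 0, ∀ p r x, u p = v p → 1 ≤ r → ‖x - p‖ ≤ r →
    u x + v x ≤ C * r := by
  obtain ⟨K, hK, hup⟩ := h.exists_hgt_upper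
  obtain ⟨C2, hC2, hsup⟩ := exists_sup_bound n (Λ := 1) (by norm_num)
  refine ⟨2 * (C2 * K + 1), by positivity, fun p r x hp hr hx => ?_⟩
  have h1 := hsup u v h.toSol p x r (by linarith) (by linarith)
  have h2 := hup p r hp hr
  have h3 : u x ^ 2 + v x ^ 2 ≤ C2 * K * r ^ 2 := h1.trans (by
    rw [mul_assoc]; gcongr)
  have h4 : 0 < C2 * K := by positivity
  have key : ∀ a : ℝ, a ^ 2 ≤ C2 * K * r ^ 2 → a ≤ (C2 * K + 1) * r := fun a ha => by
    refine (le_abs_self a).trans (abs_le_of_sq_le_sq ?_ (by positivity))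
    calc a ^ 2 ≤ _ := ha
      _ ≤ (C2 * K + 1) ^ 2 * r ^ 2 := by gcongr; nlinarith
      _ = _ := by ring
  have := key (u x) (by nlinarith [sq_nonneg (v x)])
  have := key (v x) (by nlinarith [sq_nonneg (u x)])
  linarith

theorem exists_grd_near (h : Flat u v e) {η : ℝ} (hη : 0 < η) : ∃ r₀ ≥ 1, ∀ i x r, r₀ ≤ r →
    infDist x (zs u v) ≤ 4 * r → |grd u v i x r - e i| ≤ η := by
  obtain ⟨μ, hμ1, hμ2, C0, hC0, C, hC, hrate⟩ := exists_grd_rate n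
  obtain ⟨K, hK, hup⟩ := h.exists_hgt_upper
  obtain ⟨C2, hC2, hcmp⟩ := exists_hgt_compare n (Λ := 4) (by norm_num)
  obtain ⟨r1, hr1, hlow⟩ := h.exists_hgt_lower C0
  obtain ⟨r2, hr2, hsm⟩ := exists_rpow_small hμ2 (C := C) (K := C2 * K) hη (by positivity)
  refine ⟨max r1 r2, hr1.trans (le_max_left _ _), fun i x r hr hx => ?_⟩
  have hra := (le_max_left _ _).trans hr
  have hrb := (le_max_right _ _).trans hr
  have hr0 : 0 < r := by linarith
  obtain ⟨p, hp, hpd⟩ := h.exists_nearest x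
  have hp0 := h.toSol.hgt_pos (x := x) hr0.le
  refine (hrate u v e h.toSol h.lim i x r hr0 (hlow x r hra)).trans ?_
  rw [div_le_iff₀ (by positivity)]
  refine le_trans ?_ (hsm r hrb)
  refine mul_le_mul_of_nonneg_left (Real.rpow_le_rpow (by positivity) ?_ (by linarith)) hC.le
  calc r ^ 2 * hgt u v x r ≤ r ^ 2 * (C2 * (K * r ^ 2)) := by
        gcongr
        exact (hcmp u v h.toSol p x r hr0 (by rw [← hpd]; exact hx)).trans (by
          gcongr; exact hup p r hp (by linarith))
    _ = _ := by ring

theorem lt_of_dist_lt (h : Flat u v e) (hx : v x < u x) {y : Eu n}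
    (hy : ‖y - x‖ < infDist x (zs u v)) : v y < u y := by
  by_contra! hle
  have hb : IsPreconnected (ball x (infDist x (zs u v))) := (convex_ball _ _).isPreconnected
  obtain ⟨z, hz, hzz⟩ := hb.intermediate_value₂
    (mem_ball.2 (by rwa [dist_eq_norm])) (mem_ball_self ((norm_nonneg _).trans_lt hy))
    h.su.continuous.continuousOn h.sv.continuous.continuousOn hle hx.le
  have := infDist_le_dist_of_mem (x := x) (show z ∈ zs u v from hzz)
  rw [mem_ball, dist_comm] at hz
  linarith

theorem exists_lower (h : Flat u v e) : ∃ d₀ ≥ 1, ∀ x, d₀ ≤ infDist x (zs u v) → v x < u x →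
    ∀ y, ‖y - x‖ ≤ infDist x (zs u v) / 2 → ‖e‖ / 8 * infDist x (zs u v) ≤ u y := by
  have he : 0 < ‖e‖ := norm_pos_iff.2 h.ne_zero
  obtain ⟨r0, hr0, haff⟩ := h.exists_affine (η := ‖e‖ / 32) (by positivity)
  refine ⟨r0, hr0, fun x hx hxw y hy => ?_⟩
  obtain ⟨p, hp, hpd⟩ := h.exists_nearest x
  have hlt := fun y => h.lt_of_dist_lt (y := y) hxw
  set d := infDist x (zs u v)
  have hd : 0 < d := by linarith
  set y' := y - (d / 4 / ‖e‖) • e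
  have e1 : ‖(d / 4 / ‖e‖) • e‖ = d / 4 := by
    rw [norm_smul, Real.norm_of_nonneg (by positivity)]; field_simp
  have hy' : ‖y' - x‖ ≤ 3 / 4 * d := by
    have := norm_sub_le (y - x) ((d / 4 / ‖e‖) • e)
    rw [show y' - x = y - x - (d / 4 / ‖e‖) • e by simp only [y']; abel]
    linarith
  have htri : ∀ z, ‖z - p‖ ≤ ‖z - x‖ + ‖x - p‖ := fun z => by
    have := norm_add_le (z - x) (x - p); rwa [sub_add_sub_cancel] at this
  have h1 := hlt y' (by linarith)
  have h2 := haff p (2 * d) hp (by linarith) y' (by have := htri y'; linarith)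
  have h3 := haff p (2 * d) hp (by linarith) y (by have := htri y; linarith)
  have e2 : (⟪e, y - p⟫ : ℝ) = ⟪e, y' - p⟫ + d / 4 * ‖e‖ := by
    rw [show y - p = (y' - p) + (d / 4 / ‖e‖) • e by simp only [y']; abel, inner_add_right,
      inner_smul_right, real_inner_self_eq_norm_sq]
    field_simp
  have h4 := h.pv y
  rw [abs_le] at h2 h3
  nlinarith [h2.1, h2.2, h3.1, h3.2]

end Flat

theorem le_of_lap_ge (hf : Smooth f) {z : Eu n} {k M ρ : ℝ} (hk : 0 < k) (hρ : 0 < ρ)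
    (h0 : ∀ y, 0 < f y) (hb : ∀ y, ‖y - z‖ ≤ ρ → f y ≤ M)
    (hl : ∀ y, ‖y - z‖ ≤ ρ → k * f y ≤ lap f y) : f z ≤ 2 * n * M / (k * ρ ^ 2) := by
  have hM : 0 ≤ M := (h0 z).le.trans (hb z (by simpa using hρ.le))
  obtain ⟨y, -, hy, hy1, hy2⟩ := exists_quadratic_max hf isClosed_univ (Set.mem_univ z)
    (R := ρ) (a := M / ρ ^ 2) (M := M) hρ.le (by positivity) (fun x _ hx => hb x hx)
    (by rw [div_mul_cancel₀ _ (by positivity)]; linarith [h0 z])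
  have h1 := (hl y hy.le).trans (hy2 (by simp))
  rw [le_div_iff₀ (by positivity)]
  have h2 : k * f z ≤ 2 * n * (M / ρ ^ 2) := (mul_le_mul_of_nonneg_left hy1 hk.le).trans h1
  calc f z * (k * ρ ^ 2) = k * f z * ρ ^ 2 := by ring
    _ ≤ 2 * n * (M / ρ ^ 2) * ρ ^ 2 := by gcongr
    _ = _ := by field_simp

namespace Flat

/-- Far from the interface the smaller component is tiny. -/
theorem exists_deep (h : Flat u v e) : ∃ d₀ ≥ 1, ∃ C > 0, ∀ x, d₀ ≤ infDist x (zs u v) → v x < u x →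
    ∀ z, ‖z - x‖ ≤ infDist x (zs u v) / 4 →
      v z ≤ C / infDist x (zs u v) ^ 7 ∧ u z + v z ≤ C * infDist x (zs u v) := by
  have he : 0 < ‖e‖ := norm_pos_iff.2 h.ne_zero
  obtain ⟨d0, hd0, hlow⟩ := h.exists_lower
  obtain ⟨C, hC, hlin⟩ := h.exists_linear_bound
  set A := 2 * n * 4096 / ‖e‖ ^ 2
  have hA : 0 ≤ A := by positivity
  refine ⟨d0, hd0, A * (A * (2 * C)) + 2 * C, by positivity, fun x hx hxw => ?_⟩
  obtain ⟨p, hp, hpd⟩ := h.exists_nearest x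
  have hl := hlow x hx hxw
  set d := infDist x (zs u v)
  have hd1 : 1 ≤ d := hd0.trans hx
  have hd : 0 < d := by linarith
  have htri : ∀ z y w : Eu n, ‖z - w‖ ≤ ‖z - y‖ + ‖y - w‖ := fun z y w => by
    have := norm_add_le (z - y) (y - w); rwa [sub_add_sub_cancel] at this
  have h2 : ∀ z, ‖z - x‖ ≤ d / 2 → u z + v z ≤ 2 * C * d := fun z hz => by
    have := hlin p (2 * d) z hp (by linarith) (by have := htri z x p; linarith)
    linarith
  have hlap : ∀ y, ‖y - x‖ ≤ d / 2 → (‖e‖ / 8 * d) ^ 2 * v y ≤ lap v y := fun y hy => by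
    rw [h.lv, mul_comm]
    have := hl y hy
    have := (h.pv y).le
    gcongr
  have step : ∀ z M, (∀ y, ‖y - z‖ ≤ d / 8 → ‖y - x‖ ≤ d / 2) → (∀ y, ‖y - z‖ ≤ d / 8 → v y ≤ M) →
      v z ≤ A * M / d ^ 4 := fun z M hz hM => by
    have := le_of_lap_ge h.sv (z := z) (k := (‖e‖ / 8 * d) ^ 2) (M := M) (ρ := d / 8)
      (by positivity) (by positivity) h.pv hM fun y hy => hlap y (hz y hy)
    refine this.trans (le_of_eq ?_)
    simp only [A]; field_simp; norm_num
  have h3 : ∀ z, ‖z - x‖ ≤ 3 / 8 * d → v z ≤ A * (2 * C * d) / d ^ 4 := fun z hz =>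
    step z _ (fun y hy => by have := htri y z x; linarith) fun y hy => by
      have := h2 y (by have := htri y z x; linarith)
      have := h.pu y
      linarith
  intro z hz
  have h4 := step z _ (fun y hy => by have := htri y z x; linarith) fun y hy =>
    h3 y (by have := htri y z x; linarith)
  constructor
  · refine h4.trans ?_
    rw [show A * (A * (2 * C * d) / d ^ 4) / d ^ 4 = A * (A * (2 * C)) / d ^ 7 by field_simp]
    gcongr
    linarith
  · have := h2 z (by linarith)
    have : 0 ≤ A * (A * (2 * C)) * d := by positivity
    linarith

theorem exists_small (h : Flat u v e) {η : ℝ} (hη : 0 < η) : ∃ d₀ ≥ 1, ∀ x, d₀ ≤ infDist x (zs u v) →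
    v x < u x → v x ≤ η := by
  obtain ⟨d0, hd0, C, hC, hdeep⟩ := h.exists_deep
  refine ⟨d0 + C / η, le_add_of_le_of_nonneg hd0 (by positivity), fun x hx hxw => ?_⟩
  have hCη : 0 < C / η := by positivity
  have h1 := (hdeep x (by linarith) hxw x (by
    rw [sub_self, norm_zero]; linarith [infDist_nonneg (x := x) (s := zs u v)])).1
  refine h1.trans ?_
  set d := infDist x (zs u v)
  have hd : 1 ≤ d := by linarith
  rw [div_le_iff₀ (by positivity)]
  have h2 : d ≤ d ^ 7 := le_self_pow₀ hd (by norm_num)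
  have h3 : C / η ≤ d := by linarith
  rw [div_le_iff₀ hη] at h3
  nlinarith

theorem exists_gradient_half (h : Flat u v e) {η : ℝ} (hη : 0 < η) : ∃ d₀ ≥ 1, ∀ x,
    d₀ ≤ infDist x (zs u v) → v x < u x → ∀ i, |pd i (fun y => u y - v y) x - e i| ≤ η := by
  obtain ⟨d0, hd0, C, hC, hdeep⟩ := h.exists_deep
  obtain ⟨r0, hr0, hgrd⟩ := h.exists_grd_near (half_pos hη)
  obtain ⟨D, hD, hgb⟩ := exists_gradient_bound n
  refine ⟨d0 + 4 * r0 + D * C ^ 3 / η, by have : 0 < D * C ^ 3 / η := by positivity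
                                          linarith, fun x hx hxw i => ?_⟩
  have hp : 0 < D * C ^ 3 / η := by positivity
  have hdp := hdeep x (by linarith) hxw
  have h1 := hgrd i x (infDist x (zs u v) / 4) (by linarith) (by linarith)
  set d := infDist x (zs u v)
  have hd1 : 1 ≤ d := by linarith
  have hd : 0 < d := by linarith
  have h2 := hgb _ i x (d / 4) (C ^ 3 / d ^ 5) h.toSol.smooth_sub (by linarith) (by positivity)
    (fun z hz => by
      obtain ⟨hv, hu⟩ := hdp z (by rwa [mem_closedBall, dist_eq_norm] at hz)
      have hu0 := h.pu z
      have hv0 := h.pv z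
      rw [h.toSol.lap_sub_eq, abs_neg, abs_mul, abs_of_pos (mul_pos hu0 hv0)]
      have h3 : |u z - v z| ≤ C * d := by rw [abs_le]; constructor <;> linarith
      calc u z * v z * |u z - v z| ≤ C * d * (C / d ^ 7) * (C * d) := by gcongr; linarith
        _ = _ := by field_simp)
  have h4 : D * (C ^ 3 / d ^ 5) * (d / 4) ≤ η / 2 := by
    rw [show D * (C ^ 3 / d ^ 5) * (d / 4) = D * C ^ 3 / (4 * d ^ 4) by field_simp,
      div_le_iff₀ (by positivity)]
    have h5 : D * C ^ 3 / η ≤ d := by linarith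
    rw [div_le_iff₀ hη] at h5
    have h6 : d ≤ d ^ 4 := le_self_pow₀ hd1 (by norm_num)
    nlinarith
  unfold grd at h1
  rw [abs_le] at h1 h2 ⊢
  constructor <;> linarith [h1.1, h1.2, h2.1, h2.2]

/-- Far from the interface the gradient of the difference is almost constant. -/
theorem exists_gradient (h : Flat u v e) {η : ℝ} (hη : 0 < η) : ∃ d₀ ≥ 1, ∀ x,
    d₀ ≤ infDist x (zs u v) → ∀ i, |pd i (fun y => u y - v y) x - e i| ≤ η := by
  obtain ⟨d1, hd1, h1⟩ := h.exists_gradient_half hη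
  obtain ⟨d2, hd2, h2⟩ := h.swap.exists_gradient_half hη
  refine ⟨max d1 d2, hd1.trans (le_max_left _ _), fun x hx i => ?_⟩
  rcases lt_trichotomy (u x) (v x) with hlt | heq | hlt
  · have := h2 x (by rw [zs_comm]; exact (le_max_right _ _).trans hx) hlt i
    rw [pd_sub_comm h.su h.sv, PiLp.neg_apply, ← abs_neg] at this
    convert this using 2; ring
  · have : infDist x (zs u v) = 0 := infDist_zero_of_mem heq
    have := (le_max_left _ _).trans hx
    linarith
  · exact h1 x ((le_max_left _ _).trans hx) hlt i

/-- Gradient bound for the first component near the interface. -/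
theorem exists_lipschitz (h : Flat u v e) {D : ℝ} (hD : 0 ≤ D) : ∃ L > 0, ∀ x,
    infDist x (zs u v) ≤ D → ∀ i, |pd i u x| ≤ L := by
  obtain ⟨C, hC, hlin⟩ := h.exists_linear_bound
  obtain ⟨A, hA, hgb⟩ := exists_gradient_bound n
  choose B hB hker using fun i : Fin n => exists_avk_bound (n := n) (kG_smooth.pd i).continuous
    fun _ => pd_kG_eq_zero i
  have hB0 : 0 ≤ ∑ i, B i := Finset.sum_nonneg fun i _ => (hB i).le
  set M := C * (D + 1)
  have hM : 0 < M := by positivity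
  refine ⟨A * M ^ 3 + (∑ i, B i) * M, by positivity, fun x hx i => ?_⟩
  obtain ⟨p, hp, hpd⟩ := h.exists_nearest x
  have hbd : ∀ z ∈ closedBall x 1, u z + v z ≤ M := fun z hz => by
    rw [mem_closedBall, dist_eq_norm] at hz
    have := norm_add_le (z - x) (x - p)
    rw [sub_add_sub_cancel] at this
    exact hlin p (D + 1) z hp (by linarith) (by linarith)
  have h1 := hgb u i x 1 (M ^ 3) h.su zero_le_one (by positivity) fun z hz => by
    have hu := h.pu z
    have hv := h.pv z
    have := hbd z hz
    rw [h.lu, abs_of_pos (by positivity), show M ^ 3 = M * M ^ 2 by ring]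
    gcongr <;> linarith
  have h2 := hker i u x 1 M h.su.continuous zero_le_one hM.le fun z hz => by
    have hu := h.pu z
    have hv := h.pv z
    have := hbd z hz
    rw [abs_of_pos hu]; linarith
  rw [← abs_neg, ← integral_affine_pd_mul h.su kG_smooth kG_supp, one_mul] at h2
  have h3 : B i * M ≤ (∑ i, B i) * M := mul_le_mul_of_nonneg_right
    (Finset.single_le_sum (fun i _ => (hB i).le) (Finset.mem_univ i)) hM.le
  rw [abs_le] at h1 h2 ⊢
  constructor <;> linarith [h1.1, h1.2, h2.1, h2.2]

end Flat
end Phases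

section Sliding
variable {n : ℕ} {u v f : Eu n → ℝ} {x e ξ ζ : Eu n} {t : ℝ}

/-- Translation by `ζ` increases the first component and decreases the second one. -/
def Mono (u v : Eu n → ℝ) (ζ : Eu n) : Prop := ∀ x, u x ≤ u (x + ζ) ∧ v (x + ζ) ≤ v x

theorem Mono.swap (h : Mono u v ζ) : Mono v u (-ζ) := fun x => by
  have := h (x + -ζ)
  rw [neg_add_cancel_right] at this
  exact this.symm

theorem Smooth.shift (hf : Smooth f) (ζ : Eu n) : Smooth fun y => f (y + ζ) :=
  hf.comp (contDiff_id.add contDiff_const)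

theorem lap_shift (hf : Smooth f) (ζ : Eu n) (x : Eu n) :
    lap (fun y => f (y + ζ)) x = lap f (x + ζ) := by
  have := lap_affine hf ζ 1 x
  simpa [add_comm] using this

theorem Sol.le_shift (h : Sol u v) {κ : ℝ} (hκ : 0 < κ)
    (hs : ∀ x, u (x + ζ) < u x → v (x + ζ) ≤ v x ∧ κ ≤ v x ^ 2) (x : Eu n) : u x ≤ u (x + ζ) := by
  by_contra! hlt
  obtain ⟨C, hC, hg⟩ := h.growth
  set g : Eu n → ℝ := fun y => u y - u (y + ζ)
  have sg : Smooth g := h.su.sub (h.su.shift ζ)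
  have hgx : 0 < g x := sub_pos.2 hlt
  set B := 2 * n * (C * (2 + ‖x‖))
  have hB : 0 ≤ B := by positivity
  set R := 1 + B / (κ * g x)
  have hBR : 0 ≤ B / (κ * g x) := by positivity
  have hR : 1 ≤ R := by simp only [R]; linarith
  set M := C * (2 + ‖x‖) * R
  have hgM : ∀ y, ‖y - x‖ ≤ R → g y ≤ M := fun y hy => by
    have h1 := hg y
    have h2 := h.pv y
    have h3 := h.pu (y + ζ)
    have h4 : ‖y‖ ≤ ‖x‖ + R := by
      have := norm_add_le (y - x) x
      rw [sub_add_cancel] at this; linarith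
    have h5 : 1 + ‖y‖ ≤ (2 + ‖x‖) * R := by nlinarith [norm_nonneg x]
    have h6 := mul_le_mul_of_nonneg_left h5 hC.le
    simp only [g, M]; linarith
  obtain ⟨y, -, hy, hy1, hy2⟩ := exists_quadratic_max sg isClosed_univ (Set.mem_univ x)
    (R := R) (a := M / R ^ 2) (M := M) (by linarith) (by positivity) (fun y _ hy => hgM y hy)
    (by rw [div_mul_cancel₀ _ (by positivity)]; linarith)
  have h1 := hy2 (by simp)
  have hgy : 0 < g y := hgx.trans_le hy1
  obtain ⟨h2, h3⟩ := hs y (sub_pos.1 hgy)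
  have h4 : κ * g x ≤ lap g y := by
    rw [lap_sub h.su (h.su.shift ζ), lap_shift h.su, h.lu, h.lu]
    have h5 : u (y + ζ) * v (y + ζ) ^ 2 ≤ u (y + ζ) * v y ^ 2 := by
      have := h.pu (y + ζ); have := h.pv (y + ζ)
      gcongr
    have h6 : κ * g x ≤ v y ^ 2 * g y := mul_le_mul h3 hy1 hgx.le (sq_nonneg _)
    have h7 : v y ^ 2 * g y = u y * v y ^ 2 - u (y + ζ) * v y ^ 2 := by simp only [g]; ring
    linarith
  have h5 : κ * g x * R ≤ B := by
    have := h4.trans h1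
    have h6 : 2 * n * (M / R ^ 2) * R = B := by simp only [M, B]; field_simp
    rw [← h6]
    gcongr
  have h7 : κ * g x * R = κ * g x + B := by simp only [R]; field_simp
  have : 0 < κ * g x := by positivity
  linarith

theorem Sol.mono_of_sub (h : Sol u v) {κ : ℝ} (hκ : 0 < κ)
    (hs : ∀ x, (u x ≤ u (x + ζ) ∧ v (x + ζ) ≤ v x) ∨
      κ ≤ (u (x + ζ) - v (x + ζ)) - (u x - v x)) : Mono u v ζ := fun x => by
  refine ⟨h.le_shift (pow_pos hκ 2) (fun x hx => ?_) x, ?_⟩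
  · rcases hs x with h1 | h1
    · exact absurd h1.1 (not_le.2 hx)
    · have := h.pv (x + ζ)
      exact ⟨by linarith, pow_le_pow_left₀ hκ.le (by linarith) 2⟩
  · have := h.swap.le_shift (ζ := -ζ) (pow_pos hκ 2) (fun y hy => ?_) (x + ζ)
    · rwa [add_neg_cancel_right] at this
    · have h1 := hs (y + -ζ)
      rw [neg_add_cancel_right] at h1
      rcases h1 with h1 | h1
      · exact absurd h1.2 (not_le.2 hy)
      · have := h.pu (y + -ζ)
        exact ⟨by linarith, pow_le_pow_left₀ hκ.le (by linarith) 2⟩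

theorem infDist_add_le (S : Set (Eu n)) (x y : Eu n) : infDist (x + y) S ≤ infDist x S + ‖y‖ := by
  have := infDist_le_infDist_add_dist (s := S) (x := x + y) (y := x)
  rwa [dist_eq_norm, add_sub_cancel_left] at this

theorem le_infDist_add (S : Set (Eu n)) (x y : Eu n) : infDist x S - ‖y‖ ≤ infDist (x + y) S := by
  have := infDist_le_infDist_add_dist (s := S) (x := x) (y := x + y)
  rw [dist_comm, dist_eq_norm, add_sub_cancel_left] at this
  linarith

namespace Flat

/-- Away from the interface the difference increases along admissible directions. -/
theorem exists_sub_far (h : Flat u v e) (hξ : ‖ξ‖ = 1) (hc : 0 < (⟪e, ξ⟫ : ℝ)) :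
    ∃ d₀ ≥ 1, ∀ x τ, 0 ≤ τ → d₀ + τ ≤ infDist x (zs u v) →
      ⟪e, ξ⟫ / 2 * τ ≤ (u (x + τ • ξ) - v (x + τ • ξ)) - (u x - v x) := by
  set c : ℝ := ⟪e, ξ⟫ with hcd
  obtain ⟨d0, hd0, hgr⟩ := h.exists_gradient (η := c / (2 * (n + 1))) (by positivity)
  refine ⟨d0, hd0, fun x τ hτ hx => ?_⟩
  have sw := h.toSol.smooth_sub
  have hd : ∀ s, HasDerivAt (fun s : ℝ => u (x + s • ξ) - v (x + s • ξ))
      (∑ i, ξ i * pd i (fun y => u y - v y) (x + s • ξ)) s := fun s => hasDerivAt_ray sw x ξ s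
  have := Convex.mul_sub_le_image_sub_of_le_deriv (convex_Icc 0 τ)
    (f := fun s : ℝ => u (x + s • ξ) - v (x + s • ξ)) (C := c / 2)
    (fun s _ => (hd s).continuousAt.continuousWithinAt)
    (fun s _ => (hd s).differentiableAt.differentiableWithinAt) (fun s hs => ?_)
    0 (Set.left_mem_Icc.2 hτ) τ (Set.right_mem_Icc.2 hτ) hτ
  · simpa using this
  · rw [interior_Icc] at hs
    rw [(hd s).deriv]
    have h1 : d0 ≤ infDist (x + s • ξ) (zs u v) := by
      have := le_infDist_add (zs u v) x (s • ξ)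
      rw [norm_smul, hξ, mul_one, Real.norm_of_nonneg hs.1.le] at this
      linarith [hs.2]
    have h2 : c = ∑ i, ξ i * e i := by rw [hcd, PiLp.inner_apply]; rfl
    have h3 : |∑ i, ξ i * (pd i (fun y => u y - v y) (x + s • ξ) - e i)| ≤ c / 2 := by
      refine (Finset.abs_sum_le_sum_abs _ _).trans ?_
      calc _ ≤ ∑ i : Fin n, c / (2 * (n + 1)) := Finset.sum_le_sum fun i _ => by
            rw [abs_mul]
            have h4 : |ξ i| ≤ 1 := by rw [← hξ]; exact PiLp.norm_apply_le ξ i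
            have h5 := hgr _ h1 i
            nlinarith [abs_nonneg (ξ i), abs_nonneg (pd i (fun y => u y - v y) (x + s • ξ) - e i)]
        _ ≤ c / 2 := by
            rw [Finset.sum_const, Finset.card_univ, Fintype.card_fin, nsmul_eq_mul, mul_div_assoc',
              div_le_div_iff₀ (by positivity) (by positivity)]
            nlinarith
    simp only [mul_sub, Finset.sum_sub_distrib, ← h2] at h3
    linarith [(abs_le.1 h3).1]

/-- Large translations are monotone. -/
theorem exists_mono_large (h : Flat u v e) (hξ : ‖ξ‖ = 1) (hc : 0 < (⟪e, ξ⟫ : ℝ)) :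
    ∃ T : ℝ, ∀ τ ≥ T, Mono u v (τ • ξ) := by
  obtain ⟨d0, hd0, hfar⟩ := h.exists_sub_far hξ hc
  set c : ℝ := ⟪e, ξ⟫ with hcd
  obtain ⟨r0, hr0, haff⟩ := h.exists_affine (η := c / 12) (by positivity)
  refine ⟨d0 + r0, fun τ hτ => h.toSol.mono_of_sub (κ := c / 2 * τ) (by
    have : 0 < τ := by linarith
    positivity) fun x => Or.inr ?_⟩
  rcases le_or_gt (2 * τ) (infDist x (zs u v)) with hx | hx
  · exact hfar x τ (by linarith) (by linarith)
  · obtain ⟨p, hp, hpd⟩ := h.exists_nearest x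
    have h1 := haff p (3 * τ) hp (by linarith) x (by linarith)
    have h2 := haff p (3 * τ) hp (by linarith) (x + τ • ξ) (by
      have := norm_add_le (x - p) (τ • ξ)
      rw [norm_smul, hξ, mul_one, Real.norm_of_nonneg (by linarith)] at this
      rw [show x + τ • ξ - p = x - p + τ • ξ by abel]
      linarith)
    rw [show x + τ • ξ - p = x - p + τ • ξ by abel, inner_add_right, inner_smul_right, ← hcd] at h2
    rw [abs_le] at h1 h2
    linarith [h1.1, h1.2, h2.1, h2.2]

/-- Quantitative strict monotonicity near the interface. -/
theorem exists_strip_lower (h : Flat u v e) (hξ : ‖ξ‖ = 1) (hc : 0 < (⟪e, ξ⟫ : ℝ)) (ht : 0 < t)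
    (hm : Mono u v (t • ξ)) {D : ℝ} (hD : 0 ≤ D) :
    ∃ c > 0, ∀ x, infDist x (zs u v) ≤ D → c ≤ u (x + t • ξ) - u x := by
  have he : 0 < ‖e‖ := norm_pos_iff.2 h.ne_zero
  obtain ⟨d0, hd0, hfar⟩ := h.exists_sub_far hξ hc
  set c : ℝ := ⟪e, ξ⟫
  obtain ⟨r0, hr0, haff⟩ := h.exists_affine (η := ‖e‖ / 8) (by positivity)
  obtain ⟨d1, hd1, hsmall⟩ := h.exists_small (η := c * t / 4) (by positivity)
  obtain ⟨C, hC, hlin⟩ := h.exists_linear_bound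
  obtain ⟨A, hA, hcmp⟩ := exists_avk_compare n
  set d := 2 * (d0 + t + r0 + d1 + 1)
  have hd : 0 < d := by positivity
  set r := 2 * (D + d + 1)
  have hr : 0 < r := by positivity
  set M := C * (D + r + 1)
  have hM : 0 < M := by positivity
  have hE := Real.exp_pos (M ^ 2 * r ^ 2 / 2)
  refine ⟨c * t / 4 / (A * r ^ n * Real.exp (M ^ 2 * r ^ 2 / 2)), by positivity, fun x hx => ?_⟩
  obtain ⟨p, hp, hpd⟩ := h.exists_nearest x
  set g : Eu n → ℝ := fun y => u (y + t • ξ) - u y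
  have sg : Smooth g := (h.su.shift _).sub h.su
  have hg0 : ∀ y, 0 ≤ g y := fun y => sub_nonneg.2 (hm y).1
  set y := p + (d / ‖e‖) • e
  have hyp : ‖y - p‖ = d := by
    simp only [y]
    rw [add_sub_cancel_left, norm_smul, Real.norm_of_nonneg (by positivity)]; field_simp
  have hpos : ∀ z, ‖z - y‖ ≤ d / 2 → v z < u z := fun z hz => by
    have e1 : z - p = (z - y) + (d / ‖e‖) • e := by simp only [y]; abel
    have h1 : ‖z - p‖ ≤ 2 * d := by
      have := norm_add_le (z - y) (y - p)
      rw [sub_add_sub_cancel] at this; linarith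
    have h2 := haff p (2 * d) hp (by simp only [d]; linarith) z h1
    have h3 : (⟪e, z - p⟫ : ℝ) = ⟪e, z - y⟫ + d * ‖e‖ := by
      rw [e1, inner_add_right, inner_smul_right, real_inner_self_eq_norm_sq]; field_simp
    have h4 := abs_le.1 ((abs_real_inner_le_norm e (z - y)).trans
      (mul_le_mul_of_nonneg_left hz he.le))
    have : 0 < ‖e‖ * d := by positivity
    rw [abs_le] at h2
    linarith [h2.1, h4.1]
  have hdist : d / 2 ≤ infDist y (zs u v) := by
    obtain ⟨q, hq, hqd⟩ := h.exists_nearest y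
    by_contra! hlt
    have := hpos q (by rw [norm_sub_rev]; linarith)
    linarith
  have h1 : ∀ z ∈ closedBall y 1, c * t / 4 ≤ g z := fun z hz => by
    rw [mem_closedBall, dist_eq_norm] at hz
    have h2 := le_infDist_add (zs u v) y (z - y)
    rw [add_sub_cancel] at h2
    have h3 := hfar z t ht.le (by simp only [d] at hdist; linarith)
    have h4 := hsmall z (by simp only [d] at hdist; linarith)
      (hpos z (by simp only [d]; linarith))
    have h5 := h.pv (z + t • ξ)
    simp only [g]; linarith
  have h2 := le_avk sg.continuous zero_le_one h1
  have h3 := hcmp g y x 1 r sg.continuous hg0 one_pos hr (by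
    have := norm_add_le (y - p) (p - x)
    rw [sub_add_sub_cancel, norm_sub_rev p x] at this
    simp only [r]; linarith)
  have h4 := avk_kQ_le (x := x) (r := r) sg.continuous hg0
  have h5 := avk_le_of_lap_le sg hg0 (sq_nonneg M) x hr.le fun z hz => by
    rw [mem_closedBall, dist_eq_norm] at hz
    have h6 := hlin p (D + r + 1) z hp (by linarith) (by
      have := norm_add_le (z - x) (x - p)
      rw [sub_add_sub_cancel] at this
      linarith)
    have hu := h.pu z
    have hv := h.pv z
    have hu' := h.pu (z + t • ξ)
    have hv' := h.pv (z + t • ξ)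
    rw [lap_sub (h.su.shift _) h.su, lap_shift h.su, h.lu, h.lu]
    have h7 : u (z + t • ξ) * v (z + t • ξ) ^ 2 ≤ u (z + t • ξ) * v z ^ 2 := by
      have := (hm z).2
      gcongr
    have h8 : v z ^ 2 * g z ≤ M ^ 2 * g z :=
      mul_le_mul_of_nonneg_right (pow_le_pow_left₀ hv.le (by linarith) 2) (hg0 z)
    have h9 : v z ^ 2 * g z = u (z + t • ξ) * v z ^ 2 - u z * v z ^ 2 := by simp only [g]; ring
    linarith
  rw [div_one] at h3
  rw [div_le_iff₀ (by positivity)]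
  calc c * t / 4 ≤ A * r ^ n * avk kQ g x r := h2.trans h3
    _ ≤ A * r ^ n * (Real.exp (M ^ 2 * r ^ 2 / 2) * g x) := by
        gcongr; exact h4.trans h5
    _ = _ := by simp only [g]; ring

theorem exists_lipschitz_on (h : Flat u v e) {D : ℝ} (hD : 0 ≤ D) : ∃ L > 0, ∀ x y,
    infDist x (zs u v) ≤ D → ‖y - x‖ ≤ D → |u y - u x| ≤ L * ‖y - x‖ := by
  obtain ⟨L, hL, hb⟩ := h.exists_lipschitz (D := 2 * D) (by linarith)
  refine ⟨n * L + 1, by positivity, fun x y hx hy => ?_⟩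
  have := norm_image_sub_le_of_norm_deriv_le_segment' (f := fun s : ℝ => u (x + s • (y - x)))
    (a := 0) (b := 1) (C := (n * L + 1) * ‖y - x‖)
    (fun s _ => (hasDerivAt_ray h.su x (y - x) s).hasDerivWithinAt)
    (fun s hs => ?_) 1 (Set.right_mem_Icc.2 zero_le_one)
  · simpa using this
  · have h1 := infDist_add_le (zs u v) x (s • (y - x))
    rw [norm_smul, Real.norm_of_nonneg hs.1] at h1
    have h2 : s * ‖y - x‖ ≤ D := by nlinarith [norm_nonneg (y - x), hs.1, hs.2]
    calc _ ≤ ∑ i, ‖(y - x) i * pd i u (x + s • (y - x))‖ := norm_sum_le _ _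
      _ ≤ ∑ i : Fin n, ‖y - x‖ * L := Finset.sum_le_sum fun i _ => by
          rw [norm_mul]
          exact mul_le_mul (PiLp.norm_apply_le _ i) (hb _ (by linarith) i) (norm_nonneg _)
            (norm_nonneg _)
      _ ≤ _ := by
          rw [Finset.sum_const, Finset.card_univ, Fintype.card_fin, nsmul_eq_mul]
          nlinarith [norm_nonneg (y - x)]

theorem exists_mono_half (h : Flat u v e) (hξ : ‖ξ‖ = 1) (hc : 0 < (⟪e, ξ⟫ : ℝ)) (ht : 0 < t)
    (hm : Mono u v (t • ξ)) {D : ℝ} (hD : 0 ≤ D) :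
    ∃ ε > 0, ∀ τ, 0 ≤ τ → τ ≤ t → t - ε ≤ τ → ∀ x, infDist x (zs u v) ≤ D →
      u x ≤ u (x + τ • ξ) := by
  obtain ⟨c, hc0, hlow⟩ := h.exists_strip_lower hξ hc ht hm hD
  obtain ⟨L, hL, hlip⟩ := h.exists_lipschitz_on (D := D + t) (by positivity)
  refine ⟨c / L, by positivity, fun τ h0 h1 h2 x hx => ?_⟩
  have h3 := hlow x hx
  have h4 : ‖x + τ • ξ - (x + t • ξ)‖ = t - τ := by
    rw [add_sub_add_left_eq_sub, ← sub_smul, norm_smul, hξ, mul_one, norm_sub_rev,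
      Real.norm_of_nonneg (by linarith)]
  have h5 := infDist_add_le (zs u v) x (t • ξ)
  rw [norm_smul, hξ, mul_one, Real.norm_of_nonneg ht.le] at h5
  have h6 := hlip (x + t • ξ) (x + τ • ξ) (by linarith) (by rw [h4]; linarith)
  rw [h4] at h6
  have h7 : L * (t - τ) ≤ c := by
    rw [← le_div_iff₀' hL]; linarith
  linarith [(abs_le.1 h6).1]

theorem exists_mono_near (h : Flat u v e) (hξ : ‖ξ‖ = 1) (hc : 0 < (⟪e, ξ⟫ : ℝ)) (ht : 0 < t)
    (hm : Mono u v (t • ξ)) : ∃ ε > 0, ∀ τ, τ ≤ t → t - ε ≤ τ → Mono u v (τ • ξ) := by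
  obtain ⟨d0, hd0, hfar⟩ := h.exists_sub_far hξ hc
  have hD : 0 ≤ d0 + 2 * t := by positivity
  obtain ⟨ε1, h1, hu⟩ := h.exists_mono_half hξ hc ht hm hD
  obtain ⟨ε2, h2, hv⟩ := h.swap.exists_mono_half (ξ := -ξ) (by rwa [norm_neg])
    (by rwa [inner_neg_neg]) ht (by rw [smul_neg]; exact hm.swap) hD
  set c : ℝ := ⟪e, ξ⟫
  refine ⟨min (t / 2) (min ε1 ε2), by positivity, fun τ hτ hτ' =>
    h.toSol.mono_of_sub (κ := c / 2 * (t / 2)) (by positivity) fun x => ?_⟩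
  have e1 : min (t / 2) (min ε1 ε2) ≤ t / 2 := min_le_left _ _
  have e2 : min (t / 2) (min ε1 ε2) ≤ ε1 := (min_le_right _ _).trans (min_le_left _ _)
  have e3 : min (t / 2) (min ε1 ε2) ≤ ε2 := (min_le_right _ _).trans (min_le_right _ _)
  have hτ0 : t / 2 ≤ τ := by linarith
  rcases le_or_gt (infDist x (zs u v)) (d0 + t) with hx | hx
  · left
    refine ⟨hu τ (by linarith) hτ (by linarith) x (by linarith), ?_⟩
    have h3 := infDist_add_le (zs u v) x (τ • ξ)
    rw [norm_smul, hξ, mul_one, Real.norm_of_nonneg (by linarith)] at h3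
    have := hv τ (by linarith) hτ (by linarith) (x + τ • ξ) (by rw [zs_comm]; linarith)
    rwa [smul_neg, add_neg_cancel_right] at this
  · right
    refine le_trans ?_ (hfar x τ (by linarith) (by linarith))
    gcongr

theorem mono_smul (h : Flat u v e) (hξ : ‖ξ‖ = 1) (hc : 0 < (⟪e, ξ⟫ : ℝ)) {τ : ℝ} (hτ : 0 < τ) :
    Mono u v (τ • ξ) := by
  by_contra hn
  obtain ⟨T, hT⟩ := h.exists_mono_large hξ hc
  set B := {s : ℝ | τ ≤ s ∧ ¬ Mono u v (s • ξ)}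
  have hB : τ ∈ B := ⟨le_rfl, hn⟩
  have hbd : BddAbove B := ⟨T, fun s hs => by
    by_contra! hlt
    exact hs.2 (hT s hlt.le)⟩
  set t := sSup B
  have hτt : τ ≤ t := le_csSup hbd hB
  have habove : ∀ s, t < s → Mono u v (s • ξ) := fun s hs => by
    by_contra hns
    exact absurd (le_csSup hbd (show s ∈ B from ⟨by linarith, hns⟩)) (not_le.2 hs)
  have hcu := h.su.continuous
  have hcv := h.sv.continuous
  have hmt : Mono u v (t • ξ) := fun x => by
    have hl : ∀ f : Eu n → ℝ, Continuous f → Filter.Tendsto (fun s : ℝ => f (x + s • ξ))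
        (nhdsWithin t (Set.Ioi t)) (nhds (f (x + t • ξ))) := fun f hf => by
      have : Continuous fun s : ℝ => f (x + s • ξ) := by fun_prop
      exact (this.tendsto t).mono_left nhdsWithin_le_nhds
    refine ⟨ge_of_tendsto (hl u hcu) ?_, le_of_tendsto (hl v hcv) ?_⟩
    · filter_upwards [self_mem_nhdsWithin] with s hs using (habove s hs x).1
    · filter_upwards [self_mem_nhdsWithin] with s hs using (habove s hs x).2
  obtain ⟨ε, hε, hnear⟩ := h.exists_mono_near hξ hc (hτ.trans_le hτt) hmt
  have : t ≤ t - ε := csSup_le ⟨τ, hB⟩ fun s hs => by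
    by_contra! hlt
    rcases le_or_gt s t with h1 | h1
    · exact hs.2 (hnear s h1 hlt.le)
    · exact hs.2 (habove s h1)
  linarith

theorem mono (h : Flat u v e) (hζ : 0 < (⟪e, ζ⟫ : ℝ)) : Mono u v ζ := by
  have h0 : 0 < ‖ζ‖ := norm_pos_iff.2 fun h0 => by rw [h0, inner_zero_right] at hζ; exact hζ.false
  have := h.mono_smul (ξ := ‖ζ‖⁻¹ • ζ) (by rw [norm_smul, norm_inv, norm_norm]; field_simp)
    (by rw [inner_smul_right]; positivity) h0
  rwa [smul_smul, mul_inv_cancel₀ h0.ne', one_smul] at this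

theorem mono_of_inner_eq_zero (h : Flat u v e) (hζ : (⟪e, ζ⟫ : ℝ) = 0) : Mono u v ζ := fun x => by
  have he : 0 < ‖e‖ := norm_pos_iff.2 h.ne_zero
  have hl : ∀ f : Eu n → ℝ, Continuous f → Filter.Tendsto (fun s : ℝ => f (x + (ζ + s • e)))
      (nhdsWithin 0 (Set.Ioi 0)) (nhds (f (x + ζ))) := fun f hf => by
    have : Continuous fun s : ℝ => f (x + (ζ + s • e)) := by fun_prop
    simpa using (this.tendsto 0).mono_left nhdsWithin_le_nhds
  have hm : ∀ s > (0 : ℝ), Mono u v (ζ + s • e) := fun s hs => h.mono (by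
    rw [inner_add_right, hζ, inner_smul_right, real_inner_self_eq_norm_sq]; positivity)
  refine ⟨ge_of_tendsto (hl u h.su.continuous) ?_, le_of_tendsto (hl v h.sv.continuous) ?_⟩
  · filter_upwards [self_mem_nhdsWithin] with s hs using (hm s hs x).1
  · filter_upwards [self_mem_nhdsWithin] with s hs using (hm s hs x).2

theorem add_eq (h : Flat u v e) (hζ : (⟪e, ζ⟫ : ℝ) = 0) (x : Eu n) :
    u (x + ζ) = u x ∧ v (x + ζ) = v x := by
  have h1 := h.mono_of_inner_eq_zero hζ x
  have h2 := h.mono_of_inner_eq_zero (ζ := -ζ) (by rw [inner_neg_right, hζ, neg_zero]) (x + ζ)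
  rw [add_neg_cancel_right] at h2
  exact ⟨le_antisymm h2.1 h1.1, le_antisymm h1.2 h2.2⟩

theorem exists_profile (h : Flat u v e) : ∃ e' : Eu n, ‖e'‖ = 1 ∧
    ∃ f g : ℝ → ℝ, ∀ x, u x = f ⟪x, e'⟫ ∧ v x = g ⟪x, e'⟫ := by
  have he : 0 < ‖e‖ := norm_pos_iff.2 h.ne_zero
  set e' := ‖e‖⁻¹ • e
  refine ⟨e', by rw [norm_smul, norm_inv, norm_norm]; field_simp, fun s => u (s • e'),
    fun s => v (s • e'), fun x => ?_⟩
  have h1 : (⟪e, x - (⟪x, e'⟫ : ℝ) • e'⟫ : ℝ) = 0 := by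
    simp only [e', inner_sub_right, inner_smul_right, real_inner_self_eq_norm_sq,
      real_inner_comm e x]
    field_simp
    ring
  have := h.add_eq h1 ((⟪x, e'⟫ : ℝ) • e')
  rwa [add_sub_cancel] at this

end Flat
end Sliding

/-- A locally minimizing solution of Δu = u v², Δv = v u², u,v > 0 on ℝⁿ (n ≥ 2) with linear
growth at infinity is one dimensional. -/
theorem one_dimensional_symmetry {n : ℕ} (hn : 2 ≤ n)
    (u v : EuclideanSpace ℝ (Fin n) → ℝ)
    (hsol : IsSolution u v) (hmin : IsLocalMinimizer u v)
    (C : ℝ) (hC : 0 < C) (hgrowth : ∀ x, u x + v x ≤ C * (1 + ‖x‖)) :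
    ∃ e : EuclideanSpace ℝ (Fin n), ‖e‖ = 1 ∧
      ∃ f g : ℝ → ℝ, ∀ x, u x = f ⟪x, e⟫ ∧ v x = g ⟪x, e⟫ := by
  have h := sol_of_isLocalMinimizer hsol hmin hC hgrowth
  obtain ⟨e, he⟩ := h.exists_grd_tendsto
  exact Flat.exists_profile ⟨h, he⟩
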